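/- For every n ≥ 4, the subgroup of inner automorphisms of the braid group B_n has index 2 in the full automorphism group of B_n; that is, the range of the conjugation homomorphism MulAut.conj : B_n →* MulAut B_n has index 2 in MulAut B_n (equivalently, the outer automorphism group Out(B_n) has order 2). -/

import Mathlib

/-- The braid relations on `n` strands, as elements of the free group on `Fin (n-1)`. -/
def braidRels (n : ℕ) : Set (FreeGroup (Fin (n - 1))) :=
  {r | ∃ i j : Fin (n - 1), 2 ≤ |(i : ℤ) - (j : ℤ)| ∧
      r = FreeGroup.of i * FreeGroup.of j * (FreeGroup.of j * FreeGroup.of i)⁻¹} ∪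
  {r | ∃ i j : Fin (n - 1), |(i : ℤ) - (j : ℤ)| = 1 ∧
      r = FreeGroup.of i * FreeGroup.of j * FreeGroup.of i *
        (FreeGroup.of j * FreeGroup.of i * FreeGroup.of j)⁻¹}

/-- The braid group on `n` strands. -/
abbrev B (n : ℕ) : Type := PresentedGroup (braidRels n)

/-- The standard generators of the braid group. -/
def σ {n : ℕ} (i : Fin (n - 1)) : B n := PresentedGroup.of i

namespace BraidGroup

open Equiv

theorem inv_app_self' {α : Type*} (p : Perm α) (a : α) : p⁻¹ (p a) = a := p.symm_apply_apply a

theorem app_inv_self' {α : Type*} (p : Perm α) (a : α) : p (p⁻¹ a) = a := p.apply_symm_apply a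

/-- The `i`-th standard generator of `B n`, indexed by all natural numbers
(trivial out of range). -/
def s (n i : ℕ) : B n := if h : i < n - 1 then σ ⟨i, h⟩ else 1

theorem s_of_le {n i : ℕ} (h : n ≤ i + 1) : s n i = 1 := dif_neg (by omega)

theorem s_comm {n i j : ℕ} (hij : i + 2 ≤ j) : s n i * s n j = s n j * s n i := by
  by_cases hj : j < n - 1
  · have hi : i < n - 1 := by omega
    rw [s, s, dif_pos hi, dif_pos hj]
    have : (PresentedGroup.mk (braidRels n)
        (FreeGroup.of ⟨i, hi⟩ * FreeGroup.of ⟨j, hj⟩ *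
          (FreeGroup.of ⟨j, hj⟩ * FreeGroup.of ⟨i, hi⟩)⁻¹)) = 1 := by
      apply PresentedGroup.one_of_mem
      left
      refine ⟨⟨i, hi⟩, ⟨j, hj⟩, ?_, rfl⟩
      rw [abs_of_neg] <;> simp <;> omega
    rw [map_mul, map_inv, mul_inv_eq_one, map_mul, map_mul] at this
    exact this
  · rw [s_of_le (i := j) (by omega)]; simp

theorem s_braid {n i : ℕ} (hi : i + 2 < n) :
    s n i * s n (i + 1) * s n i = s n (i + 1) * s n i * s n (i + 1) := by
  have hi' : i < n - 1 := by omega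
  have hj : i + 1 < n - 1 := by omega
  rw [s, s, dif_pos hi', dif_pos hj]
  have : (PresentedGroup.mk (braidRels n)
      (FreeGroup.of ⟨i, hi'⟩ * FreeGroup.of ⟨i + 1, hj⟩ * FreeGroup.of ⟨i, hi'⟩ *
        (FreeGroup.of ⟨i + 1, hj⟩ * FreeGroup.of ⟨i, hi'⟩ * FreeGroup.of ⟨i + 1, hj⟩)⁻¹)) = 1 := by
    apply PresentedGroup.one_of_mem
    right
    exact ⟨⟨i, hi'⟩, ⟨i + 1, hj⟩, by simp, rfl⟩
  rw [map_mul, map_inv, mul_inv_eq_one, map_mul, map_mul, map_mul, map_mul] at this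
  exact this

/-- A family of elements of a group satisfying the braid relations on `n` strands. -/
structure IsBraidFamily {G : Type*} [Group G] (n : ℕ) (f : ℕ → G) : Prop where
  comm : ∀ i j, i + 2 ≤ j → j + 1 < n → f i * f j = f j * f i
  braid : ∀ i, i + 2 < n → f i * f (i + 1) * f i = f (i + 1) * f i * f (i + 1)

theorem isBraidFamily_s (n : ℕ) : IsBraidFamily n (s n) :=
  ⟨fun _ _ h _ => s_comm h, fun _ h => s_braid h⟩

theorem IsBraidFamily.mono {G : Type*} [Group G] {k n : ℕ} {f : ℕ → G}
    (h : IsBraidFamily n f) (hk : k ≤ n) : IsBraidFamily k f :=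
  ⟨fun i j hij hj => h.comm i j hij (by omega), fun i hi => h.braid i (by omega)⟩

/-- The homomorphism out of `B n` defined by a family satisfying the braid relations. -/
def lift {G : Type*} [Group G] {n : ℕ} {f : ℕ → G} (hf : IsBraidFamily n f) : B n →* G :=
  PresentedGroup.toGroup (f := fun i : Fin (n - 1) => f i) <| by
    rintro r (⟨i, j, hij, rfl⟩ | ⟨i, j, hij, rfl⟩)
    · simp only [map_mul, map_inv, FreeGroup.lift_apply_of, mul_inv_eq_one]
      have hi := i.2
      have hj := j.2
      rcases le_abs.1 hij with h | h
      · exact (hf.comm j i (by omega) (by omega)).symm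
      · exact hf.comm i j (by omega) (by omega)
    · simp only [map_mul, map_inv, FreeGroup.lift_apply_of, mul_inv_eq_one]
      have hi := i.2
      have hj := j.2
      rcases (abs_eq (by norm_num)).1 hij with h | h
      · have : (i : ℕ) = j + 1 := by omega
        rw [this]
        exact (hf.braid j (by omega)).symm
      · have : (j : ℕ) = i + 1 := by omega
        rw [this]
        exact hf.braid i (by omega)

theorem lift_s {G : Type*} [Group G] {n : ℕ} {f : ℕ → G} (hf : IsBraidFamily n f) {i : ℕ}
    (hi : i + 1 < n) : lift hf (s n i) = f i := by
  have h : i < n - 1 := by omega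
  rw [s, dif_pos h]
  exact PresentedGroup.toGroup.of _

theorem hom_ext {G : Type*} [Group G] {n : ℕ} {f g : B n →* G}
    (h : ∀ i, i + 1 < n → f (s n i) = g (s n i)) : f = g := by
  apply PresentedGroup.ext
  rintro ⟨i, hi⟩
  have := h i (by omega)
  rwa [s, dif_pos hi] at this

theorem closure_s (n : ℕ) : Subgroup.closure (s n '' {i | i + 1 < n}) = ⊤ := by
  rw [eq_top_iff, ← PresentedGroup.closure_range_of, Subgroup.closure_le]
  rintro _ ⟨⟨i, hi⟩, rfl⟩
  apply Subgroup.subset_closure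
  exact ⟨i, by simp; omega, by rw [s, dif_pos hi]; rfl⟩

theorem braid_induction {n : ℕ} {p : B n → Prop} (b : B n) (one : p 1)
    (gen : ∀ i, i + 1 < n → ∀ b, p b → p (s n i * b))
    (inv : ∀ i, i + 1 < n → ∀ b, p b → p ((s n i)⁻¹ * b)) : p b := by
  have hb : b ∈ Subgroup.closure (s n '' {i | i + 1 < n}) := by rw [closure_s]; trivial
  induction hb using Subgroup.closure_induction_left with
  | one => exact one
  | mul_left x hx y _ hy => obtain ⟨i, hi, rfl⟩ := hx; exact gen i hi y hy
  | inv_mul_cancel x hx y _ hy => obtain ⟨i, hi, rfl⟩ := hx; exact inv i hi y hy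

/-- A subgroup containing all generators is everything. -/
theorem mem_of_s_mem {n : ℕ} (H : Subgroup (B n)) (h : ∀ i, i + 1 < n → s n i ∈ H) (b : B n) :
    b ∈ H := by
  have : Subgroup.closure (s n '' {i | i + 1 < n}) ≤ H := by
    rw [Subgroup.closure_le]
    rintro _ ⟨i, hi, rfl⟩
    exact h i hi
  rw [closure_s] at this
  exact this trivial

theorem isBraidFamily_swap (n : ℕ) : IsBraidFamily n (fun i => swap i (i + 1)) := by
  constructor
  · intro i j hij _
    ext x
    simp only [Perm.mul_apply, swap_apply_def]
    split_ifs <;> omega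
  · intro i _
    ext x
    simp only [Perm.mul_apply, swap_apply_def]
    split_ifs <;> omega

/-- The permutation underlying a braid. -/
def perm (n : ℕ) : B n →* Perm ℕ := lift (isBraidFamily_swap n)

theorem perm_s {n i : ℕ} (hi : i + 1 < n) : perm n (s n i) = swap i (i + 1) := lift_s _ hi

theorem perm_apply_of_le {n : ℕ} (b : B n) {u : ℕ} (hu : n ≤ u) : perm n b u = u := by
  have := mem_of_s_mem ((MulAction.stabilizer (Perm ℕ) u).comap (perm n)) (fun i hi => by
    rw [Subgroup.mem_comap, perm_s hi, MulAction.mem_stabilizer_iff, Perm.smul_def]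
    exact swap_apply_of_ne_of_ne (by omega) (by omega)) b
  exact this

theorem perm_apply_lt {n : ℕ} (b : B n) {u : ℕ} (hu : u < n) : perm n b u < n := by
  by_contra h
  have h1 := perm_apply_of_le b (not_lt.1 h)
  have := (perm n b).injective h1
  omega

theorem perm_lt_iff {n : ℕ} (b : B n) {u : ℕ} : perm n b u < n ↔ u < n := by
  refine ⟨fun h => ?_, perm_apply_lt b⟩
  by_contra hu
  rw [perm_apply_of_le b (not_lt.1 hu)] at h
  exact hu h

/-- The exponent sum of a braid. -/
def expo (n : ℕ) : B n →* Multiplicative ℤ :=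
  lift (f := fun _ => Multiplicative.ofAdd 1) ⟨fun _ _ _ _ => rfl, fun _ _ => rfl⟩

theorem expo_s {n i : ℕ} (hi : i + 1 < n) : expo n (s n i) = Multiplicative.ofAdd 1 := lift_s _ hi

/-- The inclusion of the braid group on the first `k` strands. -/
def incl {k n : ℕ} (h : k ≤ n) : B k →* B n := lift ((isBraidFamily_s n).mono h)

theorem incl_s {k n i : ℕ} (h : k ≤ n) (hi : i + 1 < k) : incl h (s k i) = s n i := lift_s _ hi

theorem perm_incl {k n : ℕ} (h : k ≤ n) (b : B k) : perm n (incl h b) = perm k b := by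
  have : (perm n).comp (incl h) = perm k := hom_ext fun i hi => by
    rw [MonoidHom.comp_apply, incl_s h hi, perm_s (by omega), perm_s hi]
  exact DFunLike.congr_fun this b

theorem incl_incl {k l n : ℕ} (h : k ≤ l) (h' : l ≤ n) (b : B k) :
    incl h' (incl h b) = incl (h.trans h') b := by
  have : (incl h').comp (incl h) = incl (h.trans h') := hom_ext fun i hi => by
    rw [MonoidHom.comp_apply, incl_s h hi, incl_s h' (by omega), incl_s _ hi]
  exact DFunLike.congr_fun this b

theorem incl_refl {n : ℕ} (b : B n) : incl le_rfl b = b := by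
  have : incl (le_refl n) = MonoidHom.id _ := hom_ext fun i hi => by
    rw [incl_s _ hi, MonoidHom.id_apply]
  exact DFunLike.congr_fun this b

/-- The unrestricted permutational wreath product. -/
abbrev Wreath (α M : Type*) [MulAction (Perm ℕ) α] [Group M] : Type _ :=
  (α → M) ⋊[(mulAutArrow : Perm ℕ →* MulAut (α → M))] Perm ℕ

theorem Wreath.mul_left {α M : Type*} [MulAction (Perm ℕ) α] [Group M] (a b : Wreath α M) (x : α) :
    (a * b).left x = a.left x * b.left (a.right⁻¹ • x) := rfl

/-- The indicator of the unordered pair `{i, i+1}`. -/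
def adj (i u v : ℕ) : ℤ := if (u = i ∧ v = i + 1) ∨ (u = i + 1 ∧ v = i) then 1 else 0

theorem adj_swap (i u v : ℕ) : adj i (swap i (i + 1) u) (swap i (i + 1) v) = adj i u v := by
  simp only [adj, swap_apply_def]
  grind

theorem isBraidFamily_cross (n : ℕ) : IsBraidFamily n
    (fun i => (⟨fun x => Multiplicative.ofAdd (adj i x.1 x.2), swap i (i + 1)⟩ :
      Wreath (ℕ × ℕ) (Multiplicative ℤ))) := by
  constructor
  · intro i j hij hj
    refine SemidirectProduct.ext (funext fun ⟨u, v⟩ => ?_) ((isBraidFamily_swap n).comm i j hij hj)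
    simp only [Wreath.mul_left, Prod.smul_mk, Perm.smul_def, swap_inv, ← ofAdd_add]
    congr 1
    simp only [adj, swap_apply_def]
    grind
  · intro i hi
    refine SemidirectProduct.ext (funext fun ⟨u, v⟩ => ?_) ((isBraidFamily_swap n).braid i hi)
    simp only [Wreath.mul_left, SemidirectProduct.mul_right, mul_inv_rev, Prod.smul_mk,
      Perm.smul_def, swap_inv, Perm.mul_apply, ← ofAdd_add]
    congr 1
    have hc : ∀ w, w = i ∨ w = i + 1 ∨ w = i + 2 ∨ (w ≠ i ∧ w ≠ i + 1 ∧ w ≠ i + 2) := by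
      intro w; omega
    have e1 : ∀ x : ℕ, (x = x + 1 + 1) = False := fun x => eq_false (by omega)
    have e2 : ∀ x : ℕ, (x + 1 + 1 = x) = False := fun x => eq_false (by omega)
    rcases hc u with rfl | rfl | rfl | ⟨h1, h2, h3⟩ <;>
    rcases hc v with rfl | rfl | rfl | ⟨h4, h5, h6⟩ <;>
    simp [adj, swap_apply_def, *]

/-- The crossing cocycle. -/
def cross (n : ℕ) : B n →* Wreath (ℕ × ℕ) (Multiplicative ℤ) := lift (isBraidFamily_cross n)

theorem cross_right {n : ℕ} (b : B n) : (cross n b).right = perm n b := by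
  have : SemidirectProduct.rightHom.comp (cross n) = perm n := hom_ext fun i hi => by
    rw [MonoidHom.comp_apply, cross, lift_s _ hi, perm_s hi]; rfl
  exact DFunLike.congr_fun this b

/-- The signed number of crossings of the strands of `b` ending at `u` and `v`. -/
def lk {n : ℕ} (b : B n) (u v : ℕ) : ℤ := Multiplicative.toAdd ((cross n b).left (u, v))

theorem lk_one {n : ℕ} (u v : ℕ) : lk (1 : B n) u v = 0 := by
  rw [lk, map_one]; rfl

theorem lk_mul {n : ℕ} (a b : B n) (u v : ℕ) :
    lk (a * b) u v = lk a u v + lk b ((perm n a)⁻¹ u) ((perm n a)⁻¹ v) := by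
  rw [lk, map_mul, Wreath.mul_left, cross_right, toAdd_mul]; rfl

theorem lk_inv {n : ℕ} (a : B n) (u v : ℕ) :
    lk a⁻¹ u v = - lk a (perm n a u) (perm n a v) := by
  have := lk_mul a⁻¹ a u v
  rw [inv_mul_cancel, lk_one, map_inv, inv_inv] at this
  linarith

theorem lk_s {n i : ℕ} (hi : i + 1 < n) (u v : ℕ) : lk (s n i) u v = adj i u v := by
  rw [lk, cross, lift_s _ hi]; rfl

theorem lk_symm {n : ℕ} (b : B n) : ∀ u v, lk b u v = lk b v u := by
  induction b using braid_induction with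
  | one => intro u v; simp [lk_one]
  | gen i hi b ih =>
    intro u v
    rw [lk_mul, lk_mul, ih, lk_s hi, lk_s hi]; congr 1; simp only [adj]; grind
  | inv i hi b ih =>
    intro u v
    rw [lk_mul, lk_mul, ih, lk_inv, lk_inv, lk_s hi, lk_s hi]; congr 2; simp only [adj]; grind

theorem lk_self {n : ℕ} (b : B n) : ∀ u, lk b u u = 0 := by
  induction b using braid_induction with
  | one => intro u; simp [lk_one]
  | gen i hi b ih =>
    intro u
    rw [lk_mul, ih, lk_s hi]; simp only [adj]; grind
  | inv i hi b ih =>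
    intro u
    rw [lk_mul, ih, lk_inv, lk_s hi]; simp only [adj]; grind

theorem lk_of_le {n : ℕ} (b : B n) : ∀ u v, n ≤ v → lk b u v = 0 := by
  induction b using braid_induction with
  | one => intro u v _; simp [lk_one]
  | gen i hi b ih =>
    intro u v hv
    rw [lk_mul, ih _ _ _, lk_s hi]
    · simp only [adj]; grind
    · rw [← map_inv, perm_apply_of_le _ hv]; exact hv
  | inv i hi b ih =>
    intro u v hv
    rw [lk_mul, ih _ _ _, lk_inv, lk_s hi, perm_apply_of_le _ hv]
    · simp only [adj]; grind
    · rw [← map_inv, perm_apply_of_le _ hv]; exact hv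

theorem lk_incl {k n : ℕ} (h : k ≤ n) (b : B k) (u v : ℕ) : lk (incl h b) u v = lk b u v := by
  have : (cross n).comp (incl h) = cross k := hom_ext fun i hi => by
    rw [MonoidHom.comp_apply, incl_s h hi, cross, lift_s _ (by omega), cross, lift_s _ hi]
  rw [lk, lk, ← this]; rfl

theorem odd_lk_iff {n : ℕ} (b : B n) : ∀ u v, u ≠ v →
    (Odd (lk b u v) ↔ ¬ (u < v ↔ (perm n b)⁻¹ u < (perm n b)⁻¹ v)) := by
  have key : ∀ i u v : ℕ, u ≠ v →
      (Odd (adj i u v) ↔ ¬ (u < v ↔ swap i (i + 1) u < swap i (i + 1) v)) := by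
    intro i u v huv
    simp only [adj, swap_apply_def]
    split_ifs <;> grind
  have ne : ∀ (p : Perm ℕ) (u v : ℕ), u ≠ v → p u ≠ p v := fun p u v h => p.injective.ne h
  have logic : ∀ {p q r : Prop}, ((¬ (p ↔ q) ↔ ¬ ¬ (q ↔ r)) ↔ ¬ (p ↔ r)) := by
    intro p q r
    by_cases p <;> by_cases q <;> by_cases r <;> simp [*]
  induction b using braid_induction with
  | one => intro u v _; simp [lk_one]
  | gen i hi b ih =>
    intro u v huv
    have h1 := ih _ _ (ne (perm n (s n i))⁻¹ u v huv)
    rw [lk_mul, Int.odd_add, ← Int.not_odd_iff_even, h1, lk_s hi, key i u v huv, map_mul, perm_s hi,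
      mul_inv_rev, swap_inv, Perm.mul_apply, Perm.mul_apply]
    exact logic
  | inv i hi b ih =>
    intro u v huv
    have h1 := ih _ _ (ne (perm n (s n i)⁻¹)⁻¹ u v huv)
    have h3 : Odd (lk (s n i)⁻¹ u v) ↔ Odd (adj i u v) := by
      rw [lk_inv, lk_s hi, odd_neg, perm_s hi, adj_swap]
    rw [lk_mul, Int.odd_add, ← Int.not_odd_iff_even, h1, h3, key i u v huv, map_mul, map_inv,
      perm_s hi, mul_inv_rev, inv_inv, Perm.mul_apply, Perm.mul_apply]
    exact logic

theorem even_lk {n : ℕ} {b : B n} (hb : perm n b = 1) (u v : ℕ) : Even (lk b u v) := by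
  by_cases h : u = v
  · rw [h, lk_self]; exact Even.zero
  · rw [← Int.not_odd_iff_even, odd_lk_iff b u v h, hb]; simp

theorem lk_mul_of_pure {n : ℕ} {a : B n} (ha : perm n a = 1) (b : B n) (u v : ℕ) :
    lk (a * b) u v = lk a u v + lk b u v := by
  rw [lk_mul, ha]; rfl

theorem lk_inv_of_pure {n : ℕ} {a : B n} (ha : perm n a = 1) (u v : ℕ) :
    lk a⁻¹ u v = - lk a u v := by
  rw [lk_inv, ha]; rfl

theorem lk_conj {n : ℕ} (b : B n) {p : B n} (hp : perm n p = 1) (u v : ℕ) :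
    lk (b * p * b⁻¹) u v = lk p ((perm n b)⁻¹ u) ((perm n b)⁻¹ v) := by
  have h : lk (b * b⁻¹) u v = 0 := by rw [mul_inv_cancel, lk_one]
  rw [lk_mul] at h
  rw [lk_mul, lk_mul, map_mul, hp, mul_one]
  linarith

theorem sum_lk {n : ℕ} (b : B n) : ∑ u : Fin n, ∑ v : Fin n, lk b u v =
    2 * Multiplicative.toAdd (expo n b) := by
  let F : (b : B n) → Perm (Fin n) := fun b =>
    ((perm n b)).subtypePerm (p := fun u => u < n) (fun u => perm_lt_iff b) |> fun e =>
      (Fin.equivSubtype.trans e).trans Fin.equivSubtype.symm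
  have hF : ∀ b u, ((F b u : Fin n) : ℕ) = perm n b u := fun b u => rfl
  have inva : ∀ (f : ℕ → ℕ → ℤ) (c : B n),
      ∑ u : Fin n, ∑ v : Fin n, f (perm n c u) (perm n c v) = ∑ u : Fin n, ∑ v : Fin n, f u v := by
    intro f c
    rw [← Equiv.sum_comp (F c) (fun u : Fin n => ∑ v : Fin n, f u v)]
    refine Finset.sum_congr rfl fun u _ => ?_
    rw [← Equiv.sum_comp (F c) (fun v : Fin n => f (F c u) v)]
    rfl
  have adjsum : ∀ i, i + 1 < n → ∑ u : Fin n, ∑ v : Fin n, adj i u v = 2 := by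
    intro i hi
    have : ∀ u v : Fin n, adj i u v =
        (if u = ⟨i, by omega⟩ then (if v = ⟨i + 1, hi⟩ then 1 else 0) else 0) +
        (if u = ⟨i + 1, hi⟩ then (if v = ⟨i, by omega⟩ then 1 else 0) else 0) := by
      intro u v
      simp only [adj, Fin.ext_iff]
      split_ifs <;> first | rfl | omega
    simp only [this, Finset.sum_add_distrib]
    simp
  have ih' : ∀ c b : B n, ∑ u : Fin n, ∑ v : Fin n, lk (c * b) u v =
      ∑ u : Fin n, ∑ v : Fin n, lk c u v + ∑ u : Fin n, ∑ v : Fin n, lk b u v := by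
    intro c b
    simp only [lk_mul, Finset.sum_add_distrib, ← map_inv, inva (lk b)]
  induction b using braid_induction with
  | one => simp [lk_one]
  | gen i hi b ih =>
    rw [ih', ih, map_mul, expo_s hi]
    simp only [lk_s hi, adjsum i hi, toAdd_mul, toAdd_ofAdd]
    ring
  | inv i hi b ih =>
    have h : ∑ u : Fin n, ∑ v : Fin n, lk (s n i)⁻¹ u v = - 2 := by
      rw [← adjsum i hi]
      simp only [lk_inv, Finset.sum_neg_distrib, lk_s hi]
      rw [inva (adj i)]
    rw [ih', ih, map_mul, map_inv, expo_s hi, h]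
    simp only [toAdd_mul, toAdd_inv, toAdd_ofAdd]
    ring

end BraidGroup

namespace BraidGroup

open Equiv

/-- The free generator `x i`. -/
abbrev x (i : ℕ) : FreeGroup ℕ := FreeGroup.of i

/-- The Artin automorphism attached to the `i`-th generator. -/
def artinFun (i : ℕ) : FreeGroup ℕ →* FreeGroup ℕ := FreeGroup.lift fun k =>
  if k = i then (x i)⁻¹ * x (i + 1) * x i else if k = i + 1 then x i else x k

/-- The inverse of `artinFun i`. -/
def artinInv (i : ℕ) : FreeGroup ℕ →* FreeGroup ℕ := FreeGroup.lift fun k =>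
  if k = i then x (i + 1) else if k = i + 1 then x (i + 1) * x i * (x (i + 1))⁻¹ else x k

theorem artinFun_self {i k : ℕ} (h : k = i) :
    artinFun i (x k) = (x i)⁻¹ * x (i + 1) * x i := by
  simp [artinFun, h]

theorem artinFun_succ {i k : ℕ} (h : k = i + 1) : artinFun i (x k) = x i := by
  simp [artinFun, h]

theorem artinFun_ne {i k : ℕ} (h : k ≠ i ∧ k ≠ i + 1) : artinFun i (x k) = x k := by
  simp [artinFun, h.1, h.2]

theorem artinInv_self {i k : ℕ} (h : k = i) : artinInv i (x k) = x (i + 1) := by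
  simp [artinInv, h]

theorem artinInv_succ {i k : ℕ} (h : k = i + 1) :
    artinInv i (x k) = x (i + 1) * x i * (x (i + 1))⁻¹ := by
  simp [artinInv, h]

theorem artinInv_ne {i k : ℕ} (h : k ≠ i ∧ k ≠ i + 1) : artinInv i (x k) = x k := by
  simp [artinInv, h.1, h.2]

/-- The Artin automorphism attached to the `i`-th generator. -/
def artinGen (i : ℕ) : MulAut (FreeGroup ℕ) :=
  MonoidHom.toMulEquiv (artinFun i) (artinInv i)
    (by
      ext k
      rcases (by omega : k = i ∨ k = i + 1 ∨ (k ≠ i ∧ k ≠ i + 1)) with h | h | h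
      · simp (disch := omega) only [MonoidHom.comp_apply, artinFun_self, map_mul, map_inv,
          artinInv_self, artinInv_succ, MonoidHom.id_apply, h]
        group
      · simp (disch := omega) only [MonoidHom.comp_apply, artinFun_succ,
          artinInv_self, MonoidHom.id_apply, h]
      · simp (disch := omega) only [MonoidHom.comp_apply, artinFun_ne,
          artinInv_ne, MonoidHom.id_apply])
    (by
      ext k
      rcases (by omega : k = i ∨ k = i + 1 ∨ (k ≠ i ∧ k ≠ i + 1)) with h | h | h
      · simp (disch := omega) only [MonoidHom.comp_apply, artinInv_self,
          artinFun_succ, MonoidHom.id_apply, h]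
      · simp (disch := omega) only [MonoidHom.comp_apply, artinInv_succ, map_mul, map_inv,
          artinFun_self, artinFun_succ, MonoidHom.id_apply, h]
        group
      · simp (disch := omega) only [MonoidHom.comp_apply, artinFun_ne,
          artinInv_ne, MonoidHom.id_apply])

theorem artinGen_apply (i : ℕ) (f : FreeGroup ℕ) : artinGen i f = artinFun i f := rfl

theorem mulAut_ext_of {f g : MulAut (FreeGroup ℕ)} (h : ∀ k, f (x k) = g (x k)) : f = g := by
  have : f.toMonoidHom = g.toMonoidHom := FreeGroup.ext_hom _ _ h
  ext y
  exact DFunLike.congr_fun this y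

theorem isBraidFamily_artinGen (n : ℕ) : IsBraidFamily n artinGen := by
  constructor
  · intro i j hij _
    refine mulAut_ext_of fun k => ?_
    rcases (by omega : k = i ∨ k = i + 1 ∨ k = j ∨ k = j + 1 ∨
      (k ≠ i ∧ k ≠ i + 1 ∧ k ≠ j ∧ k ≠ j + 1)) with h | h | h | h | h <;>
    simp (disch := omega) only [MulAut.mul_apply, artinGen_apply, artinFun_self, artinFun_succ,
      artinFun_ne, map_mul, map_inv, h]
  · intro i _
    refine mulAut_ext_of fun k => ?_
    rcases (by omega : k = i ∨ k = i + 1 ∨ k = i + 2 ∨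
      (k ≠ i ∧ k ≠ i + 1 ∧ k ≠ i + 2)) with h | h | h | h <;>
    simp (disch := omega) only [MulAut.mul_apply, artinGen_apply, artinFun_self, artinFun_succ,
      artinFun_ne, map_mul, map_inv, h]
    group

/-- The Artin action of `B m` on a free group. -/
def artin (m : ℕ) : B m →* MulAut (FreeGroup ℕ) := lift (isBraidFamily_artinGen m)

theorem artin_s {m i : ℕ} (hi : i + 1 < m) (f : FreeGroup ℕ) :
    artin m (s m i) f = artinFun i f := by
  rw [artin, lift_s _ hi]; rfl

theorem artin_incl {k n : ℕ} (h : k ≤ n) (b : B k) : artin n (incl h b) = artin k b := by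
  have : (artin n).comp (incl h) = artin k := hom_ext fun i hi => by
    rw [MonoidHom.comp_apply, incl_s h hi, artin, lift_s _ (by omega), artin, lift_s _ hi]
  exact DFunLike.congr_fun this b

/-- The semidirect product of a free group by `B m` along the Artin action. -/
abbrev FB (m : ℕ) : Type := FreeGroup ℕ ⋊[artin m] B m

open SemidirectProduct (inl inr)

theorem inr_mul_inl {m : ℕ} (b : B m) (f : FreeGroup ℕ) :
    (inr b : FB m) * inl f = inl (artin m b f) * inr b := by
  rw [SemidirectProduct.inl_aut]; simp

theorem swap_left {i u : ℕ} (h : u = i) : swap i (i + 1) u = i + 1 := by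
  rw [h, swap_apply_left]

theorem swap_right {i u : ℕ} (h : u = i + 1) : swap i (i + 1) u = i := by
  rw [h, swap_apply_right]

theorem swap_ne {i u : ℕ} (h : u ≠ i ∧ u ≠ i + 1) : swap i (i + 1) u = u :=
  swap_apply_of_ne_of_ne h.1 h.2

/-- The labels of the wreath recursion. -/
def lab (m j u : ℕ) : FB m :=
  if m < u then 1 else if j + 1 < u then inr (s m j) else if u = j + 1 then inl (x j)
  else if u = j then 1 else inr (s m (j - 1))

theorem lab_big {m j u : ℕ} (h : m < u) : lab m j u = 1 := if_pos h

theorem lab_gt {m j u : ℕ} (h : j + 1 < u ∧ u ≤ m) : lab m j u = inr (s m j) := by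
  rw [lab, if_neg (by omega), if_pos h.1]

theorem lab_succ {m j u : ℕ} (h : u = j + 1 ∧ u ≤ m) : lab m j u = inl (x j) := by
  rw [lab, if_neg (by omega), if_neg (by omega), if_pos h.1]

theorem lab_self {m j u : ℕ} (h : u = j ∧ u ≤ m) : lab m j u = 1 := by
  rw [lab, if_neg (by omega), if_neg (by omega), if_neg (by omega), if_pos h.1]

theorem lab_lt {m j u : ℕ} (h : u < j ∧ u ≤ m) : lab m j u = inr (s m (j - 1)) := by
  rw [lab, if_neg (by omega), if_neg (by omega), if_neg (by omega), if_neg (by omega)]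

theorem isBraidFamily_wreath (m : ℕ) : IsBraidFamily (m + 1)
    (fun j => (⟨lab m j, swap j (j + 1)⟩ : Wreath ℕ (FB m))) := by
  constructor
  · intro i j hij hj
    refine SemidirectProduct.ext (funext fun u => ?_) ((isBraidFamily_swap _).comm i j hij hj)
    simp only [Wreath.mul_left, Perm.smul_def, swap_inv]
    rcases (by omega : m < u ∨ (j + 1 < u ∧ u ≤ m) ∨ u = j + 1 ∨ u = j ∨ (i + 1 < u ∧ u < j) ∨
      u = i + 1 ∨ u = i ∨ u < i) with h | h | h | h | h | h | h | h <;>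
    simp (disch := omega) only [swap_left, swap_right, swap_ne, lab_big, lab_gt, lab_succ, lab_self,
      lab_lt, mul_one, one_mul, inr_mul_inl, artin_s, artinFun_ne, ← map_mul]
    · rw [s_comm hij]
    · rw [s_comm (by omega)]
    · rw [s_comm (by omega)]
  · intro i hi
    refine SemidirectProduct.ext (funext fun u => ?_) ((isBraidFamily_swap _).braid i hi)
    simp only [Wreath.mul_left, SemidirectProduct.mul_right, mul_inv_rev, Perm.smul_def, swap_inv,
      Perm.mul_apply]
    rcases (by omega : m < u ∨ (i + 2 < u ∧ u ≤ m) ∨ u = i + 2 ∨ u = i + 1 ∨ u = i ∨ u < i)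
      with h | h | h | h | h | h <;>
    simp (disch := omega) only [swap_left, swap_right, swap_ne, lab_big, lab_gt, lab_succ, lab_self,
      lab_lt, mul_one, one_mul, inr_mul_inl, artin_s, artinFun_succ]
    · simp only [← map_mul]
      rw [s_braid (by omega)]
    · simp (disch := omega) only [Nat.add_sub_cancel, mul_assoc, inr_mul_inl, artin_s,
        artinFun_self]
      simp (disch := omega) only [← mul_assoc]
      simp only [← map_mul, mul_assoc, mul_inv_cancel_left]
    · simp only [Nat.add_sub_cancel]
    · simp only [Nat.add_sub_cancel]
    · obtain ⟨k, rfl⟩ : ∃ k, i = k + 1 := ⟨i - 1, by omega⟩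
      simp only [Nat.add_sub_cancel, ← map_mul]
      rw [s_braid (by omega)]

/-- The wreath recursion. -/
def wr (m : ℕ) : B (m + 1) →* Wreath ℕ (FB m) := lift (isBraidFamily_wreath m)

theorem wr_right {m : ℕ} (b : B (m + 1)) : (wr m b).right = perm (m + 1) b := by
  have : SemidirectProduct.rightHom.comp (wr m) = perm (m + 1) := hom_ext fun i hi => by
    rw [MonoidHom.comp_apply, wr, lift_s _ hi, perm_s hi]; rfl
  exact DFunLike.congr_fun this b

theorem wr_s {m j : ℕ} (hj : j < m) (u : ℕ) : (wr m (s (m + 1) j)).left u = lab m j u := by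
  rw [wr, lift_s _ (by omega)]

theorem wr_mul {m : ℕ} (a b : B (m + 1)) (u : ℕ) :
    (wr m (a * b)).left u = (wr m a).left u * (wr m b).left ((perm (m + 1) a)⁻¹ u) := by
  rw [map_mul, Wreath.mul_left, wr_right]; rfl

end BraidGroup

namespace BraidGroup

open Equiv
open SemidirectProduct (inl inr)

/-- The product `s i * s (i+1) * ⋯ * s (m-1)` in `B (m+1)`. -/
def tail (m i : ℕ) : B (m + 1) := ((List.range' i (m - i)).map (s (m + 1))).prod

theorem tail_self (m : ℕ) : tail m m = 1 := by simp [tail]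

theorem tail_eq {m i : ℕ} (h : i < m) : tail m i = s (m + 1) i * tail m (i + 1) := by
  obtain ⟨k, rfl⟩ : ∃ k, m = i + k + 1 := ⟨m - i - 1, by omega⟩
  rw [tail, tail, show i + k + 1 - i = k + 1 by omega, show i + k + 1 - (i + 1) = k by omega,
    List.range'_succ]
  simp

theorem tail_induction {m : ℕ} {p : ℕ → Prop} (h0 : p m) (h1 : ∀ i, i < m → p (i + 1) → p i)
    {i : ℕ} (hi : i ≤ m) : p i :=
  Nat.decreasingInduction (motive := fun k _ => p k) (fun k hk => h1 k (by omega)) h0 hi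

theorem s_mul_tail_gt {m i j : ℕ} (hi : i ≤ m) (h : j + 1 < i) :
    s (m + 1) j * tail m i = tail m i * s (m + 1) j := by
  revert h
  refine tail_induction (p := fun i => j + 1 < i →
    s (m + 1) j * tail m i = tail m i * s (m + 1) j) ?_ ?_ hi
  · intro _; simp [tail_self]
  · intro i hi ih h
    rw [tail_eq hi, mul_assoc, ← ih (by omega), ← mul_assoc, s_comm (by omega), mul_assoc]

theorem s_mul_tail_lt {m i j : ℕ} (hj : j + 1 < m) (h : i ≤ j) :
    s (m + 1) (j + 1) * tail m i = tail m i * s (m + 1) j := by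
  induction hk : j - i generalizing i with
  | zero =>
    obtain rfl : i = j := by omega
    rw [tail_eq (show i < m by omega), tail_eq hj]
    have := s_mul_tail_gt (show i + 2 ≤ m by omega) (show i + 1 < i + 2 by omega)
    rw [mul_assoc, mul_assoc, ← this]
    simp only [← mul_assoc]
    rw [← s_braid (by omega)]
  | succ k ih =>
    rw [tail_eq (show i < m by omega), mul_assoc, ← ih (i := i + 1) (by omega) (by omega),
      ← mul_assoc,
      ← mul_assoc, ← s_comm (i := i) (j := j + 1) (by omega)]

/-- The images of the free generators in `B (m+1)`. -/
def xbar (m i : ℕ) : B (m + 1) :=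
  if i < m then (tail m (i + 1))⁻¹ * s (m + 1) i ^ 2 * tail m (i + 1) else 1

theorem xbar_of_lt {m i : ℕ} (h : i < m) :
    xbar m i = (tail m (i + 1))⁻¹ * s (m + 1) i ^ 2 * tail m (i + 1) := if_pos h

theorem xbar_of_le {m i : ℕ} (h : m ≤ i) : xbar m i = 1 := if_neg (by omega)

theorem xbar_last (m : ℕ) : xbar (m + 1) m = s (m + 2) m ^ 2 := by
  rw [xbar_of_lt (by omega), tail_self]; simp

theorem s_mul_xbar_gt {m j k : ℕ} (h : j + 1 < k) :
    s (m + 1) j * xbar m k = xbar m k * s (m + 1) j := by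
  by_cases hk : k < m
  · have h1 : Commute (s (m + 1) j) (tail m (k + 1)) := s_mul_tail_gt (by omega) (by omega)
    have h2 : Commute (s (m + 1) j) (s (m + 1) k) := s_comm (by omega)
    rw [xbar_of_lt hk]
    exact ((h1.inv_right.mul_right (h2.pow_right 2)).mul_right h1).eq
  · rw [xbar_of_le (by omega)]; simp

theorem s_mul_xbar_lt {m j k : ℕ} (hj : j + 1 < m) (h : k < j) :
    s (m + 1) j * xbar m k = xbar m k * s (m + 1) j := by
  have h1 : s (m + 1) (j + 1) * tail m (k + 1) = tail m (k + 1) * s (m + 1) j :=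
    s_mul_tail_lt hj (by omega)
  have h2 : s (m + 1) (j + 1) = tail m (k + 1) * s (m + 1) j * (tail m (k + 1))⁻¹ := by
    rw [← h1]; group
  have h3 : Commute (s (m + 1) (j + 1)) (s (m + 1) k ^ 2) :=
    Commute.pow_right (Commute.symm (s_comm (by omega))) 2
  rw [h2] at h3
  have h4 := h3.eq
  rw [xbar_of_lt (by omega)]
  calc _ = (tail m (k + 1))⁻¹ * (tail m (k + 1) * s (m + 1) j * (tail m (k + 1))⁻¹ *
        s (m + 1) k ^ 2) * tail m (k + 1) := by group
    _ = _ := by rw [h4]; group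

theorem s_mul_xbar_succ {m j : ℕ} (hj : j + 1 < m) :
    s (m + 1) j * xbar m (j + 1) = xbar m j * s (m + 1) j := by
  have h1 : s (m + 1) j * tail m (j + 2) = tail m (j + 2) * s (m + 1) j :=
    s_mul_tail_gt (by omega) (by omega)
  have hb := s_braid (n := m + 1) (i := j) (by omega)
  rw [xbar_of_lt hj, xbar_of_lt (by omega), tail_eq (i := j + 1) hj]
  have e1 : s (m + 1) j * (tail m (j + 2))⁻¹ = (tail m (j + 2))⁻¹ * s (m + 1) j :=
    Commute.inv_right h1
  have e2 : (s (m + 1) (j + 1))⁻¹ * s (m + 1) j ^ 2 * s (m + 1) (j + 1) * s (m + 1) j =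
      s (m + 1) j * s (m + 1) (j + 1) ^ 2 := by
    rw [mul_assoc, mul_assoc, inv_mul_eq_iff_eq_mul, pow_two, pow_two]
    generalize s (m + 1) j = a at *
    generalize s (m + 1) (j + 1) = b at *
    calc a * a * (b * a) = a * (a * b * a) := by group
      _ = (a * b * a) * b := by nth_rw 1 [hb]; group
      _ = _ := by rw [hb]; simp only [mul_assoc]
  calc _ = (s (m + 1) j * (tail m (j + 2))⁻¹) * s (m + 1) (j + 1) ^ 2 * tail m (j + 2) := by
        group
    _ = (tail m (j + 2))⁻¹ * (s (m + 1) j * s (m + 1) (j + 1) ^ 2) * tail m (j + 2) := by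
        rw [e1]; group
    _ = (tail m (j + 2))⁻¹ * ((s (m + 1) (j + 1))⁻¹ * s (m + 1) j ^ 2 * s (m + 1) (j + 1)) *
        (s (m + 1) j * tail m (j + 2)) := by rw [← e2]; group
    _ = _ := by rw [h1]; group

theorem s_mul_xbar_self {m j : ℕ} (hj : j + 1 < m) :
    s (m + 1) j * xbar m j = (xbar m j)⁻¹ * xbar m (j + 1) * xbar m j * s (m + 1) j := by
  have h1 : s (m + 1) j * tail m (j + 2) = tail m (j + 2) * s (m + 1) j :=
    s_mul_tail_gt (by omega) (by omega)
  have h0 := s_mul_xbar_succ hj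
  have hb := s_braid (n := m + 1) (i := j) (by omega)
  have hx : xbar m j = s (m + 1) j * xbar m (j + 1) * (s (m + 1) j)⁻¹ := by rw [h0]; group
  have e1 : s (m + 1) j * xbar m (j + 1) * s (m + 1) j * xbar m (j + 1) =
      xbar m (j + 1) * s (m + 1) j * xbar m (j + 1) * s (m + 1) j := by
    have h2 : s (m + 1) j = (tail m (j + 2))⁻¹ * s (m + 1) j * tail m (j + 2) := by
      rw [mul_assoc, h1]; group
    rw [h2, xbar_of_lt hj]
    generalize s (m + 1) j = a at *
    generalize s (m + 1) (j + 1) = b at *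
    have : a * b ^ 2 * a * b ^ 2 = b ^ 2 * a * b ^ 2 * a := by
      simp only [pow_two]
      have h3 : a * (b * b) * a * (b * b) = a * b * a * (b * a * b) := by
        calc _ = a * b * (b * a * b) * b := by group
          _ = _ := by nth_rw 1 [← hb]; group
      have h4 : b * b * a * (b * b) * a = b * a * b * (a * b * a) := by
        calc _ = b * (b * a * b) * b * a := by group
          _ = _ := by nth_rw 1 [← hb]; group
      rw [h3, h4, hb]
    calc _ = (tail m (j + 2))⁻¹ * (a * b ^ 2 * a * b ^ 2) * tail m (j + 2) := by group
      _ = _ := by rw [this]; group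
  rw [hx]
  generalize s (m + 1) j = a at *
  generalize xbar m (j + 1) = b at *
  calc a * (a * b * a⁻¹) = a * b⁻¹ * a⁻¹ * (a * b * a * b) * a⁻¹ := by group
    _ = _ := by rw [e1]; group

/-- The map from the free group to `B (m+1)`; it kills the generators out of range. -/
def pf (m : ℕ) : FreeGroup ℕ →* B (m + 1) := FreeGroup.lift (xbar m)

theorem pf_x (m i : ℕ) : pf m (x i) = xbar m i := by simp [pf]

/-- The inclusion `B m → B (m+1)`. -/
abbrev up {m : ℕ} : B m →* B (m + 1) := incl (Nat.le_succ m)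

theorem up_s {m i : ℕ} (hi : i + 1 < m) : up (s m i) = s (m + 1) i := incl_s _ hi

theorem up_mul_pf {m : ℕ} (b : B m) (f : FreeGroup ℕ) :
    up b * pf m f * (up b)⁻¹ = pf m (artin m b f) := by
  have gen : ∀ i, i + 1 < m → ∀ f, up (s m i) * pf m f * (up (s m i))⁻¹ =
      pf m (artin m (s m i) f) := by
    intro i hi f
    have : (MulAut.conj (up (s m i))).toMonoidHom.comp (pf m) =
        (pf m).comp (artin m (s m i)).toMonoidHom := by
      refine FreeGroup.ext_hom _ _ fun k => ?_
      change up (s m i) * pf m (x k) * (up (s m i))⁻¹ = pf m (artin m (s m i) (x k))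
      rw [artin_s hi, up_s hi, mul_inv_eq_iff_eq_mul]
      rcases (by omega : k = i ∨ k = i + 1 ∨ k < i ∨ i + 1 < k) with h | h | h | h
      · rw [artinFun_self h, h]
        simp only [map_mul, map_inv, pf_x]
        exact s_mul_xbar_self hi
      · rw [artinFun_succ h, h, pf_x, pf_x]
        exact s_mul_xbar_succ hi
      · rw [artinFun_ne (by omega), pf_x]
        exact s_mul_xbar_lt hi h
      · rw [artinFun_ne (by omega), pf_x]
        exact s_mul_xbar_gt h
    exact DFunLike.congr_fun this f
  induction b using braid_induction generalizing f with
  | one => simp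
  | gen i hi b ih =>
    rw [map_mul (artin m), MulAut.mul_apply, ← gen i hi, ← ih, map_mul]; group
  | inv i hi b ih =>
    have := gen i hi (artin m ((s m i)⁻¹ * b) f)
    rw [← MulAut.mul_apply, ← map_mul (artin m), mul_inv_cancel_left, ← ih] at this
    have h : ∀ a b p q : B (m + 1), a * q * a⁻¹ = b * p * b⁻¹ →
        (a⁻¹ * b) * p * (a⁻¹ * b)⁻¹ = q := by
      intro a b p q h
      calc _ = a⁻¹ * (b * p * b⁻¹) * a := by group
        _ = q := by rw [← h]; group
    rw [map_mul, map_inv]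
    exact h _ _ _ _ this

/-- The map `F ⋊ B m → B (m+1)`. -/
def pfb (m : ℕ) : FB m →* B (m + 1) :=
  SemidirectProduct.lift (pf m) up fun b => by
    ext f
    simp only [MonoidHom.comp_apply, MulEquiv.coe_toMonoidHom, MulAut.conj_apply]
    rw [← up_mul_pf]

theorem pfb_inl {m : ℕ} (f : FreeGroup ℕ) : pfb m (inl f) = pf m f :=
  SemidirectProduct.lift_inl _ _ _ _

theorem pfb_inr {m : ℕ} (b : B m) : pfb m (inr b) = up b :=
  SemidirectProduct.lift_inr _ _ _ _

theorem s_mul_tail {m j i : ℕ} (hj : j < m) (hi : i ≤ m) :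
    s (m + 1) j * tail m i = tail m (swap j (j + 1) i) * pfb m (lab m j (swap j (j + 1) i)) := by
  rcases (by omega : i = j ∨ i = j + 1 ∨ i < j ∨ j + 1 < i) with h | h | h | h
  · rw [swap_left h, lab_succ ⟨rfl, by omega⟩, pfb_inl, pf_x, xbar_of_lt hj, h, tail_eq hj, pow_two]
    group
  · rw [swap_right h, lab_self ⟨rfl, by omega⟩, map_one, mul_one, h, tail_eq hj]
  · rw [swap_ne (by omega), lab_lt (by omega), pfb_inr, up_s (by omega)]
    obtain ⟨k, rfl⟩ : ∃ k, j = k + 1 := ⟨j - 1, by omega⟩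
    exact s_mul_tail_lt hj (by omega)
  · rw [swap_ne (by omega), lab_gt (by omega), pfb_inr, up_s (by omega)]
    exact s_mul_tail_gt hi h

theorem mul_tail {m i : ℕ} (b : B (m + 1)) (hi : i ≤ m) :
    b * tail m i = tail m (perm _ b i) * pfb m ((wr m b).left (perm _ b i)) := by
  have mulc : ∀ a b : B (m + 1), (∀ i, i ≤ m →
      a * tail m i = tail m (perm _ a i) * pfb m ((wr m a).left (perm _ a i))) → (∀ i, i ≤ m →
      b * tail m i = tail m (perm _ b i) * pfb m ((wr m b).left (perm _ b i))) → (∀ i, i ≤ m →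
      (a * b) * tail m i = tail m (perm _ (a * b) i) *
        pfb m ((wr m (a * b)).left (perm _ (a * b) i))) := by
    intro a b ha hb i hi
    have h1 : perm _ b i ≤ m := Nat.le_of_lt_succ (perm_apply_lt b (by omega))
    rw [mul_assoc, hb i hi, ← mul_assoc, ha _ h1, wr_mul, map_mul (perm _), Perm.mul_apply,
      inv_app_self', map_mul (pfb m), mul_assoc]
  have gen : ∀ j, j + 1 < m + 1 → ∀ i, i ≤ m → s (m + 1) j * tail m i =
      tail m (perm _ (s (m + 1) j) i) *
        pfb m ((wr m (s (m + 1) j)).left (perm _ (s (m + 1) j) i)) := by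
    intro j hj i hi
    rw [perm_s hj, wr_s (by omega), s_mul_tail (by omega) hi]
  have inv : ∀ j, j + 1 < m + 1 → ∀ i, i ≤ m → (s (m + 1) j)⁻¹ * tail m i =
      tail m (perm _ (s (m + 1) j)⁻¹ i) *
        pfb m ((wr m (s (m + 1) j)⁻¹).left (perm _ (s (m + 1) j)⁻¹ i)) := by
    intro j hj i hi
    have h1 : perm _ (s (m + 1) j)⁻¹ i ≤ m := Nat.le_of_lt_succ (perm_apply_lt _ (by omega))
    have h2 := gen j hj _ h1
    have h3 : perm _ (s (m + 1) j) (perm _ (s (m + 1) j)⁻¹ i) = i := by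
      rw [map_inv, app_inv_self']
    rw [h3] at h2
    have h4 := wr_mul (s (m + 1) j) (s (m + 1) j)⁻¹ i
    rw [mul_inv_cancel, map_one, ← map_inv (perm _)] at h4
    have h5 := eq_inv_of_mul_eq_one_right h4.symm
    rw [h5, map_inv (pfb m), inv_mul_eq_iff_eq_mul, ← mul_assoc, h2]
    group
  induction b using braid_induction generalizing i with
  | one => simp
  | gen j hj b ih => exact mulc _ _ (gen j hj) (fun i hi => ih hi) i hi
  | inv j hj b ih => exact mulc _ _ (inv j hj) (fun i hi => ih hi) i hi

/-- The retraction from braids fixing the last strand to `F ⋊ B m`. -/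
def kap {m : ℕ} (b : B (m + 1)) : FB m := (wr m b).left m

theorem kap_mul {m : ℕ} {a : B (m + 1)} (ha : perm _ a m = m) (b : B (m + 1)) :
    kap (a * b) = kap a * kap b := by
  rw [kap, wr_mul, Perm.inv_eq_iff_eq.2 ha.symm]; rfl

theorem kap_one {m : ℕ} : kap (1 : B (m + 1)) = 1 := by
  rw [kap, map_one]; rfl

theorem kap_inv {m : ℕ} {a : B (m + 1)} (ha : perm _ a m = m) : kap a⁻¹ = (kap a)⁻¹ := by
  apply eq_inv_of_mul_eq_one_right
  rw [← kap_mul ha, mul_inv_cancel, kap_one]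

theorem eq_pfb_kap {m : ℕ} {b : B (m + 1)} (hb : perm _ b m = m) : b = pfb m (kap b) := by
  have := mul_tail b (le_refl m)
  rwa [hb, tail_self, mul_one, one_mul] at this

theorem perm_up_last {m : ℕ} (b : B m) : perm (m + 1) (up b) m = m := by
  rw [perm_incl, perm_apply_of_le _ le_rfl]

theorem kap_up {m : ℕ} (b : B m) : kap (up b) = inr b := by
  have h : ∀ i, i + 1 < m → kap (up (s m i)) = inr (s m i) := fun i hi => by
    rw [up_s hi, kap, wr_s (by omega), lab_gt (by omega)]
  induction b using braid_induction with
  | one => rw [map_one, kap_one, map_one]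
  | gen i hi b ih => rw [map_mul, kap_mul (perm_up_last _), ih, h i hi, map_mul]
  | inv i hi b ih =>
    rw [map_mul, kap_mul (perm_up_last _), ih, map_inv, kap_inv (perm_up_last _), h i hi, map_mul,
      map_inv]

theorem perm_xbar (m i : ℕ) : perm (m + 1) (xbar m i) = 1 := by
  by_cases h : i < m
  · rw [xbar_of_lt h, map_mul, map_mul, map_pow, perm_s (by omega), map_inv, pow_two, swap_mul_self]
    simp
  · rw [xbar_of_le (by omega), map_one]

theorem perm_pf {m : ℕ} (f : FreeGroup ℕ) : perm (m + 1) (pf m f) = 1 := by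
  have : (perm (m + 1)).comp (pf m) = 1 := FreeGroup.ext_hom _ _ fun i => by
    rw [MonoidHom.comp_apply, pf_x, perm_xbar]; rfl
  exact DFunLike.congr_fun this f

theorem xbar_eq {m j : ℕ} (hj : j + 1 < m) :
    xbar m j = up (s m j) * xbar m (j + 1) * (up (s m j))⁻¹ := by
  rw [up_s hj, s_mul_xbar_succ hj]; group

theorem kap_xbar {m i : ℕ} (h : i < m) : kap (xbar m i) = inl (x i) := by
  obtain ⟨k, rfl⟩ : ∃ k, m = k + 1 := ⟨m - 1, by omega⟩
  refine tail_induction (m := k) (p := fun i => kap (xbar (k + 1) i) = inl (x i)) ?_ ?_ (by omega)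
  · rw [xbar_last, pow_two, kap, wr_mul, wr_s (by omega), lab_succ ⟨rfl, by omega⟩,
      perm_s (by omega),
      wr_s (by omega), swap_inv, swap_right rfl, lab_self ⟨rfl, by omega⟩, mul_one]
  · intro i hi ih
    rw [xbar_eq (by omega), kap_mul, kap_mul (perm_up_last _), kap_inv (perm_up_last _), kap_up, ih,
      inr_mul_inl, artin_s (by omega), artinFun_succ rfl, mul_inv_cancel_right]
    rw [map_mul, Perm.mul_apply, perm_xbar, Perm.one_apply, perm_up_last]

/-- The retraction of the free group onto the span of the first `m` generators. -/
def retr (m : ℕ) : FreeGroup ℕ →* FreeGroup ℕ := FreeGroup.lift fun k => if k < m then x k else 1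

theorem retr_x {m k : ℕ} (h : k < m) : retr m (x k) = x k := by simp [retr, h]

theorem retr_x' {m k : ℕ} (h : m ≤ k) : retr m (x k) = 1 := by simp [retr, h]

theorem kap_pf {m : ℕ} (f : FreeGroup ℕ) : kap (pf m f) = inl (retr m f) := by
  have hp : ∀ f, perm (m + 1) (pf m f) m = m := fun f => by rw [perm_pf]; rfl
  let K : FreeGroup ℕ →* FB m := MonoidHom.mk' (fun f => kap (pf m f)) fun a b => by
    rw [map_mul, kap_mul (hp _)]
  have : K = inl.comp (retr m) := FreeGroup.ext_hom _ _ fun i => by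
    change kap (pf m (x i)) = inl (retr m (x i))
    by_cases h : i < m
    · rw [pf_x, kap_xbar h, retr_x h]
    · rw [pf_x, xbar_of_le (by omega), kap_one, retr_x' (by omega), map_one]
  exact DFunLike.congr_fun this f

theorem pf_retr {m : ℕ} (f : FreeGroup ℕ) : pf m (retr m f) = pf m f := by
  have : (pf m).comp (retr m) = pf m := FreeGroup.ext_hom _ _ fun i => by
    rw [MonoidHom.comp_apply]
    by_cases h : i < m
    · rw [retr_x h]
    · rw [retr_x' (by omega), pf_x, xbar_of_le (by omega), map_one]
  exact DFunLike.congr_fun this f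

/-- The free component of a braid fixing the last strand. -/
def fpart {m : ℕ} (b : B (m + 1)) : FreeGroup ℕ := (kap b).left

/-- The braid obtained by forgetting the last strand, when it is fixed. -/
def forget {m : ℕ} (b : B (m + 1)) : B m := (kap b).right

theorem eq_pf_mul_up {m : ℕ} {b : B (m + 1)} (hb : perm _ b m = m) :
    b = pf m (fpart b) * up (forget b) := by
  conv_lhs => rw [eq_pfb_kap hb, ← SemidirectProduct.inl_left_mul_inr_right (kap b)]
  rw [map_mul, pfb_inl, pfb_inr]; rfl

theorem kap_pf_mul_up {m : ℕ} (f : FreeGroup ℕ) (b : B m) :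
    kap (pf m f * up b) = inl (retr m f) * inr b := by
  rw [kap_mul (by rw [perm_pf]; rfl), kap_pf, kap_up]

theorem retr_fpart {m : ℕ} {b : B (m + 1)} (hb : perm _ b m = m) : retr m (fpart b) = fpart b := by
  have : kap b = inl (retr m (fpart b)) * inr (forget b) := by
    conv_lhs => rw [eq_pf_mul_up hb]
    rw [kap_pf_mul_up]
  conv_rhs => rw [fpart, this]
  simp

theorem forget_mul {m : ℕ} {a : B (m + 1)} (ha : perm _ a m = m) (b : B (m + 1)) :
    forget (a * b) = forget a * forget b := by
  rw [forget, kap_mul ha]; rfl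

theorem forget_up {m : ℕ} (b : B m) : forget (up b) = b := by
  rw [forget, kap_up]; rfl

theorem forget_pf {m : ℕ} (f : FreeGroup ℕ) : forget (pf m f) = 1 := by
  rw [forget, kap_pf]; rfl

theorem fpart_pf {m : ℕ} (f : FreeGroup ℕ) : fpart (pf m f) = retr m f := by
  rw [fpart, kap_pf]; rfl

theorem forget_inv {m : ℕ} {a : B (m + 1)} (ha : perm _ a m = m) :
    forget a⁻¹ = (forget a)⁻¹ := by
  rw [forget, kap_inv ha]; rfl

theorem perm_forget {m : ℕ} {b : B (m + 1)} (hb : perm _ b m = m) :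
    perm m (forget b) = perm (m + 1) b := by
  conv_rhs => rw [eq_pf_mul_up hb]
  rw [map_mul, perm_pf, one_mul, perm_incl]

theorem pf_injective {m : ℕ} {f g : FreeGroup ℕ} (hf : retr m f = f) (hg : retr m g = g)
    (h : pf m f = pf m g) : f = g := by
  rw [← hf, ← hg, ← fpart_pf, ← fpart_pf, h]

/-- The exponent sum of `x i`. -/
def fexp (i : ℕ) : FreeGroup ℕ →* Multiplicative ℤ :=
  FreeGroup.lift fun k => if k = i then Multiplicative.ofAdd 1 else 1

theorem lk_xbar {m k : ℕ} (hk : k < m) : ∀ i j, i < j → lk (xbar m k) i j =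
    if j = m ∧ i = k then 2 else 0 := by
  obtain ⟨l, rfl⟩ : ∃ l, m = l + 1 := ⟨m - 1, by omega⟩
  refine tail_induction (m := l) (p := fun k => ∀ i j, i < j → lk (xbar (l + 1) k) i j =
    if j = l + 1 ∧ i = k then 2 else 0) ?_ ?_ (Nat.le_of_lt_succ hk)
  · intro i j hij
    rw [xbar_last, pow_two, lk_mul, perm_s (by omega), lk_s (by omega), swap_inv, lk_s (by omega),
      adj_swap, adj]
    split_ifs <;> omega
  · intro k hk ih i j hij
    rw [xbar_eq (by omega), lk_conj _ (perm_xbar _ _), up_s (by omega), perm_s (by omega), swap_inv]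
    rcases lt_or_ge (swap k (k + 1) i) (swap k (k + 1) j) with h | h
    · rw [ih _ _ h]
      simp only [swap_apply_def]
      split_ifs <;> omega
    · rw [lk_symm, ih _ _ (lt_of_le_of_ne h ((swap k (k + 1)).injective.ne hij.ne'))]
      revert h
      simp only [swap_apply_def]
      split_ifs <;> omega

theorem lk_pf {m : ℕ} (f : FreeGroup ℕ) (i j : ℕ) (hij : i < j) : lk (pf m f) i j =
    if j = m then 2 * Multiplicative.toAdd (fexp i (retr m f)) else 0 := by
  let K : FreeGroup ℕ →* Multiplicative ℤ := MonoidHom.mk'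
    (fun f => Multiplicative.ofAdd (lk (pf m f) i j)) fun a b => by
      rw [map_mul, lk_mul_of_pure (perm_pf _), ofAdd_add]
  let L : FreeGroup ℕ →* Multiplicative ℤ := MonoidHom.mk'
    (fun f => Multiplicative.ofAdd
      (if j = m then 2 * Multiplicative.toAdd (fexp i (retr m f)) else 0)) fun a b => by
      rw [← ofAdd_add, map_mul, map_mul, toAdd_mul]
      split_ifs <;> simp [mul_add]
  have : K = L := FreeGroup.ext_hom _ _ fun k => by
    change Multiplicative.ofAdd (lk (pf m (x k)) i j) = Multiplicative.ofAdd
      (if j = m then 2 * Multiplicative.toAdd (fexp i (retr m (x k))) else 0)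
    congr 1
    rw [pf_x]
    by_cases h : k < m
    · rw [retr_x h, lk_xbar h _ _ hij, fexp, FreeGroup.lift_apply_of]
      split_ifs <;> first | rfl | omega
    · rw [retr_x' (by omega), xbar_of_le (by omega), lk_one]; simp
  exact congrArg Multiplicative.toAdd (DFunLike.congr_fun this f)

end BraidGroup

namespace BraidGroup

open Equiv
open SemidirectProduct (inl inr)

section Free

theorem exists_zpowers_of_subsingleton (H : Type*) [Group H] [IsFreeGroup H]
    [Subsingleton (IsFreeGroup.Generators H)] : ∃ r : H, ∀ a : H, a ∈ Subgroup.zpowers r := by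
  have key : ∃ r : FreeGroup (IsFreeGroup.Generators H), ∀ a, a ∈ Subgroup.zpowers r := by
    obtain h | ⟨⟨i⟩⟩ := isEmpty_or_nonempty (IsFreeGroup.Generators H)
    · exact ⟨1, fun a => by rw [Subsingleton.elim a 1]; exact one_mem _⟩
    · refine ⟨FreeGroup.of i, fun a => ?_⟩
      have ha : a ∈ Subgroup.closure
          (Set.range (FreeGroup.of (α := IsFreeGroup.Generators H))) := by
        rw [FreeGroup.closure_range_of]; trivial
      refine (Subgroup.closure_le _).2 ?_ ha
      rintro _ ⟨j, rfl⟩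
      rw [Subsingleton.elim j i]
      exact Subgroup.mem_zpowers _
  obtain ⟨r, hr⟩ := key
  refine ⟨(IsFreeGroup.toFreeGroup H).symm r, fun a => ?_⟩
  obtain ⟨k, hk⟩ := hr (IsFreeGroup.toFreeGroup H a)
  refine ⟨k, ?_⟩
  apply (IsFreeGroup.toFreeGroup H).injective
  simpa using hk

theorem of_eq_of_commute {X : Type*} {i j : X}
    (h : Commute (FreeGroup.of i) (FreeGroup.of j)) : i = j := by
  classical
  by_contra hij
  have h1 := congrArg (FreeGroup.lift fun k => if k = i then (swap 0 1 : Perm (Fin 3)) else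
    swap 1 2) h.eq
  simp only [map_mul, FreeGroup.lift_apply_of, if_true, if_neg (Ne.symm hij)] at h1
  revert h1
  decide

theorem freeGroup_commute {X : Type*} {a b : FreeGroup X} (h : Commute a b) :
    ∃ r : FreeGroup X, a ∈ Subgroup.zpowers r ∧ b ∈ Subgroup.zpowers r := by
  let H := Subgroup.closure {a, b}
  have hc : ∀ u v : H, u * v = v * u := by
    have : ∀ x ∈ ({a, b} : Set (FreeGroup X)), ∀ y ∈ ({a, b} : Set (FreeGroup X)),
        x * y = y * x := by
      rintro x (rfl | rfl) y (rfl | rfl)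
      · rfl
      · exact h.eq
      · exact h.eq.symm
      · rfl
    have := (Subgroup.isMulCommutative_closure this)
    intro u v
    exact this.is_comm.comm u v
  have hs : Subsingleton (IsFreeGroup.Generators H) := by
    refine ⟨fun i j => of_eq_of_commute ?_⟩
    apply (IsFreeGroup.toFreeGroup H).symm.injective
    rw [map_mul, map_mul, hc]
  obtain ⟨r, hr⟩ := exists_zpowers_of_subsingleton H
  refine ⟨r, ?_, ?_⟩
  · obtain ⟨k, hk⟩ := hr ⟨a, Subgroup.subset_closure (by simp)⟩
    exact ⟨k, congrArg Subtype.val hk⟩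
  · obtain ⟨k, hk⟩ := hr ⟨b, Subgroup.subset_closure (by simp)⟩
    exact ⟨k, congrArg Subtype.val hk⟩

theorem eq_one_of_commute {X : Type*} {a b : FreeGroup X} (h : Commute a b)
    (e : FreeGroup X →* Multiplicative ℤ) (ha : e a = 1) (hb : e b ≠ 1) : a = 1 := by
  obtain ⟨r, ⟨k, rfl⟩, ⟨l, rfl⟩⟩ := freeGroup_commute h
  have h1 : k * Multiplicative.toAdd (e r) = 0 := by
    have := congrArg Multiplicative.toAdd ha
    simpa using this
  rcases mul_eq_zero.1 h1 with h2 | h2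
  · simp [h2]
  · refine absurd ?_ hb
    have : e r = 1 := h2
    simp [this]

theorem exists_zpowers_of_commute {X : Type*} {z : FreeGroup X} (hz : z ≠ 1) :
    ∃ r : FreeGroup X, ∀ a, Commute z a → a ∈ Subgroup.zpowers r := by
  let H := Subgroup.centralizer {z}
  have hzH : z ∈ H := by simp [H, Subgroup.mem_centralizer_singleton_iff]
  have hs : Subsingleton (IsFreeGroup.Generators H) := by
    refine ⟨fun i j => ?_⟩
    by_contra hij
    classical
    let E := IsFreeGroup.toFreeGroup H
    have hcom : ∀ w, Commute (E ⟨z, hzH⟩) w := by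
      intro w
      obtain ⟨v, rfl⟩ := E.surjective w
      have : (⟨z, hzH⟩ : H) * v = v * ⟨z, hzH⟩ := by
        ext
        exact ((Subgroup.mem_centralizer_singleton_iff).1 v.2).symm
      rw [commute_iff_eq, ← map_mul, this, map_mul]
    have hz1 : E ⟨z, hzH⟩ ≠ 1 := by
      intro h
      apply hz
      have := (map_eq_one_iff E E.injective).1 h
      exact congrArg Subtype.val this
    let e : FreeGroup (IsFreeGroup.Generators H) →* Multiplicative ℤ :=
      FreeGroup.lift fun k => if k = i then Multiplicative.ofAdd 1 else 1
    have hei : e (FreeGroup.of i) = Multiplicative.ofAdd 1 := by simp [e]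
    have hej : e (FreeGroup.of j) = 1 := by simp [e, Ne.symm hij]
    have h1 : e (E ⟨z, hzH⟩) ≠ 1 := fun h =>
      hz1 (eq_one_of_commute (hcom (FreeGroup.of i)) e h (by rw [hei]; decide))
    have h2 := eq_one_of_commute (hcom (FreeGroup.of j)).symm e hej h1
    exact FreeGroup.of_ne_one _ h2
  obtain ⟨r, hr⟩ := exists_zpowers_of_subsingleton H
  refine ⟨r, fun a ha => ?_⟩
  obtain ⟨k, hk⟩ := hr ⟨a, Subgroup.mem_centralizer_singleton_iff.2 ha.eq.symm⟩
  exact ⟨k, congrArg Subtype.val hk⟩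

/-- The centralizer of a nontrivial power of `W` is generated by `W` when some exponent
homomorphism takes the value one on `W`. -/
theorem mem_zpowers_of_commute {X : Type*} {a W : FreeGroup X}
    (e : FreeGroup X →* Multiplicative ℤ) (hW : e W = Multiplicative.ofAdd 1) {r : ℤ} (hr : r ≠ 0)
    (h : Commute a (W ^ r)) : a ∈ Subgroup.zpowers W := by
  have hWr : W ^ r ≠ 1 := by
    intro h
    have := congrArg (fun z => Multiplicative.toAdd (e z)) h
    simp only [map_zpow, hW, toAdd_zpow, toAdd_ofAdd, map_one, toAdd_one, smul_eq_mul, mul_one]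
      at this
    exact hr this
  obtain ⟨ρ, hρ⟩ := exists_zpowers_of_commute hWr
  obtain ⟨k, rfl⟩ := hρ a h.symm
  obtain ⟨l, hl⟩ := hρ W (Commute.zpow_left rfl r)
  have hl' : ρ ^ l = W := hl
  have h1 : l * Multiplicative.toAdd (e ρ) = 1 := by
    have := congrArg (fun z => Multiplicative.toAdd (e z)) hl'
    simpa [hW] using this
  rcases Int.eq_one_or_neg_one_of_mul_eq_one h1 with rfl | rfl
  · refine ⟨k, ?_⟩
    simp [← hl']
  · refine ⟨-k, ?_⟩
    simp [← hl']

end Free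

/-- The product `x (m-1) * ⋯ * x 0`. -/
def W : ℕ → FreeGroup ℕ
  | 0 => 1
  | m + 1 => x m * W m

theorem artinFun_W_le {i k : ℕ} (h : k ≤ i) : artinFun i (W k) = W k := by
  induction k with
  | zero => simp [W]
  | succ k ih => rw [W, map_mul, ih (by omega), artinFun_ne (by omega)]

theorem artinFun_W {i m : ℕ} (h : i + 2 ≤ m) : artinFun i (W m) = W m := by
  induction m with
  | zero => omega
  | succ k ih =>
    rcases h.lt_or_eq with h | h
    · rw [W, map_mul, ih (by omega), artinFun_ne (by omega)]
    · obtain rfl : k = i + 1 := by omega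
      simp only [W, map_mul, artinFun_W_le le_rfl, artinFun_succ, artinFun_self]
      group

theorem artin_W {m : ℕ} (b : B m) : artin m b (W m) = W m := by
  have := mem_of_s_mem ((MulAction.stabilizer (MulAut (FreeGroup ℕ)) (W m)).comap (artin m))
    (fun i hi => ?_) b
  · exact this
  · change artin m (s m i) (W m) = W m
    rw [artin_s hi, artinFun_W (by omega)]

theorem artin_x {m : ℕ} (b : B m) {k : ℕ} (hk : m ≤ k) : artin m b (x k) = x k := by
  have := mem_of_s_mem ((MulAction.stabilizer (MulAut (FreeGroup ℕ)) (x k)).comap (artin m))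
    (fun i hi => ?_) b
  · exact this
  · change artin m (s m i) (x k) = x k
    rw [artin_s hi, artinFun_ne (by omega)]

theorem retr_W {k m : ℕ} (h : k ≤ m) : retr m (W k) = W k := by
  induction k with
  | zero => simp [W]
  | succ k ih => rw [W, map_mul, ih (by omega), retr_x (by omega)]

theorem retr_retr (m : ℕ) (f : FreeGroup ℕ) : retr m (retr m f) = retr m f := by
  have : (retr m).comp (retr m) = retr m := FreeGroup.ext_hom _ _ fun i => by
    rw [MonoidHom.comp_apply]
    by_cases h : i < m
    · rw [retr_x h, retr_x h]
    · rw [retr_x' (by omega), map_one]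
  exact DFunLike.congr_fun this f

theorem retr_artin {m : ℕ} (b : B m) (f : FreeGroup ℕ) :
    retr m (artin m b f) = artin m b (retr m f) := by
  have gen : ∀ i, i + 1 < m → ∀ f, retr m (artinFun i f) = artinFun i (retr m f) := by
    intro i hi f
    have : (retr m).comp (artinFun i) = (artinFun i).comp (retr m) :=
      FreeGroup.ext_hom _ _ fun k => by
        rw [MonoidHom.comp_apply, MonoidHom.comp_apply]
        rcases (by omega : k = i ∨ k = i + 1 ∨ (k ≠ i ∧ k ≠ i + 1 ∧ k < m) ∨
          (k ≠ i ∧ k ≠ i + 1 ∧ m ≤ k)) with h | h | h | h <;>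
        simp (disch := omega) only [artinFun_self, artinFun_succ, artinFun_ne, retr_x, retr_x',
          map_mul, map_inv, map_one, h]
    exact DFunLike.congr_fun this f
  have inv : ∀ i, i + 1 < m → ∀ f, retr m (artinInv i f) = artinInv i (retr m f) := by
    intro i hi f
    have : (retr m).comp (artinInv i) = (artinInv i).comp (retr m) :=
      FreeGroup.ext_hom _ _ fun k => by
        rw [MonoidHom.comp_apply, MonoidHom.comp_apply]
        rcases (by omega : k = i ∨ k = i + 1 ∨ (k ≠ i ∧ k ≠ i + 1 ∧ k < m) ∨
          (k ≠ i ∧ k ≠ i + 1 ∧ m ≤ k)) with h | h | h | h <;>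
        simp (disch := omega) only [artinInv_self, artinInv_succ, artinInv_ne, retr_x, retr_x',
          map_mul, map_inv, map_one, h]
    exact DFunLike.congr_fun this f
  induction b using braid_induction with
  | one => simp
  | gen i hi b ih =>
    rw [map_mul, MulAut.mul_apply, MulAut.mul_apply, artin_s hi, artin_s hi, gen i hi, ih]
  | inv i hi b ih =>
    have e : ∀ f, (artin m (s m i)⁻¹) f = artinInv i f := by
      intro f
      rw [map_inv, artin, lift_s _ hi]; rfl
    rw [map_mul, MulAut.mul_apply, MulAut.mul_apply, e, e, inv i hi, ih]

theorem fexp_x (i k : ℕ) : fexp i (x k) = if k = i then Multiplicative.ofAdd 1 else 1 := by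
  simp [fexp]

theorem fexp_W {i m : ℕ} : fexp i (W m) = if i < m then Multiplicative.ofAdd 1 else 1 := by
  induction m with
  | zero => simp [W]
  | succ m ih =>
    rw [W, map_mul, ih, fexp_x]
    by_cases h : m = i
    · subst h; simp
    · have : i < m + 1 ↔ i < m := by omega
      simp [h, this]

end BraidGroup

namespace BraidGroup

open Equiv
open SemidirectProduct (inl inr)

theorem commute_incl_s {k n i : ℕ} (h : k ≤ n) (hi : k ≤ i) (b : B k) :
    Commute (incl h b) (s n i) := by
  have := mem_of_s_mem ((Subgroup.centralizer {s n i}).comap (incl h)) (fun j hj => by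
    rw [Subgroup.mem_comap, Subgroup.mem_centralizer_singleton_iff, incl_s h hj]
    exact s_comm (by omega)) b
  rw [Subgroup.mem_comap, Subgroup.mem_centralizer_singleton_iff] at this
  exact this

theorem tail_succ {m i : ℕ} (h : i ≤ m) : tail (m + 1) i = up (tail m i) * s (m + 2) m := by
  refine tail_induction (p := fun i => tail (m + 1) i = up (tail m i) * s (m + 2) m)
    ?_ (fun i hi ih => ?_) h
  · rw [tail_eq (Nat.lt_succ_self m), tail_self, tail_self, map_one, mul_one, one_mul]
  · rw [tail_eq (by omega), ih, tail_eq hi, map_mul, up_s (by omega), mul_assoc]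

theorem pf_succ {m : ℕ} (f : FreeGroup ℕ) :
    pf (m + 1) (retr m f) = (s (m + 2) m)⁻¹ * up (pf m f) * s (m + 2) m := by
  have : (pf (m + 1)).comp (retr m) =
      ((MulAut.conj (s (m + 2) m)⁻¹).toMonoidHom.comp up).comp (pf m) := by
    refine FreeGroup.ext_hom _ _ fun i => ?_
    simp only [MonoidHom.comp_apply, MulEquiv.coe_toMonoidHom, MulAut.conj_apply, inv_inv]
    obtain h | h := lt_or_ge i m
    · rw [retr_x h, pf_x, pf_x, xbar_of_lt h, xbar_of_lt (by omega), tail_succ (by omega)]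
      simp only [map_mul, map_inv, map_pow, up_s (show i + 1 < m + 1 by omega)]
      group
    · rw [retr_x' h, pf_x, xbar_of_le h]; simp
  simpa [mul_assoc] using DFunLike.congr_fun this f

theorem pf_W_succ (m : ℕ) : pf (m + 1) (W (m + 1)) =
    s (m + 2) m * up (pf m (W m)) * s (m + 2) m := by
  rw [W, map_mul, pf_x, xbar_last, ← retr_W le_rfl, pf_succ, retr_W le_rfl]
  group

theorem commute_up_pf_W {m : ℕ} (b : B m) : Commute (up b) (pf m (W m)) := by
  have := up_mul_pf b (W m)
  rw [artin_W] at this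
  exact (mul_inv_eq_iff_eq_mul.1 this)

/-- The full twist. -/
def tw : (n : ℕ) → B n
  | 0 => 1
  | n + 1 => pf n (W n) * up (tw n)

theorem tw_succ (n : ℕ) : tw (n + 1) = pf n (W n) * up (tw n) := rfl

theorem commute_tw : ∀ {n : ℕ} (b : B n), Commute b (tw n)
  | 0, b => by simp [tw]
  | n + 1, b => by
    have key : ∀ i, i + 1 < n + 1 → Commute (s (n + 1) i) (tw (n + 1)) := by
      intro i hi
      obtain h | h := lt_or_ge (i + 1) n
      · rw [← up_s h, tw_succ]
        exact (commute_up_pf_W _).mul_right ((commute_tw (s n i)).map up)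
      · obtain ⟨m, rfl⟩ : ∃ m, n = m + 1 := ⟨n - 1, by omega⟩
        obtain rfl : i = m := by omega
        rw [tw_succ, tw_succ, map_mul, ← mul_assoc]
        refine Commute.mul_right ?_ ?_
        · have h1 := commute_up_pf_W (pf i (W i))
          rw [pf_W_succ] at h1 ⊢
          generalize up (pf i (W i)) = A at *
          generalize s (i + 1 + 1) i = t at *
          have h2 : A * (t * A * t) = t * A * t * A := h1
          change t * (t * A * t * A) = t * A * t * A * t
          calc _ = t * (A * (t * A * t)) := by rw [h2]
            _ = _ := by group
        · rw [incl_incl]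
          exact (commute_incl_s _ le_rfl _).symm
    have := mem_of_s_mem (Subgroup.centralizer {tw (n + 1)}) (fun j hj => by
      rw [Subgroup.mem_centralizer_singleton_iff]
      exact (key j hj)) b
    rw [Subgroup.mem_centralizer_singleton_iff] at this
    exact this

theorem perm_tw : ∀ n : ℕ, perm n (tw n) = 1
  | 0 => by simp [tw]
  | n + 1 => by rw [tw_succ, map_mul, perm_pf, perm_incl, perm_tw n, one_mul]

theorem lk_tw : ∀ {n i j : ℕ}, i < j → j < n → lk (tw n) i j = 2
  | n + 1, i, j, hij, hj => by
    rw [tw_succ, lk_mul_of_pure (perm_pf _), lk_pf _ _ _ hij, lk_incl, retr_W le_rfl, fexp_W]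
    obtain rfl | h := eq_or_ne j n
    · rw [lk_of_le _ _ _ le_rfl]; simp [hij]
    · rw [if_neg h, lk_tw hij (by omega), zero_add]

theorem artin_tw {m : ℕ} {f : FreeGroup ℕ} (hf : retr m f = f) :
    artin m (tw m) f = (W m)⁻¹ * f * W m := by
  have h := commute_tw (pf m f)
  have h1 := up_mul_pf (tw m) f
  rw [tw_succ] at h
  refine pf_injective (m := m) ?_ ?_ ?_
  · rw [retr_artin, hf]
  · simp only [map_mul, map_inv, hf, retr_W le_rfl]
  · rw [← h1]
    simp only [map_mul, map_inv]
    have h2 : pf m f * (pf m (W m) * up (tw m)) = pf m (W m) * up (tw m) * pf m f := h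
    rw [mul_inv_eq_iff_eq_mul, mul_assoc _ _ (up (tw m)), mul_assoc, h2]
    group

theorem artin_tw_incl {k m i : ℕ} (h : k ≤ m) (hi : i < k) :
    artin m (incl h (tw k)) (x i) = (W k)⁻¹ * x i * W k := by
  rw [artin_incl, artin_tw (retr_x hi)]

/-! ### Generation of pure braids by conjugates of squares of generators -/

theorem mem_of_forget : ∀ {n : ℕ} (H : Subgroup (B n))
    (_ : ∀ i j, i < j → ∀ hj : j < n, incl (show j + 1 ≤ n from hj) (xbar j i) ∈ H) (b : B n)
    (_ : perm n b = 1), b ∈ H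
  | 0, H, _, b, _ => mem_of_s_mem H (fun i hi => by omega) b
  | n + 1, H, h, b, hb => by
    have hbn : perm (n + 1) b n = n := by rw [hb]; rfl
    rw [eq_pf_mul_up hbn]
    refine H.mul_mem ?_ ?_
    · generalize fpart b = f
      have : f ∈ H.comap (pf n) := by
        have hf : f ∈ Subgroup.closure (Set.range (FreeGroup.of (α := ℕ))) := by
          rw [FreeGroup.closure_range_of]; trivial
        refine (Subgroup.closure_le _).2 ?_ hf
        rintro _ ⟨i, rfl⟩
        change pf n (x i) ∈ H
        rw [pf_x]
        obtain hi | hi := lt_or_ge i n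
        · have := h i n hi (Nat.lt_succ_self n)
          rwa [incl_refl] at this
        · rw [xbar_of_le hi]; exact one_mem _
      exact this
    · refine mem_of_forget (H.comap up) (fun i j hij hj => ?_) (forget b) ?_
      · rw [Subgroup.mem_comap, incl_incl]
        exact h i j hij (by omega)
      · rw [perm_forget hbn, hb]

theorem perm_tail_inv {m i : ℕ} (hi : i ≤ m) :
    (perm (m + 1) (tail m i))⁻¹ i = m ∧ ∀ k < i, (perm (m + 1) (tail m i))⁻¹ k = k := by
  refine tail_induction (p := fun i => (perm (m + 1) (tail m i))⁻¹ i = m ∧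
    ∀ k < i, (perm (m + 1) (tail m i))⁻¹ k = k) ?_ (fun i hi ih => ?_) hi
  · simp [tail_self]
  · rw [tail_eq hi, map_mul, mul_inv_rev, perm_s (by omega), swap_inv]
    refine ⟨?_, fun k hk => ?_⟩
    · rw [Perm.mul_apply, swap_apply_left, ih.1]
    · rw [Perm.mul_apply, swap_ne (by omega), ih.2 k (by omega)]

theorem exists_conj_s {n : ℕ} : ∀ i, i + 1 < n → ∃ b : B n,
    s n i = b * s n 0 * b⁻¹ ∧ perm n b 0 = i ∧ perm n b 1 = i + 1
  | 0, _ => ⟨1, by simp⟩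
  | i + 1, hi => by
    obtain ⟨b, hb, h0, h1⟩ := exists_conj_s i (by omega : i + 1 < n)
    refine ⟨s n i * s n (i + 1) * b, ?_, ?_, ?_⟩
    · have := s_braid hi
      have e : s n i * s n (i + 1) * b * s n 0 * (s n i * s n (i + 1) * b)⁻¹ =
          s n i * s n (i + 1) * (b * s n 0 * b⁻¹) * (s n i * s n (i + 1))⁻¹ := by group
      rw [e, ← hb, this]; group
    · rw [map_mul, map_mul, perm_s (by omega), perm_s (by omega), Perm.mul_apply, Perm.mul_apply,
        h0,
        swap_ne (show i ≠ i + 1 ∧ i ≠ i + 1 + 1 by omega), swap_left rfl]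
    · rw [map_mul, map_mul, perm_s (by omega), perm_s (by omega), Perm.mul_apply, Perm.mul_apply,
        h1, swap_left rfl,
        swap_ne (show i + 1 + 1 ≠ i ∧ i + 1 + 1 ≠ i + 1 by omega)]

theorem exists_conj_xbar {n i j : ℕ} (hij : i < j) (hj : j < n) : ∃ b : B n,
    incl (show j + 1 ≤ n from hj) (xbar j i) = b * s n 0 ^ 2 * b⁻¹ ∧
      perm n b 0 = i ∧ perm n b 1 = j := by
  obtain ⟨b, hb, h0, h1⟩ := exists_conj_s (n := n) i (by omega)
  refine ⟨incl (show j + 1 ≤ n from hj) (tail j (i + 1))⁻¹ * b, ?_, ?_, ?_⟩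
  · rw [xbar_of_lt hij]
    simp only [map_mul, map_inv, map_pow, incl_s (show j + 1 ≤ n from hj) (show i + 1 < j + 1 by
      omega), hb, conj_pow]
    group
  · rw [map_mul, perm_incl, map_inv, Perm.mul_apply, h0, (perm_tail_inv (by omega)).2 _ (by omega)]
  · rw [map_mul, perm_incl, map_inv, Perm.mul_apply, h1, (perm_tail_inv (by omega)).1]

theorem perm_s_sq {n i : ℕ} : perm n (s n i ^ 2) = 1 := by
  obtain h | h := lt_or_ge (i + 1) n
  · rw [map_pow, perm_s h, pow_two, swap_mul_self]
  · rw [s_of_le h, one_pow, map_one]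

/-! ### The center -/

theorem eq_tw_zpow_aux {k : ℕ} {c : B k} : ∀ (_ : perm k c = 1)
    (_ : ∀ p : B k, perm k p = 1 → Commute c p), ∃ e : ℤ, c = tw k ^ e := by
  induction k with
  | zero =>
    intro _ _
    exact ⟨0, by rw [zpow_zero]; exact mem_of_s_mem ⊥ (fun i hi => by omega) c⟩
  | succ m ih =>
    intro hc hcomm
    have hcm : perm (m + 1) c m = m := by rw [hc]; rfl
    obtain rfl | rfl | hm : m = 0 ∨ m = 1 ∨ 2 ≤ m := by omega
    · exact ⟨0, by rw [zpow_zero]; exact mem_of_s_mem ⊥ (fun i hi => by omega) c⟩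
    · have h1 := eq_pf_mul_up hcm
      have h2 : forget c = 1 := mem_of_s_mem ⊥ (fun i hi => by omega) _
      rw [h2, map_one, mul_one] at h1
      have h3 : ∀ f : FreeGroup ℕ, retr 1 f ∈ Subgroup.zpowers (W 1) := by
        intro f
        have hf : f ∈ Subgroup.closure (Set.range (FreeGroup.of (α := ℕ))) := by
          rw [FreeGroup.closure_range_of]; trivial
        refine (Subgroup.closure_le ((Subgroup.zpowers (W 1)).comap (retr 1))).2 ?_ hf
        rintro _ ⟨i, rfl⟩
        change retr 1 (x i) ∈ Subgroup.zpowers (W 1)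
        obtain rfl | hi := Nat.eq_zero_or_pos i
        · rw [retr_x one_pos]; simp [W]
        · rw [retr_x' hi]; exact one_mem _
      obtain ⟨e, he⟩ := h3 (fpart c)
      have he : W 1 ^ e = retr 1 (fpart c) := he
      refine ⟨e, ?_⟩
      rw [h1, ← pf_retr, ← he, map_zpow, tw_succ]
      have : tw 1 = 1 := mem_of_s_mem ⊥ (fun i hi => by omega) _
      rw [this, map_one, mul_one]
    · have hperm : ∀ p : B m, perm m p = 1 → perm (m + 1) (up p) = 1 := fun p hp => by
        rw [perm_incl, hp]
      obtain ⟨e, he⟩ := ih (c := forget c) (by rw [perm_forget hcm, hc]) (fun p hp => by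
        have h1 := congrArg forget (hcomm (up p) (hperm p hp)).eq
        rw [forget_mul hcm, forget_mul (by rw [hperm p hp]; rfl), forget_up] at h1
        exact h1)
      refine ⟨e, ?_⟩
      have h1 := eq_pf_mul_up hcm
      rw [he] at h1
      have h2 : (tw (m + 1)) ^ e = pf m (W m ^ e) * up (tw m ^ e) := by
        rw [tw_succ, Commute.mul_zpow (commute_up_pf_W _).symm, map_zpow, map_zpow]
      set g := fpart c * (W m ^ e)⁻¹ with hg
      have hgr : retr m g = g := by
        rw [hg, map_mul, map_inv, map_zpow, retr_fpart hcm, retr_W le_rfl]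
      have h3 : pf m g * tw (m + 1) ^ e = c := by
        rw [h1, h2, hg, map_mul, map_inv]; group
      have h4 : ∀ i, i < m → Commute g (x i) := by
        intro i hi
        refine pf_injective (m := m) ?_ ?_ ?_
        · rw [map_mul, hgr, retr_x hi]
        · rw [map_mul, hgr, retr_x hi]
        · have h5 : pf m g = c * (tw (m + 1) ^ e)⁻¹ := by rw [← h3]; group
          rw [map_mul, map_mul (pf m) (x i), h5]
          exact (((hcomm _ (perm_pf _)).symm.mul_right
            (((commute_tw _).zpow_right e).inv_right))).symm.eq
      have h6 : g = 1 := by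
        obtain ⟨u, hu⟩ := mem_zpowers_of_commute (a := g) (W := x 0) (fexp 0)
          (by rw [fexp_x, if_pos rfl]) one_ne_zero (by rw [zpow_one]; exact h4 0 (by omega))
        have hu : x 0 ^ u = g := hu
        refine eq_one_of_commute (h4 1 (by omega)) (fexp 1) ?_ ?_
        · rw [← hu, map_zpow, fexp_x, if_neg (by omega), one_zpow]
        · rw [fexp_x, if_pos rfl]; decide
      rw [← h3, h6, map_one, one_mul]

theorem eq_tw_zpow {k : ℕ} {c : B k} (hc : perm k c = 1)
    (hcomm : ∀ p : B k, perm k p = 1 → Commute c p) : ∃ e : ℤ, c = tw k ^ e :=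
  eq_tw_zpow_aux hc hcomm

theorem lk_zpow {n : ℕ} {p : B n} (hp : perm n p = 1) (e : ℤ) (i j : ℕ) :
    lk (p ^ e) i j = e * lk p i j := by
  have h : ∀ k : ℕ, lk (p ^ k) i j = k * lk p i j := by
    intro k
    induction k with
    | zero => simp [lk_one]
    | succ k ih => rw [pow_succ', lk_mul_of_pure hp, ih]; push_cast; ring
  obtain ⟨k, rfl | rfl⟩ := e.eq_nat_or_neg
  · rw [zpow_natCast, h]
  · rw [zpow_neg, zpow_natCast, lk_inv_of_pure (by rw [map_pow, hp, one_pow]), h]; ring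

/-- A central pure braid with the linking numbers of the full twist to the power `d` is that
power. -/
theorem eq_tw_of_lk {k : ℕ} {c : B k} (hc : perm k c = 1)
    (hcomm : ∀ p : B k, perm k p = 1 → Commute c p) (d : ℤ)
    (hlk : ∀ i j, i < j → j < k → lk c i j = 2 * d) : c = tw k ^ d := by
  obtain ⟨e, rfl⟩ := eq_tw_zpow hc hcomm
  obtain hk | hk := lt_or_ge 1 k
  · have := hlk 0 1 one_pos hk
    rw [lk_zpow (perm_tw k), lk_tw one_pos hk] at this
    rw [show e = d by omega]
  · have : tw k = 1 := mem_of_s_mem ⊥ (fun i hi => by omega) _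
    rw [this, one_zpow, one_zpow]

end BraidGroup

namespace BraidGroup

open Equiv
open SemidirectProduct (inl inr)

theorem eq_one_of_le_one {n : ℕ} (hn : n ≤ 1) (b : B n) : b = 1 :=
  mem_of_s_mem ⊥ (fun i hi => by omega) b

theorem perm_incl_xbar {n i j : ℕ} (hj : j + 1 ≤ n) : perm n (incl hj (xbar j i)) = 1 := by
  rw [perm_incl, perm_xbar]

theorem lk_forget {m : ℕ} {b : B (m + 1)} (hb : perm (m + 1) b = 1) {i j : ℕ} (hij : i < j)
    (hj : j < m) : lk (forget b) i j = lk b i j := by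
  conv_rhs => rw [eq_pf_mul_up (show perm (m + 1) b m = m by rw [hb]; rfl)]
  rw [lk_mul_of_pure (perm_pf _), lk_pf _ _ _ hij, if_neg (by omega), lk_incl, zero_add]

theorem lk_last {m : ℕ} {b : B (m + 1)} (hb : perm (m + 1) b = 1) {i : ℕ} (hi : i < m) :
    lk b i m = 2 * Multiplicative.toAdd (fexp i (fpart b)) := by
  have hbm : perm (m + 1) b m = m := by rw [hb]; rfl
  conv_lhs => rw [eq_pf_mul_up hbm]
  rw [lk_mul_of_pure (perm_pf _), lk_pf _ _ _ hi, if_pos rfl, retr_fpart hbm, lk_incl,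
    lk_of_le _ _ _ le_rfl, add_zero]

/-- A surjective homomorphism of pure braid groups compatible with linking numbers and, up to pure
conjugation, with the action of the smaller braid group. -/
structure IsPureMap {n k : ℕ} (hk : k ≤ n) (h : B n → B k) : Prop where
  mul : ∀ p q, perm n p = 1 → perm n q = 1 → h (p * q) = h p * h q
  pure : ∀ p, perm n p = 1 → perm k (h p) = 1
  lk_eq : ∀ p, perm n p = 1 → ∀ i j, i < j → j < k → lk (h p) i j = lk p i j
  surj : ∀ q, perm k q = 1 → ∃ p, perm n p = 1 ∧ h p = q
  conj : ∀ b : B k, ∃ q, perm k q = 1 ∧ ∀ p, perm n p = 1 →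
    h (incl hk b * p * (incl hk b)⁻¹) = q * b * h p * b⁻¹ * q⁻¹

namespace IsPureMap

variable {n k : ℕ}

theorem map_one {hk : k ≤ n} {h : B n → B k} (hh : IsPureMap hk h) : h 1 = 1 := by
  have := hh.mul 1 1 (_root_.map_one _) (_root_.map_one _)
  rw [mul_one] at this
  exact (left_eq_mul.1 this)

theorem map_inv {hk : k ≤ n} {h : B n → B k} (hh : IsPureMap hk h) {p : B n}
    (hp : perm n p = 1) : h p⁻¹ = (h p)⁻¹ := by
  have := hh.mul p⁻¹ p (by rw [_root_.map_inv, hp, inv_one]) hp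
  rw [inv_mul_cancel, hh.map_one] at this
  exact eq_inv_of_mul_eq_one_left this.symm

theorem forget {hk : k + 1 ≤ n} {h : B n → B (k + 1)} (hh : IsPureMap hk h) :
    IsPureMap (Nat.le_of_succ_le hk) (fun p => forget (h p)) where
  mul p q hp hq := by
    rw [hh.mul p q hp hq, forget_mul (by rw [hh.pure p hp]; rfl)]
  pure p hp := by
    rw [perm_forget (by rw [hh.pure p hp]; rfl), hh.pure p hp]
  lk_eq p hp i j hij hj := by
    rw [lk_forget (hh.pure p hp) hij hj, hh.lk_eq p hp i j hij (by omega)]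
  surj q hq := by
    obtain ⟨p, hp, e⟩ := hh.surj (up q) (by rw [perm_incl, hq])
    exact ⟨p, hp, by rw [e, forget_up]⟩
  conj b := by
    obtain ⟨q, hq, e⟩ := hh.conj (up b)
    have hqm : perm (k + 1) q k = k := by rw [hq]; rfl
    have hb := perm_up_last b
    refine ⟨BraidGroup.forget q, by rw [perm_forget hqm, hq], fun p hp => ?_⟩
    have hpm : perm (k + 1) (h p) k = k := by rw [hh.pure p hp]; rfl
    have hbi : perm (k + 1) (up b)⁻¹ k = k := by rw [_root_.map_inv, Perm.inv_eq_iff_eq, hb]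
    have := e p hp
    rw [incl_incl] at this
    rw [this, forget_mul, forget_mul, forget_mul, forget_mul hqm, forget_up, forget_inv hqm,
      forget_inv hb, forget_up]
    · rw [map_mul, Perm.mul_apply, hb, hqm]
    · rw [map_mul, Perm.mul_apply, hpm, map_mul, Perm.mul_apply, hb, hqm]
    · rw [map_mul, Perm.mul_apply, hbi, map_mul, Perm.mul_apply, hpm, map_mul, Perm.mul_apply, hb,
        hqm]

theorem mem_of_forget {hk : k ≤ n} {h : B n → B k} (hh : IsPureMap hk h) (H : Subgroup (B k))
    (hH : ∀ i j, i < j → ∀ hj : j < n, h (incl (show j + 1 ≤ n from hj) (xbar j i)) ∈ H) (b : B n)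
    (hb : perm n b = 1) : h b ∈ H := by
  let K : Subgroup (B n) :=
    { carrier := {p | perm n p = 1 ∧ h p ∈ H}
      one_mem' := ⟨_root_.map_one _, by rw [hh.map_one]; exact one_mem _⟩
      mul_mem' := fun {a b} ha hb => ⟨by rw [map_mul, ha.1, hb.1, one_mul], by
        rw [hh.mul a b ha.1 hb.1]; exact mul_mem ha.2 hb.2⟩
      inv_mem' := fun {a} ha => ⟨by rw [_root_.map_inv, ha.1, inv_one], by
        rw [hh.map_inv ha.1]; exact inv_mem ha.2⟩ }
  exact (BraidGroup.mem_of_forget K (fun i j hij hj => ⟨perm_incl_xbar _, hH i j hij hj⟩) b hb).2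

theorem map_xbar : ∀ {k : ℕ} {hk : k ≤ n} {h : B n → B k} (_ : IsPureMap hk h) {i j : ℕ}
    (_ : i < j) (_ : k ≤ j) (hj : j < n), h (incl (show j + 1 ≤ n from hj) (xbar j i)) = 1
  | 0, hk, h, hh, i, j, hij, hkj, hj => eq_one_of_le_one (by omega) _
  | k + 1, hk, h, hh, i, j, hij, hkj, hj => by
    obtain rfl | hk0 := Nat.eq_zero_or_pos k
    · exact eq_one_of_le_one (by omega) _
    have IH := fun i j (hij : i < j) hkj hj => map_xbar hh.forget (i := i) (j := j) hij hkj hj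
    have hkn : k ≤ n := Nat.le_of_succ_le hk
    set t := incl hkn (tw k) with ht
    have htp : perm n t = 1 := by rw [ht, perm_incl, perm_tw]
    have hhtm : perm (k + 1) (h t) k = k := by rw [hh.pure t htp]; rfl
    have h1 : BraidGroup.forget (h t) = tw k ^ (1 : ℤ) := by
      refine eq_tw_of_lk (hh.forget.pure t htp) (fun q hq => ?_) 1 (fun i j hij hj => ?_)
      · obtain ⟨p, hp, rfl⟩ := hh.forget.surj q hq
        have := hh.forget.mem_of_forget (Subgroup.centralizer {BraidGroup.forget (h t)})
          (fun i j hij hj => ?_) p hp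
        · rw [Subgroup.mem_centralizer_singleton_iff] at this
          exact this.symm
        · rw [Subgroup.mem_centralizer_singleton_iff]
          obtain hkj | hkj := le_or_gt k j
          · rw [IH i j hij hkj hj, mul_one, one_mul]
          · have e : incl (show j + 1 ≤ n from hj) (xbar j i) =
                incl hkn (incl (show j + 1 ≤ k from hkj) (xbar j i)) := by rw [incl_incl]
            rw [← hh.forget.mul _ _ (perm_incl_xbar _) htp,
              ← hh.forget.mul _ _ htp (perm_incl_xbar _), e, ht, ← map_mul, (commute_tw _).eq,
              map_mul]
      · rw [hh.forget.lk_eq t htp i j hij hj, ht, lk_incl, lk_tw hij hj]; norm_num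
    rw [zpow_one] at h1
    set f := fpart (h t) with hf
    have hfr : retr k f = f := retr_fpart hhtm
    have h2 : h t = pf k f * up (tw k) := by rw [← h1]; exact eq_pf_mul_up hhtm
    have hf0 : fexp 0 f = 1 := by
      have h3 := lk_last (hh.pure t htp) hk0
      rw [hh.lk_eq t htp 0 k hk0 (by omega), ht, lk_incl, lk_of_le _ _ _ le_rfl] at h3
      apply Multiplicative.toAdd.injective
      change Multiplicative.toAdd (fexp 0 (fpart (h t))) = 0
      linarith
    have big : ∀ i, i < j → k ≤ i → h (incl (show j + 1 ≤ n from hj) (xbar j i)) = 1 := by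
      intro i hij hki
      set y := incl (show j + 1 ≤ n from hj) (xbar j i) with hy
      have hyp : perm n y = 1 := perm_incl_xbar _
      have hym : perm (k + 1) (h y) k = k := by rw [hh.pure y hyp]; rfl
      have hy1 : h y = pf k (fpart (h y)) := by
        conv_lhs => rw [eq_pf_mul_up hym]
        rw [IH i j hij (by omega) hj, _root_.map_one, mul_one]
      set g := fpart (h y) with hg
      have hgr : retr k g = g := retr_fpart hym
      have hg0 : fexp 0 g = 1 := by
        have h3 := lk_last (hh.pure y hyp) hk0
        rw [hh.lk_eq y hyp 0 k hk0 (by omega), hy, lk_incl, lk_xbar hij _ _ hk0,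
          if_neg (by omega)] at h3
        apply Multiplicative.toAdd.injective
        change Multiplicative.toAdd (fexp 0 (fpart (h y))) = 0
        linarith
      have hc : t * y = y * t := by
        have e : t = incl (show j + 1 ≤ n from hj) (up (incl (show k ≤ j by omega) (tw k))) := by
          rw [incl_incl, incl_incl]
        have h5 := up_mul_pf (incl (show k ≤ j by omega) (tw k)) (x i)
        rw [artin_incl, artin_x _ hki, pf_x, mul_inv_eq_iff_eq_mul] at h5
        rw [e, hy, ← map_mul, h5, map_mul]
      have hc2 : h t * h y = h y * h t := by
        rw [← hh.mul _ _ htp hyp, hc, hh.mul _ _ hyp htp]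
      have h6 : Commute g (f * (W k)⁻¹) := by
        refine pf_injective (m := k) ?_ ?_ ?_
        · simp only [map_mul, _root_.map_inv, hgr, hfr, retr_W le_rfl]
        · simp only [map_mul, _root_.map_inv, hgr, hfr, retr_W le_rfl]
        · have h5 := up_mul_pf (tw k) g
          rw [artin_tw hgr, mul_inv_eq_iff_eq_mul] at h5
          rw [h2, hy1, mul_assoc, h5] at hc2
          simp only [← mul_assoc] at hc2
          have h7 := mul_right_cancel hc2
          simp only [map_mul, _root_.map_inv] at h7 ⊢
          simp only [← mul_assoc] at h7 ⊢
          rw [← h7]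
          group
      have : g = 1 := eq_one_of_commute h6 (fexp 0) hg0 (by
        rw [map_mul, hf0, one_mul, _root_.map_inv, fexp_W, if_pos hk0]; decide)
      rw [hy1, this, _root_.map_one]
    have small : ∀ d i, i + d = k → h (incl (show j + 1 ≤ n from hj) (xbar j i)) = 1 := by
      intro d
      induction d with
      | zero => exact fun i hi => big i (by omega) (by omega)
      | succ d ih =>
        intro i hi
        obtain ⟨q, hq, e⟩ := hh.conj (s (k + 1) i)
        have e2 := e _ (perm_incl_xbar (n := n) (i := i + 1) (j := j) hj)
        rw [ih (i + 1) (by omega), incl_s hk (by omega)] at e2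
        rw [xbar_eq (by omega), map_mul, map_mul, _root_.map_inv, incl_incl,
          incl_s _ (show i + 1 < j by omega), e2]
        group
    obtain hki | hki := le_or_gt k i
    · exact big i hij hki
    · exact small (k - i) i (by omega)

end IsPureMap

end BraidGroup

namespace BraidGroup

open Equiv Monoid

namespace FreeProd

variable {ι : Type*} {M : ι → Type*} [∀ i, Group (M i)]

/-- Reduced words. -/
def Red (l : List (Σ i, M i)) : Prop :=
  (∀ a ∈ l, a.2 ≠ 1) ∧ l.IsChain fun a b => a.1 ≠ b.1

/-- The product of a word. -/
def lprod (l : List (Σ i, M i)) : CoprodI M := (l.map fun a => CoprodI.of a.2).prod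

@[simp] theorem lprod_nil : lprod ([] : List (Σ i, M i)) = 1 := rfl

@[simp] theorem lprod_cons (a : Σ i, M i) (l : List (Σ i, M i)) :
    lprod (a :: l) = CoprodI.of a.2 * lprod l := by simp [lprod]

@[simp] theorem lprod_append (l l' : List (Σ i, M i)) :
    lprod (l ++ l') = lprod l * lprod l' := by simp [lprod]

theorem exists_wd (g : CoprodI M) : ∃ l : List (Σ i, M i), Red l ∧ lprod l = g := by
  classical
  exact ⟨(CoprodI.Word.equiv g).toList, ⟨(CoprodI.Word.equiv g).ne_one,
    (CoprodI.Word.equiv g).chain_ne⟩, CoprodI.Word.equiv.symm_apply_apply g⟩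

theorem Red.eq_of_lprod {l l' : List (Σ i, M i)} (h : Red l) (h' : Red l')
    (e : lprod l = lprod l') : l = l' := by
  classical
  have := CoprodI.Word.equiv.symm.injective
    (a₁ := (⟨l, h.1, h.2⟩ : CoprodI.Word M)) (a₂ := ⟨l', h'.1, h'.2⟩) e
  exact congrArg CoprodI.Word.toList this

/-- The reduced word of an element. -/
noncomputable def wd (g : CoprodI M) : List (Σ i, M i) := (exists_wd g).choose

theorem red_wd (g : CoprodI M) : Red (wd g) := (exists_wd g).choose_spec.1

@[simp] theorem lprod_wd (g : CoprodI M) : lprod (wd g) = g := (exists_wd g).choose_spec.2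

theorem Red.wd_lprod {l : List (Σ i, M i)} (h : Red l) : wd (lprod l) = l :=
  (red_wd _).eq_of_lprod h (lprod_wd _)

theorem red_nil : Red ([] : List (Σ i, M i)) := ⟨by simp, by simp⟩

@[simp] theorem wd_one : wd (1 : CoprodI M) = [] := (red_nil (M := M)).wd_lprod

theorem wd_eq_nil {g : CoprodI M} (h : wd g = []) : g = 1 := by rw [← lprod_wd g, h, lprod_nil]

theorem red_singleton {i : ι} {a : M i} : Red [(⟨i, a⟩ : Σ i, M i)] ↔ a ≠ 1 := by simp [Red]

theorem wd_of {i : ι} {a : M i} (h : a ≠ 1) : wd (CoprodI.of a) = [(⟨i, a⟩ : Σ i, M i)] := by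
  have := (red_singleton.2 h).wd_lprod
  simpa using this

theorem red_append {l l' : List (Σ i, M i)} : Red (l ++ l') ↔
    Red l ∧ Red l' ∧ ∀ a ∈ l.getLast?, ∀ b ∈ l'.head?, a.1 ≠ b.1 := by
  simp only [Red, List.mem_append, List.isChain_append]
  constructor
  · rintro ⟨h1, h2, h3, h4⟩
    exact ⟨⟨fun a ha => h1 a (Or.inl ha), h2⟩, ⟨fun a ha => h1 a (Or.inr ha), h3⟩, h4⟩
  · rintro ⟨⟨h1, h2⟩, ⟨h3, h4⟩, h5⟩
    exact ⟨fun a ha => ha.elim (h1 a) (h3 a), h2, h4, h5⟩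

theorem red_cons {a : Σ i, M i} {l : List (Σ i, M i)} : Red (a :: l) ↔
    a.2 ≠ 1 ∧ Red l ∧ ∀ b ∈ l.head?, a.1 ≠ b.1 := by
  rw [← List.singleton_append, red_append, show [a] = [⟨a.1, a.2⟩] from rfl, red_singleton]
  simp

theorem Red.left {l l' : List (Σ i, M i)} (h : Red (l ++ l')) : Red l := (red_append.1 h).1

theorem Red.right {l l' : List (Σ i, M i)} (h : Red (l ++ l')) : Red l' := (red_append.1 h).2.1

theorem length_wd_of_mul {i : ι} (a : M i) (g : CoprodI M) :
    (wd (CoprodI.of a * g)).length ≤ (wd g).length + 1 := by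
  obtain rfl | ha := eq_or_ne a 1
  · simp
  cases hg : wd g with
  | nil => rw [wd_eq_nil hg, mul_one, wd_of ha]; simp
  | cons b t =>
    have hr := red_wd g
    rw [hg] at hr
    have hgp : g = CoprodI.of b.2 * lprod t := by rw [← lprod_wd g, hg, lprod_cons]
    obtain ⟨j, b⟩ := b
    by_cases hij : i = j
    · subst hij
      rw [hgp, ← mul_assoc, ← map_mul]
      dsimp only
      obtain h1 | h1 := eq_or_ne (a * b) 1
      · rw [h1, map_one, one_mul, (red_cons.1 hr).2.1.wd_lprod]; simp; omega
      · have : Red ((⟨i, a * b⟩ : Σ i, M i) :: t) :=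
          red_cons.2 ⟨h1, (red_cons.1 hr).2.1, (red_cons.1 hr).2.2⟩
        have := this.wd_lprod
        rw [lprod_cons] at this
        rw [this]; simp
    · have : Red ((⟨i, a⟩ : Σ i, M i) :: ⟨j, b⟩ :: t) := red_cons.2 ⟨ha, hr, by simpa using hij⟩
      have := this.wd_lprod
      rw [lprod_cons, lprod_cons] at this
      rw [hgp, this]; simp

theorem length_wd_le (l : List (Σ i, M i)) : (wd (lprod l)).length ≤ l.length := by
  induction l with
  | nil => simp
  | cons a t ih =>
    rw [lprod_cons]
    have := length_wd_of_mul a.2 (lprod t)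
    simp; omega

theorem length_wd_lt {i : ι} (p t : List (Σ i, M i)) (a b : M i) :
    (wd (lprod (p ++ [(⟨i, a⟩ : Σ i, M i)] ++ (⟨i, b⟩ : Σ i, M i) :: t))).length <
      p.length + t.length + 2 := by
  have : lprod (p ++ [(⟨i, a⟩ : Σ i, M i)] ++ (⟨i, b⟩ : Σ i, M i) :: t) =
      lprod (p ++ (⟨i, a * b⟩ : Σ i, M i) :: t) := by
    simp [mul_assoc]
  rw [this]
  refine (length_wd_le _).trans_lt ?_
  simp; omega

/-! ### Conjugacy -/

theorem isRotated_of_append_eq {α : Type*} {u v : List α} :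
    ∀ {h : List α}, v ++ h = h ++ u → v ~r u := by
  intro h
  induction hn : h.length using Nat.strong_induction_on generalizing h with
  | _ n ih =>
    intro e
    rcases List.append_eq_append_iff.1 e with ⟨t, h1, h2⟩ | ⟨t, h1, h2⟩
    · obtain rfl | hv := eq_or_ne v []
      · have := congrArg List.length e
        simp at this
        rw [this]
      · refine ih t.length ?_ rfl (h1 ▸ h2)
        have := List.length_pos_of_ne_nil hv
        rw [← hn, h1, List.length_append]; omega
    · rw [h1, h2]
      exact List.isRotated_append

/-- The inverse word. -/
def linv (l : List (Σ i, M i)) : List (Σ i, M i) := (l.map fun a => ⟨a.1, a.2⁻¹⟩).reverse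

theorem lprod_linv (l : List (Σ i, M i)) : lprod (linv l) = (lprod l)⁻¹ := by
  induction l with
  | nil => simp [linv]
  | cons a t ih =>
    have : linv (a :: t) = linv t ++ [⟨a.1, a.2⁻¹⟩] := by simp [linv]
    rw [this, lprod_append, ih, lprod_cons, lprod_cons]
    simp

theorem Red.linv {l : List (Σ i, M i)} (h : Red l) : Red (linv l) := by
  refine ⟨?_, ?_⟩
  · intro a ha
    simp only [FreeProd.linv, List.mem_reverse, List.mem_map] at ha
    obtain ⟨b, hb, rfl⟩ := ha
    simpa using h.1 b hb
  · rw [FreeProd.linv, List.isChain_reverse, List.isChain_map]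
    exact h.2.imp fun a b hab => hab.symm

theorem isRotated_aux {lu lv : List (Σ i, M i)} (hv : Red lv)
    (hlen : lu.length = lv.length) {h : CoprodI M} (hr : Red (wd h ++ lu))
    (e : h * lprod lu = lprod lv * h) : lv ~r lu := by
  have e1 : lprod (wd h ++ lu) = lprod (lv ++ wd h) := by simpa using e
  by_cases hr2 : Red (lv ++ wd h)
  · exact isRotated_of_append_eq (hr.eq_of_lprod hr2 e1).symm
  · exfalso
    rw [red_append] at hr2
    push Not at hr2
    obtain ⟨a, ha, b, hb, hab⟩ := hr2 hv (red_wd h)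
    have h1 := List.dropLast_append_getLast? a ha
    have h2 := List.cons_head?_tail hb
    have h3 := congrArg List.length hr.wd_lprod
    obtain ⟨i, a⟩ := a
    obtain ⟨j, b⟩ := b
    obtain rfl : i = j := hab
    rw [e1] at h3
    have h4 := length_wd_lt lv.dropLast (wd h).tail a b
    rw [h1, h2, h3] at h4
    have h5 := congrArg List.length h1
    have h6 := congrArg List.length h2
    simp only [List.length_append, List.length_cons, List.length_nil] at h4 h5 h6
    omega

theorem isRotated_of_conj {lu lv : List (Σ i, M i)} (hu : Red (lu ++ lu)) (hv : Red lv)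
    (hlen : lu.length = lv.length) {h : CoprodI M} (e : h * lprod lu = lprod lv * h) :
    lv ~r lu := by
  by_cases hr : Red (wd h ++ lu)
  · exact isRotated_aux hv hlen hr e
  · have h1 : Red (wd h ++ linv lu) := by
      rw [red_append] at hr ⊢
      push Not at hr
      refine ⟨red_wd h, hu.left.linv, fun c hc b hb => ?_⟩
      obtain ⟨c', hc', a, ha, hca⟩ := hr (red_wd h) hu.left
      obtain rfl : c = c' := Option.mem_unique hc hc'
      simp only [linv, List.head?_reverse, List.getLast?_map, Option.mem_def,
        Option.map_eq_some_iff] at hb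
      obtain ⟨b, hb, rfl⟩ := hb
      rw [hca]
      exact ((red_append.1 hu).2.2 b hb a ha).symm
    have h2 := isRotated_aux (lv := linv lv) hv.linv (by simpa [linv] using hlen) h1 (by
      rw [lprod_linv, lprod_linv, eq_inv_mul_iff_mul_eq, ← mul_assoc, ← e]
      group)
    have h3 := (h2.reverse).map fun a : Σ i, M i => (⟨a.1, a.2⁻¹⟩ : Σ i, M i)
    simpa [linv, Function.comp_def] using h3

/-- Every element is conjugate to a letter or to a cyclically reduced word. -/
theorem exists_conj_cyclic (g : CoprodI M) : ∃ (c : CoprodI M) (l : List (Σ i, M i)), Red l ∧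
    c * g * c⁻¹ = lprod l ∧ (l.length ≤ 1 ∨ Red (l ++ l)) := by
  induction hn : (wd g).length using Nat.strong_induction_on generalizing g with
  | _ n ih =>
    by_cases hl : (wd g).length ≤ 1 ∨ Red (wd g ++ wd g)
    · exact ⟨1, wd g, red_wd g, by simp, hl⟩
    · push Not at hl
      obtain ⟨hl1, hl⟩ := hl
      rw [red_append] at hl
      push Not at hl
      obtain ⟨a, ha, b, hb, hab⟩ := hl (red_wd g) (red_wd g)
      have h2 := List.cons_head?_tail hb
      have h3 : (wd g).tail ≠ [] := by
        intro h; rw [h] at h2; rw [← h2] at hl1; simp at hl1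
      have ha' : a ∈ (wd g).tail.getLast? := by
        rw [← h2, List.getLast?_cons_of_ne_nil h3] at ha
        exact ha
      have h1 := List.dropLast_append_getLast? a ha'
      obtain ⟨i, a⟩ := a
      obtain ⟨j, b⟩ := b
      obtain rfl : i = j := hab
      rw [← h1] at h2
      set p := (wd g).tail.dropLast
      have hg : g = CoprodI.of b * lprod p * CoprodI.of a := by
        rw [← lprod_wd g, ← h2]; simp [mul_assoc]
      have hlen : (wd g).length = p.length + 2 := by rw [← h2]; simp
      have hs := length_wd_le (⟨i, a * b⟩ :: p : List (Σ i, M i))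
      obtain ⟨c, l, hl, e, h⟩ := ih _ (by
        rw [List.length_cons] at hs; omega)
        (lprod (⟨i, a * b⟩ :: p : List (Σ i, M i))) rfl
      refine ⟨c * CoprodI.of a, l, hl, ?_, h⟩
      rw [← e, hg]
      simp [mul_assoc]

theorem lprod_flatten_replicate (l : List (Σ i, M i)) (n : ℕ) :
    lprod (List.replicate n l).flatten = lprod l ^ n := by
  induction n with
  | zero => simp
  | succ n ih => rw [List.replicate_succ, List.flatten_cons, lprod_append, ih, pow_succ']

theorem Red.flatten_replicate {l : List (Σ i, M i)} (h : Red (l ++ l)) (n : ℕ) :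
    Red (List.replicate n l).flatten := by
  induction n with
  | zero => simpa using red_nil
  | succ n ih =>
    rw [List.replicate_succ, List.flatten_cons, red_append]
    refine ⟨h.left, ih, fun a ha b hb => (red_append.1 h).2.2 a ha b ?_⟩
    cases n with
    | zero => simp at hb
    | succ n =>
      have hl : l ≠ [] := by rintro rfl; simp at ha
      rw [List.replicate_succ, List.flatten_cons, List.head?_append_of_ne_nil _ hl] at hb
      exact hb

theorem length_le_one_of_torsion {g c : CoprodI M} {l : List (Σ i, M i)} {n : ℕ} (hn : 0 < n)
    (hg : g ^ n = 1) (hc : c * g * c⁻¹ = lprod l) (hl : l.length ≤ 1 ∨ Red (l ++ l)) :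
    l.length ≤ 1 := by
  rcases hl with hl | hl
  · exact hl
  · have h1 : lprod (List.replicate n l).flatten = 1 := by
      rw [lprod_flatten_replicate, ← hc, conj_pow, hg]; simp
    have h2 := (hl.flatten_replicate n).wd_lprod
    rw [h1, wd_one] at h2
    have h3 := congrArg List.length h2
    simp only [List.length_nil, List.length_flatten, List.map_replicate, List.sum_replicate,
      smul_eq_mul] at h3
    rcases mul_eq_zero.1 h3.symm with h | h <;> omega

/-- Elements of finite order are conjugate into a factor. -/
theorem exists_conj_of_torsion {g : CoprodI M} {n : ℕ} (hn : 0 < n) (hg : g ^ n = 1) (hg1 : g ≠ 1) :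
    ∃ (c : CoprodI M) (i : ι) (a : M i), c * g * c⁻¹ = CoprodI.of a := by
  obtain ⟨c, l, hl, e, h⟩ := exists_conj_cyclic g
  have := length_le_one_of_torsion hn hg e h
  match l, this, e with
  | [], _, e =>
    exact absurd (by simpa using e) hg1
  | [a], _, e => exact ⟨c, a.1, a.2, by simpa using e⟩

/-! ### Letterwise maps -/

/-- The endomorphism induced by endomorphisms of the factors. -/
def hat (T : ∀ i, M i →* M i) : CoprodI M →* CoprodI M :=
  CoprodI.lift fun i => CoprodI.of.comp (T i)

/-- The action on letters. -/
def tl (T : ∀ i, M i →* M i) (a : Σ i, M i) : Σ i, M i := ⟨a.1, T a.1 a.2⟩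

theorem hat_lprod (T : ∀ i, M i →* M i) (l : List (Σ i, M i)) :
    hat T (lprod l) = lprod (l.map (tl T)) := by
  induction l with
  | nil => simp
  | cons a t ih => rw [lprod_cons, map_mul, ih]; simp [hat, tl]

theorem Red.map_tl {T : ∀ i, M i →* M i} (hT : ∀ i, Function.Injective (T i))
    {l : List (Σ i, M i)} (h : Red l) : Red (l.map (tl T)) := by
  refine ⟨?_, ?_⟩
  · intro a ha
    obtain ⟨b, hb, rfl⟩ := List.mem_map.1 ha
    exact fun h1 => h.1 b hb ((hT b.1) (by rw [map_one]; exact h1))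
  · rw [List.isChain_map]
    exact h.2

theorem map_eq_self_of_hat_eq {T : ∀ i, M i →* M i} (hT : ∀ i, Function.Injective (T i))
    {g : CoprodI M} (h : hat T g = g) : ∀ a ∈ wd g, T a.1 a.2 = a.2 := by
  have h1 : (wd g).map (tl T) = wd g := by
    refine ((red_wd g).map_tl hT).eq_of_lprod (red_wd g) ?_
    rw [← hat_lprod, lprod_wd, h]
  intro a ha
  rw [← List.map_id (wd g), List.map_map] at h1
  have := List.map_inj_left.1 h1 a ha
  simp only [Function.comp_apply, tl, id] at this
  exact eq_of_heq (Sigma.mk.inj_iff.1 this).2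

theorem exists_conj_fixed {T : ∀ i, M i →* M i} (hT : ∀ i, Function.Injective (T i))
    {g h : CoprodI M} (hg : h * g * h⁻¹ = hat T g) : ∃ (c : CoprodI M) (l : List (Σ i, M i)),
      c * g * c⁻¹ = lprod l ∧ (l.length ≤ 1 ∨ ∃ r, 0 < r ∧ ∀ a ∈ l, (T a.1)^[r] a.2 = a.2) := by
  obtain ⟨c, l, hl, e, h1⟩ := exists_conj_cyclic g
  refine ⟨c, l, e, ?_⟩
  refine or_iff_not_imp_left.2 fun hl1 => ?_
  have hll := h1.resolve_left hl1
  have h2 : l.map (tl T) ~r l := by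
    refine isRotated_of_conj hll (hl.map_tl hT) (by simp) (h := hat T c * h * c⁻¹) ?_
    rw [← hat_lprod, ← e, map_mul, map_mul, ← hg, map_inv]
    group
  obtain ⟨k, hk⟩ := h2.symm
  have h3 : ∀ j, l.map (tl T)^[j] = l.rotate (k * j) := by
    intro j
    induction j with
    | zero => simp
    | succ j ih =>
      rw [Function.iterate_succ', ← List.map_map, ih, List.map_rotate, ← hk, List.rotate_rotate,
        mul_add, mul_one]
      congr 1; omega
  refine ⟨l.length, by omega, fun a ha => ?_⟩
  have h4 := h3 l.length
  rw [mul_comm, List.rotate_length_mul] at h4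
  have h5 : l.map (tl T)^[l.length] = l.map id := by rw [h4, List.map_id]
  have h6 := List.map_inj_left.1 h5 a ha
  have h7 : ∀ j, (tl T)^[j] a = ⟨a.1, (T a.1)^[j] a.2⟩ := by
    intro j
    induction j with
    | zero => rfl
    | succ j ih => rw [Function.iterate_succ', Function.iterate_succ', Function.comp_apply, ih]; rfl
  rw [h7] at h6
  exact eq_of_heq (Sigma.mk.inj_iff.1 h6).2

end FreeProd

end BraidGroup

namespace BraidGroup

open Equiv Monoid

namespace FreeProd

variable {ι : Type*} {M : ι → Type*} [∀ i, Group (M i)]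

/-- The reduced word starts and ends in the factor `i`. -/
def SE (i : ι) (g : CoprodI M) : Prop :=
  (∃ a ∈ (wd g).head?, a.1 = i) ∧ ∃ a ∈ (wd g).getLast?, a.1 = i

theorem SE.ne_nil {i : ι} {g : CoprodI M} (h : SE i g) : wd g ≠ [] := by
  obtain ⟨⟨a, ha, _⟩, _⟩ := h
  rintro e
  simp [e] at ha

theorem se_of {i : ι} {a : M i} (h : a ≠ 1) : SE i (CoprodI.of a : CoprodI M) := by
  simp [SE, wd_of h]

theorem Red.se {i : ι} {a b : M i} {p : List (Σ i, M i)} (h : Red (⟨i, a⟩ :: (p ++ [⟨i, b⟩]))) :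
    SE i (lprod (⟨i, a⟩ :: (p ++ [⟨i, b⟩]) : List (Σ i, M i))) := by
  rw [SE, h.wd_lprod]
  refine ⟨⟨_, rfl, rfl⟩, ⟨i, b⟩, ?_, rfl⟩
  exact List.getLast?_concat (l := ⟨i, a⟩ :: p) (a := (⟨i, b⟩ : Σ i, M i))

theorem SE.cases {i : ι} {g : CoprodI M} (h : SE i g) :
    (∃ a : M i, a ≠ 1 ∧ g = CoprodI.of a) ∨ ∃ (a b : M i) (p : List (Σ i, M i)),
      wd g = ⟨i, a⟩ :: (p ++ [⟨i, b⟩]) ∧ p ≠ [] := by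
  obtain ⟨⟨⟨i, a⟩, ha, rfl⟩, ⟨⟨j, b⟩, hb, hj⟩⟩ := h
  dsimp only at hj
  subst hj
  have h2 := List.cons_head?_tail ha
  have hr := red_wd g
  by_cases h3 : (wd g).tail = []
  · left
    rw [h3] at h2
    refine ⟨a, ?_, ?_⟩
    · rw [← h2] at hr; exact red_singleton.1 hr
    · rw [← lprod_wd g, ← h2]; simp
  · right
    have hb' : (⟨j, b⟩ : Σ i, M i) ∈ (wd g).tail.getLast? := by
      rw [← h2, List.getLast?_cons_of_ne_nil h3] at hb
      exact hb
    have h1 := List.dropLast_append_getLast? _ hb'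
    rw [← h1] at h2
    refine ⟨a, b, (wd g).tail.dropLast, h2.symm, fun h4 => ?_⟩
    rw [h4] at h2
    rw [← h2] at hr
    exact (red_cons.1 hr).2.2 ⟨j, b⟩ (by simp) rfl

theorem Red.replace_head {i : ι} {a c : M i} {v : List (Σ i, M i)} (h : Red (⟨i, a⟩ :: v))
    (hc : c ≠ 1) : Red ((⟨i, c⟩ : Σ i, M i) :: v) :=
  red_cons.2 ⟨hc, (red_cons.1 h).2.1, (red_cons.1 h).2.2⟩

theorem Red.replace_last {i : ι} {a c : M i} {v : List (Σ i, M i)} (h : Red (v ++ [⟨i, a⟩]))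
    (hc : c ≠ 1) : Red (v ++ [(⟨i, c⟩ : Σ i, M i)]) := by
  rw [red_append] at h ⊢
  refine ⟨h.1, red_singleton.2 hc, fun x hx y hy => ?_⟩
  simp only [List.head?_cons, Option.mem_def, Option.some.injEq] at hy
  subst hy
  exact h.2.2 x hx ⟨i, a⟩ (by simp)

theorem Red.glue {c : Σ i, M i} {u v : List (Σ i, M i)} (h : Red (u ++ [c])) (h' : Red (c :: v)) :
    Red (u ++ c :: v) := by
  refine red_append.2 ⟨h.left, h', fun x hx y hy => ?_⟩
  exact (red_append.1 h).2.2 x hx y (by simpa using hy)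

theorem SE.inv {i : ι} {g : CoprodI M} (h : SE i g) : SE i g⁻¹ := by
  have e : wd g⁻¹ = linv (wd g) := by
    rw [← (red_wd g).linv.wd_lprod, lprod_linv, lprod_wd]
  obtain ⟨⟨a, ha, hai⟩, b, hb, hbi⟩ := h
  rw [SE, e]
  simp only [linv, List.head?_reverse, List.getLast?_reverse, List.getLast?_map, List.head?_map]
  exact ⟨⟨⟨b.1, b.2⁻¹⟩, by simpa using ⟨b.1, b.2, hb, rfl, HEq.rfl⟩, hbi⟩,
    ⟨a.1, a.2⁻¹⟩, by simpa using ⟨a.1, a.2, ha, rfl, HEq.rfl⟩, hai⟩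

section Bool

variable {M : Bool → Type*} [∀ i, Group (M i)]

theorem Red.se_inner {i : Bool} {a b : M i} {p : List (Σ i, M i)}
    (hr : Red (⟨i, a⟩ :: (p ++ [⟨i, b⟩]))) (hp0 : p ≠ []) : SE (!i) (lprod p) := by
  have hpr : Red p := (red_cons.1 hr).2.1.left
  rw [SE, hpr.wd_lprod]
  constructor
  · obtain ⟨c, q, rfl⟩ := List.exists_cons_of_ne_nil hp0
    refine ⟨c, by simp, ?_⟩
    have := (red_cons.1 hr).2.2 c (by simp)
    cases i <;> simp_all
  · rcases List.eq_nil_or_concat p with rfl | ⟨q, c, rfl⟩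
    · exact absurd rfl hp0
    · refine ⟨c, by simp, ?_⟩
      have := (red_append.1 ((red_cons.1 hr).2.1)).2.2 c (by simp) ⟨i, b⟩ (by simp)
      cases i <;> simp_all

theorem SE.pow {i : Bool} {g : CoprodI M} (h : SE i g) (k : ℕ) : g ^ k = 1 ∨ SE i (g ^ k) := by
  induction hn : (wd g).length using Nat.strong_induction_on generalizing g i k with
  | _ n ih =>
    rcases h.cases with ⟨a, ha, rfl⟩ | ⟨a, b, p, hp, hp0⟩
    · rw [← map_pow]
      obtain h1 | h1 := eq_or_ne (a ^ k) 1
      · left; rw [h1, map_one]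
      · right; exact se_of h1
    · have hr := red_wd g
      rw [hp] at hr
      have hg : g = CoprodI.of a * lprod p * CoprodI.of b := by
        rw [← lprod_wd g, hp]; simp [mul_assoc]
      by_cases hba : b * a = 1
      · have hpr : Red p := (red_cons.1 hr).2.1.left
        have hse : SE (!i) (lprod p) := hr.se_inner hp0
        have hb : b = a⁻¹ := eq_inv_of_mul_eq_one_left hba
        have hgk : g ^ k = CoprodI.of a * lprod p ^ k * (CoprodI.of a)⁻¹ := by
          rw [hg, hb, map_inv, conj_pow]
        rcases ih _ (by rw [← hn, hp, hpr.wd_lprod]; simp) hse k rfl with h1 | h1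
        · left; rw [hgk, h1]; simp
        · right
          have hr2 : Red ((⟨i, a⟩ : Σ i, M i) :: (wd (lprod p ^ k) ++ [⟨i, b⟩])) := by
            obtain ⟨⟨c, hc, hci⟩, d, hd, hdi⟩ := h1
            refine red_cons.2 ⟨(red_cons.1 hr).1, red_append.2 ⟨red_wd _,
              (red_append.1 (red_cons.1 hr).2.1).2.1, fun x hx y hy => ?_⟩, fun y hy => ?_⟩
            · obtain rfl := Option.mem_unique hx hd
              simp only [List.head?_cons, Option.mem_def, Option.some.injEq] at hy
              subst hy
              rw [hdi]; cases i <;> simp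
            · have hc' : c ∈ (wd (lprod p ^ k) ++ [(⟨i, b⟩ : Σ i, M i)]).head? := by
                rw [List.head?_append_of_ne_nil]
                · exact hc
                · rintro e; simp [e] at hc
              obtain rfl := Option.mem_unique hy hc'
              rw [hci]; cases i <;> simp
          have := hr2.se
          rw [lprod_cons, lprod_append, lprod_wd] at this
          rw [hgk]
          simpa [mul_assoc, hb] using this
      · have key : ∀ k : ℕ, ∃ q : List (Σ i, M i), Red (⟨i, a⟩ :: (q ++ [⟨i, b⟩])) ∧
            lprod (⟨i, a⟩ :: (q ++ [⟨i, b⟩]) : List (Σ i, M i)) = g ^ (k + 1) := by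
          intro k
          induction k with
          | zero => exact ⟨p, hr, by rw [← hp]; simp⟩
          | succ k ihk =>
            obtain ⟨q, hq, e⟩ := ihk
            refine ⟨p ++ ⟨i, b * a⟩ :: q, ?_, ?_⟩
            · have h1 := Red.glue (Red.replace_last (v := ⟨i, a⟩ :: p) hr hba)
                (hq.replace_head hba)
              simpa using h1
            · rw [pow_succ', ← e, hg]; simp [mul_assoc]
        cases k with
        | zero => left; simp
        | succ k =>
          right
          obtain ⟨q, hq, e⟩ := key k
          rw [← e]
          exact hq.se

theorem SE.zpow {i : Bool} {g : CoprodI M} (h : SE i g) (k : ℤ) : g ^ k = 1 ∨ SE i (g ^ k) := by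
  obtain ⟨k, rfl | rfl⟩ := k.eq_nat_or_neg
  · rw [zpow_natCast]; exact h.pow k
  · rw [zpow_neg, zpow_natCast]
    exact (h.pow k).imp (fun h => by rw [h, inv_one]) SE.inv

end Bool

/-! ### Free products of subgroups -/

theorem red_flatMap {K : ι → Subgroup (CoprodI M)} (hK : ∀ i, ∀ v ∈ K i, v ≠ 1 → SE i v)
    {l : List (Σ i, K i)} (hl : Red l) :
    Red (l.flatMap fun a => wd (a.2 : CoprodI M)) ∧
      (∀ a ∈ (l.flatMap fun a => wd (a.2 : CoprodI M)).head?, ∃ b ∈ l.head?, a.1 = b.1) ∧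
      l.length ≤ (l.flatMap fun a => wd (a.2 : CoprodI M)).length ∧
      lprod (l.flatMap fun a => wd (a.2 : CoprodI M)) =
        CoprodI.lift (fun i => (K i).subtype) (lprod l) := by
  induction l with
  | nil => simpa using red_nil
  | cons b t ih =>
    obtain ⟨h1, h2, h3⟩ := red_cons.1 hl
    obtain ⟨i1, i2, i3, i4⟩ := ih h2
    have hse := hK b.1 b.2 b.2.2 (fun e => h1 (Subtype.ext e))
    have hne := hse.ne_nil
    rw [List.flatMap_cons]
    refine ⟨red_append.2 ⟨red_wd _, i1, fun x hx y hy => ?_⟩, fun x hx => ?_, ?_, ?_⟩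
    · obtain ⟨z, hz, e⟩ := i2 y hy
      obtain ⟨_, d, hd, hdi⟩ := hse
      obtain rfl := Option.mem_unique hx hd
      rw [e, hdi]
      exact h3 z hz
    · rw [List.head?_append_of_ne_nil _ hne] at hx
      obtain ⟨⟨d, hd, hdi⟩, _⟩ := hse
      obtain rfl := Option.mem_unique hx hd
      exact ⟨b, by simp, hdi⟩
    · have := List.length_pos_of_ne_nil hne
      simp only [List.length_append, List.length_cons]
      omega
    · rw [lprod_append, lprod_wd, i4, lprod_cons, map_mul]
      simp

theorem mem_of_wd_singleton {K : ι → Subgroup (CoprodI M)} (hK : ∀ i, ∀ v ∈ K i, v ≠ 1 → SE i v)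
    {i : ι} {a : M i} (ha : a ≠ 1) (hg : (CoprodI.of a : CoprodI M) ∈ ⨆ i, K i) :
    CoprodI.of a ∈ K i := by
  have h1 : (CoprodI.of a : CoprodI M) ∈ (CoprodI.lift fun i => (K i).subtype).range := by
    rw [CoprodI.range_eq_iSup]; simpa using hg
  obtain ⟨n, hn⟩ := h1
  obtain ⟨h2, h3, h4, h5⟩ := red_flatMap hK (red_wd n)
  rw [lprod_wd, hn] at h5
  have h6 := h2.wd_lprod
  rw [h5, wd_of ha] at h6
  rw [← h6] at h4
  rw [← lprod_wd n] at hn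
  match hw : wd n, h4 with
  | [], _ => rw [hw] at h6; simp at h6
  | [b], _ =>
    rw [hw] at hn h6
    simp only [lprod_cons, lprod_nil, mul_one, CoprodI.lift_of, Subgroup.coe_subtype] at hn
    have hse := hK b.1 b.2 b.2.2 (by
      intro e; rw [e] at hn
      have := wd_of (M := M) ha
      rw [← hn] at this; simp at this)
    obtain ⟨⟨d, hd, hdi⟩, _⟩ := hse
    rw [hn, wd_of ha] at hd
    simp only [List.head?_cons, Option.mem_def, Option.some.injEq] at hd
    subst hd
    dsimp only at hdi
    subst hdi
    rw [← hn]
    exact b.2.2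

end FreeProd

end BraidGroup

namespace BraidGroup

open Equiv Monoid FreeProd

/-- An automorphism compatible with the permutation of the strands and with the linking numbers of
pure braids. -/
structure IsLinkPreserving {n : ℕ} (φ : B n ≃* B n) : Prop where
  perm : ∀ b, perm n (φ b) = perm n b
  lk : ∀ p, BraidGroup.perm n p = 1 → ∀ i j, i < j → j < n → lk (φ p) i j = lk p i j

namespace IsLinkPreserving

variable {n : ℕ} {φ : B n ≃* B n}

theorem symm (h : IsLinkPreserving φ) : IsLinkPreserving φ.symm where
  perm b := by rw [← h.perm, φ.apply_symm_apply]
  lk p hp i j hij hj := by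
    rw [← h.lk _ _ i j hij hj, φ.apply_symm_apply]
    rw [← h.perm, φ.apply_symm_apply, hp]

theorem conj (h : IsLinkPreserving φ) {g : B n} (hg : BraidGroup.perm n g = 1) :
    IsLinkPreserving (φ.trans (MulAut.conj g)) where
  perm b := by simp [hg, h.perm]
  lk p hp i j hij hj := by
    rw [← h.lk p hp i j hij hj, MulEquiv.trans_apply, MulAut.conj_apply, lk_conj, hg]
    · simp
    · rw [h.perm, hp]

theorem apply_tw (h : IsLinkPreserving φ) : φ (tw n) = tw n := by
  have := eq_tw_of_lk (c := φ (tw n)) (by rw [h.perm, perm_tw]) (fun p _ => ?_) 1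
    (fun i j hij hj => ?_)
  · rw [this, zpow_one]
  · have := (commute_tw (φ.symm p)).symm.map φ
    simpa using this
  · rw [h.lk _ (perm_tw n) i j hij hj, lk_tw hij hj]; rfl

end IsLinkPreserving

/-! ### Three strands -/

/-- The homomorphism from a finite cyclic group given by a torsion element. -/
def cyc {H : Type*} [Group H] {k : ℕ} (g : H) (hg : g ^ k = 1) : Multiplicative (ZMod k) →* H :=
  AddMonoidHom.toMultiplicativeLeft (ZMod.lift k ⟨zmultiplesHom (Additive H) (Additive.ofMul g), by
    rw [zmultiplesHom_apply, natCast_zsmul]; exact hg⟩)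

theorem cyc_one {H : Type*} [Group H] {k : ℕ} (g : H) (hg : g ^ k = 1) :
    cyc g hg (Multiplicative.ofAdd 1) = g := by
  have := ZMod.lift_coe k (⟨zmultiplesHom (Additive H) (Additive.ofMul g), by
    rw [zmultiplesHom_apply, natCast_zsmul]; exact hg⟩ : {f : ℤ →+ Additive H // f k = 0}) 1
  simp only [Int.cast_one, zmultiplesHom_apply, one_zsmul] at this
  exact this

/-- The factors of the modular group. -/
abbrev ModFactor (b : Bool) : Type := Multiplicative (ZMod (cond b 2 3))

/-- The modular group, as a free product of cyclic groups of orders two and three. -/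
abbrev ModGroup : Type := CoprodI ModFactor

/-- The generator of order two. -/
def modS : ModGroup := CoprodI.of (M := ModFactor) (i := true) (Multiplicative.ofAdd 1)

/-- The generator of order three. -/
def modT : ModGroup := CoprodI.of (M := ModFactor) (i := false) (Multiplicative.ofAdd 1)

theorem modS_sq : modS ^ 2 = 1 := by
  rw [modS, ← map_pow, show (Multiplicative.ofAdd 1 : ModFactor true) ^ 2 = 1 by decide, map_one]

theorem modT_cube : modT ^ 3 = 1 := by
  rw [modT, ← map_pow, show (Multiplicative.ofAdd 1 : ModFactor false) ^ 3 = 1 by decide, map_one]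

/-- The images of the standard generators of `B 3` in the modular group. -/
def modFun (j : ℕ) : ModGroup := if j = 0 then modT⁻¹ * modS else modS * modT⁻¹

theorem isBraidFamily_modFun : IsBraidFamily 3 modFun where
  comm i j h1 h2 := by omega
  braid i hi := by
    obtain rfl : i = 0 := by omega
    have h1 := modS_sq
    have h2 := modT_cube
    have h3 : modS * modS = 1 := by rw [← sq]; exact h1
    have h4 : modT⁻¹ * modT⁻¹ = modT := by
      rw [← mul_inv_rev, inv_eq_iff_mul_eq_one, mul_assoc, ← sq, ← pow_succ']; exact h2
    simp only [modFun, if_true, zero_add, one_ne_zero, if_false]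
    calc _ = modT⁻¹ * (modS * modS) * (modT⁻¹ * modT⁻¹) * modS := by group
      _ = modS * (modT⁻¹ * modT⁻¹) * (modS * modS) * modT⁻¹ := by rw [h3, h4]; group
      _ = _ := by group

/-- The quotient map to the modular group. -/
def toMod : B 3 →* ModGroup := lift isBraidFamily_modFun

theorem toMod_s_zero : toMod (s 3 0) = modT⁻¹ * modS := lift_s _ (by omega)

theorem toMod_s_one : toMod (s 3 1) = modS * modT⁻¹ := lift_s _ (by omega)

theorem toMod_two : toMod (s 3 0 * s 3 1) = modT := by
  have h4 : modT⁻¹ * modT⁻¹ = modT := by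
    rw [← mul_inv_rev, inv_eq_iff_mul_eq_one, mul_assoc, ← sq, ← pow_succ']; exact modT_cube
  rw [map_mul, toMod_s_zero, toMod_s_one]
  calc _ = modT⁻¹ * (modS ^ 2) * modT⁻¹ := by simp only [sq, mul_assoc]
    _ = _ := by rw [modS_sq, mul_one, h4]

theorem toMod_three : toMod (s 3 0 * s 3 1 * s 3 0) = modS := by
  rw [map_mul, toMod_two, toMod_s_zero]; group

theorem tw_three_eq_sq : tw 3 = (s 3 0 * s 3 1 * s 3 0) ^ 2 := by
  have h1 : tw 3 = s 3 1 * s 3 1 * s 3 0 * s 3 1 * s 3 1 * s 3 0 := by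
    have e1 : xbar 2 1 = s 3 1 ^ 2 := xbar_last 1
    have e2 : xbar 1 0 = s 2 0 ^ 2 := xbar_last 0
    have h0 : tw 1 = 1 := eq_one_of_le_one le_rfl _
    rw [tw_succ, tw_succ, h0]
    simp only [W, map_mul, pf_x, xbar_eq (show 0 + 1 < 2 by omega), e1, e2, mul_one, map_one,
      up_s (show 0 + 1 < 2 by omega), sq, mul_assoc, inv_mul_cancel_left]
  have h2 := s_braid (n := 3) (i := 0) (by omega)
  rw [zero_add] at h2
  rw [h1]
  calc _ = s 3 1 * (s 3 1 * s 3 0 * s 3 1) * (s 3 1 * s 3 0) := by group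
    _ = s 3 1 * (s 3 0 * s 3 1 * s 3 0) * (s 3 1 * s 3 0) := by rw [h2]
    _ = (s 3 1 * s 3 0 * s 3 1) * (s 3 0 * s 3 1 * s 3 0) := by simp only [mul_assoc]
    _ = _ := by rw [← h2, sq]

theorem tw_three_eq_cube : tw 3 = (s 3 0 * s 3 1) ^ 3 := by
  have h2 := s_braid (n := 3) (i := 0) (by omega)
  rw [zero_add] at h2
  rw [tw_three_eq_sq]
  calc _ = s 3 0 * s 3 1 * s 3 0 * (s 3 0 * s 3 1 * s 3 0) := sq _
    _ = _ := by nth_rw 2 [h2]; simp only [pow_succ, pow_zero, one_mul, mul_assoc]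

theorem iSup_range_of {ι : Type*} {M : ι → Type*} [∀ i, Group (M i)] :
    ⨆ i, (CoprodI.of : M i →* CoprodI M).range = ⊤ := by
  rw [← CoprodI.range_eq_iSup, MonoidHom.range_eq_top]
  exact fun g => ⟨g, DFunLike.congr_fun (CoprodI.lift_of' (M := M)) g⟩

theorem toMod_surjective : Function.Surjective toMod := by
  rw [← MonoidHom.range_eq_top, eq_top_iff, ← iSup_range_of, iSup_le_iff]
  have key : ∀ {k : ℕ} (g : ModGroup) (f : Multiplicative (ZMod k) →* ModGroup),
      f (Multiplicative.ofAdd 1) = g → g ∈ toMod.range → f.range ≤ toMod.range := by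
    rintro k g f rfl hg _ ⟨a, rfl⟩
    obtain ⟨z, hz⟩ := ZMod.intCast_surjective (Multiplicative.toAdd a)
    have : a = (Multiplicative.ofAdd (1 : ZMod k)) ^ z := by
      rw [← ofAdd_zsmul, zsmul_one, hz]; rfl
    rw [this, map_zpow]
    exact Subgroup.zpow_mem _ hg _
  rintro (_ | _)
  · exact key modT _ rfl ⟨_, toMod_two⟩
  · exact key modS _ rfl ⟨_, toMod_three⟩

theorem exists_tw_zpow_of_toMod {b : B 3} (h : toMod b = 1) : ∃ k : ℤ, b = tw 3 ^ k := by
  have : (Subgroup.zpowers (tw 3)).Normal := ⟨by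
    rintro _ ⟨k, rfl⟩ g
    refine ⟨k, ?_⟩
    rw [((commute_tw g).zpow_right k).eq, mul_inv_cancel_right]⟩
  let mk := QuotientGroup.mk' (Subgroup.zpowers (tw 3))
  have h1 : mk (tw 3) = 1 := (QuotientGroup.eq_one_iff _).2 (Subgroup.mem_zpowers _)
  have hS : mk (s 3 0 * s 3 1 * s 3 0) ^ 2 = 1 := by rw [← map_pow, ← tw_three_eq_sq, h1]
  have hT : mk (s 3 0 * s 3 1) ^ 3 = 1 := by rw [← map_pow, ← tw_three_eq_cube, h1]
  let ψ : ModGroup →* B 3 ⧸ Subgroup.zpowers (tw 3) := CoprodI.lift fun i => match i with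
    | true => cyc _ hS
    | false => cyc _ hT
  have eS : ψ modS = mk (s 3 0 * s 3 1 * s 3 0) := by
    rw [modS]; exact (CoprodI.lift_of _ _).trans (cyc_one _ hS)
  have eT : ψ modT = mk (s 3 0 * s 3 1) := by
    rw [modT]; exact (CoprodI.lift_of _ _).trans (cyc_one _ hT)
  have h2 : ψ.comp toMod = mk := by
    apply hom_ext
    intro i hi
    rcases (by omega : i = 0 ∨ i = 1) with rfl | rfl
    · rw [MonoidHom.comp_apply, toMod_s_zero, map_mul, map_inv, eS, eT, ← map_inv, ← map_mul]
      congr 1; group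
    · have h2 := s_braid (n := 3) (i := 0) (by omega)
      rw [zero_add] at h2
      rw [MonoidHom.comp_apply, toMod_s_one, map_mul, map_inv, eS, eT, ← map_inv, ← map_mul, h2]
      congr 1; group
  have h3 : mk b = 1 := by rw [← h2, MonoidHom.comp_apply, h, map_one]
  obtain ⟨k, hk⟩ := (QuotientGroup.eq_one_iff _).1 h3
  exact ⟨k, hk.symm⟩

theorem eq_of_toMod {a b : B 3} (h : toMod a = toMod b) (he : expo 3 a = expo 3 b) : a = b := by
  obtain ⟨k, hk⟩ := exists_tw_zpow_of_toMod (b := a * b⁻¹)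
    (by rw [map_mul, h, map_inv, mul_inv_cancel])
  have h1 : expo 3 (a * b⁻¹) = 1 := by rw [map_mul, he, map_inv, mul_inv_cancel]
  rw [hk, tw_three_eq_sq] at h1
  simp only [map_zpow, map_pow, map_mul, expo_s (show 0 + 1 < 3 by omega),
    expo_s (show 1 + 1 < 3 by omega)] at h1
  have h2 : (k : ℤ) = 0 := by
    have := congrArg Multiplicative.toAdd h1
    simp at this
    exact this
  rw [h2, zpow_zero] at hk
  exact mul_inv_eq_one.1 hk

theorem perm_eq_one_of_commute {n : ℕ} (hn : 3 ≤ n) {g : B n}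
    (h : ∀ b, Commute (perm n g) (perm n b)) : perm n g = 1 := by
  have h1 : ∀ i, i + 1 < n → (perm n g i = i ∨ perm n g i = i + 1) ∧
      (perm n g (i + 1) = i ∨ perm n g (i + 1) = i + 1) := by
    intro i hi
    have e := (h (s n i)).eq
    rw [perm_s hi] at e
    have e1 := Perm.congr_fun e i
    have e2 := Perm.congr_fun e (i + 1)
    simp only [Perm.mul_apply, swap_apply_left, swap_apply_right] at e1 e2
    have h3 : ∀ k, swap i (i + 1) k ≠ k → k = i ∨ k = i + 1 := fun k hk => by
      by_contra hc
      push Not at hc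
      exact hk (swap_apply_of_ne_of_ne hc.1 hc.2)
    refine ⟨h3 _ ?_, h3 _ ?_⟩
    · rw [← e1]; exact fun h => by simpa using (perm n g).injective h
    · rw [← e2]; exact fun h => by simpa using (perm n g).injective h
  have h2 : ∀ u, 0 < u → u + 1 < n → perm n g u = u := by
    intro u h0 hu
    obtain ⟨v, rfl⟩ : ∃ v, u = v + 1 := ⟨u - 1, by omega⟩
    have := (h1 v (by omega)).2
    have := (h1 (v + 1) hu).1
    omega
  ext u
  rw [Perm.one_apply]
  obtain hu | hu := lt_or_ge u n
  · obtain rfl | h0 := Nat.eq_zero_or_pos u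
    · have e1 := h2 1 one_pos (by omega)
      rcases (h1 0 (by omega)).1 with h | h
      · exact h
      · exact absurd ((perm n g).injective (h.trans e1.symm)) (by omega)
    · obtain h3 | h3 := lt_or_ge (u + 1) n
      · exact h2 u h0 h3
      · obtain ⟨v, rfl⟩ : ∃ v, u = v + 1 := ⟨u - 1, by omega⟩
        rcases (h1 v (by omega)).2 with h | h
        · exact absurd ((perm n g).injective (h.trans (h2 v (by omega) (by omega)).symm)) (by omega)
        · exact h
  · exact perm_apply_of_le _ hu

theorem exists_conj_modS {S : ModGroup} (h : S ^ 2 = 1) (h1 : S ≠ 1) :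
    ∃ c, c * S * c⁻¹ = modS := by
  obtain ⟨c, i, a, e⟩ := exists_conj_of_torsion two_pos h h1
  have ha1 : a ≠ 1 := by
    rintro rfl
    rw [map_one] at e
    exact h1 (by simpa using e)
  have ha : a ^ 2 = 1 := by
    apply CoprodI.of_injective i
    rw [map_pow, ← e, conj_pow, h]; simp
  cases i with
  | false =>
    have : ∀ a : Multiplicative (ZMod 3), a ≠ 1 → a ^ 2 ≠ 1 := by decide
    exact absurd ha (this a ha1)
  | true =>
    refine ⟨c, ?_⟩
    rw [e, modS]
    have : ∀ a : Multiplicative (ZMod 2), a ≠ 1 → a = Multiplicative.ofAdd 1 := by decide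
    rw [this a ha1]

theorem exists_conj_se {S T : ModGroup} (hS : S ^ 2 = 1) (hS1 : S ≠ 1) (hT : T ^ 3 = 1)
    (hT1 : T ≠ 1) : ∃ c, c * S * c⁻¹ = modS ∧ SE false (c * T * c⁻¹) := by
  obtain ⟨c, hc⟩ := exists_conj_modS hS hS1
  obtain ⟨U, hU⟩ : ∃ U, U = c * T * c⁻¹ := ⟨_, rfl⟩
  have hU3 : U ^ 3 = 1 := by rw [hU, conj_pow, hT]; simp
  have hU1 : U ≠ 1 := by rw [hU]; simpa using hT1
  have hne : wd U ≠ [] := fun h => hU1 (wd_eq_nil h)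
  obtain ⟨x, hx⟩ := Option.isSome_iff_exists.1 (List.isSome_head?.2 hne)
  obtain ⟨y, hy⟩ := Option.isSome_iff_exists.1 (by simpa using hne : (wd U).getLast?.isSome)
  have hxy : x.1 = y.1 := by
    by_contra hxy
    have := length_le_one_of_torsion (c := 1) (by omega) hU3 (l := wd U) (by simp)
      (Or.inr (red_append.2 ⟨red_wd _, red_wd _, fun a ha b hb => by
        rw [hx] at hb; rw [hy] at ha; cases ha; cases hb; exact Ne.symm hxy⟩))
    match hw : wd U, this with
    | [z], _ => rw [hw] at hx hy; simp at hx hy; subst hx; subst hy; exact hxy rfl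
    | [], _ => exact hne hw
  have hse : SE x.1 U := ⟨⟨x, hx, rfl⟩, y, hy, hxy.symm⟩
  cases hi : x.1 with
  | false => rw [hi, hU] at hse; exact ⟨c, hc, hse⟩
  | true =>
    rw [hi] at hse
    rcases hse.cases with ⟨a, ha, rfl⟩ | ⟨a, b, p, hp, hp0⟩
    · exfalso
      rw [← map_pow] at hU3
      have h3 := CoprodI.of_injective true (hU3.trans (map_one _).symm)
      have : ∀ a : Multiplicative (ZMod 2), a ≠ 1 → a ^ 3 ≠ 1 := by decide
      exact this a ha h3
    · have hr := red_wd U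
      rw [hp] at hr
      have h1 : ∀ a : Multiplicative (ZMod 2), a ≠ 1 → a = Multiplicative.ofAdd 1 := by decide
      have ea := h1 a (red_cons.1 hr).1
      have eb := h1 b (red_singleton.1 (red_cons.1 hr).2.1.right)
      have hs : modS⁻¹ = modS := inv_eq_of_mul_eq_one_left (by rw [← sq, modS_sq])
      have e : U = modS * lprod p * modS := by
        rw [← lprod_wd U, hp, lprod_cons, lprod_append, lprod_cons, lprod_nil, mul_one, ea, eb,
          mul_assoc]
        rfl
      refine ⟨modS⁻¹ * c, ?_, ?_⟩
      · calc _ = modS⁻¹ * (c * S * c⁻¹) * modS := by group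
          _ = _ := by rw [hc]; group
      · have : modS⁻¹ * c * T * (modS⁻¹ * c)⁻¹ = lprod p := by
          calc _ = modS⁻¹ * (c * T * c⁻¹) * modS := by group
            _ = modS⁻¹ * (c * T * c⁻¹) * modS⁻¹ := by rw [hs]
            _ = _ := by rw [← hU, e]; group
        rw [this]
        exact hr.se_inner hp0

theorem IsLinkPreserving.exists_conj_three {φ : B 3 ≃* B 3} (h : IsLinkPreserving φ) :
    ∃ g, BraidGroup.perm 3 g = 1 ∧ ∀ b, φ b = g * b * g⁻¹ := by
  obtain ⟨D, hD⟩ : ∃ D, D = s 3 0 * s 3 1 * s 3 0 := ⟨_, rfl⟩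
  obtain ⟨d, hd⟩ : ∃ d, d = s 3 0 * s 3 1 := ⟨_, rfl⟩
  have hD2 := tw_three_eq_sq
  have hd3 := tw_three_eq_cube
  have qD := toMod_three
  have qd := toMod_two
  have eD : expo 3 D = Multiplicative.ofAdd 3 := by
    rw [hD, map_mul, map_mul, expo_s (by omega), expo_s (by omega)]; rfl
  have ed : expo 3 d = Multiplicative.ofAdd 2 := by
    rw [hd, map_mul, expo_s (by omega), expo_s (by omega)]; rfl
  have s0 : s 3 0 = d⁻¹ * D := by rw [hD, hd]; group
  have s1 : s 3 1 = (d⁻¹ * D)⁻¹ * d := by rw [hD, hd]; group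
  rw [← hD] at hD2 qD
  rw [← hd] at hd3 qd
  have eD' : expo 3 (φ D) = expo 3 D := by
    apply pow_left_injective (two_ne_zero)
    dsimp only
    rw [← map_pow, ← map_pow, ← map_pow, ← hD2, h.apply_tw]
  have ed' : expo 3 (φ d) = expo 3 d := by
    apply pow_left_injective (three_ne_zero)
    dsimp only
    rw [← map_pow, ← map_pow, ← map_pow, ← hd3, h.apply_tw]
  have htw : ∀ k : ℤ, Multiplicative.toAdd (expo 3 (tw 3 ^ k)) = 6 * k := by
    intro k
    rw [hD2, map_zpow, map_pow, eD]
    simp; ring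
  have hS2 : toMod (φ D) ^ 2 = 1 := by
    rw [← map_pow, ← map_pow, ← hD2, h.apply_tw, hD2, map_pow, qD, modS_sq]
  have hT3 : toMod (φ d) ^ 3 = 1 := by
    rw [← map_pow, ← map_pow, ← hd3, h.apply_tw, hd3, map_pow, qd, modT_cube]
  have hS1 : toMod (φ D) ≠ 1 := by
    intro h1
    obtain ⟨k, hk⟩ := exists_tw_zpow_of_toMod h1
    have := htw k
    rw [← hk, eD', eD, toAdd_ofAdd] at this
    omega
  have hT1 : toMod (φ d) ≠ 1 := by
    intro h1
    obtain ⟨k, hk⟩ := exists_tw_zpow_of_toMod h1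
    have := htw k
    rw [← hk, ed', ed, toAdd_ofAdd] at this
    omega
  obtain ⟨c, hc, hse⟩ := exists_conj_se hS2 hS1 hT3 hT1
  obtain ⟨U, hU⟩ : ∃ U, U = c * toMod (φ d) * c⁻¹ := ⟨_, rfl⟩
  rw [← hU] at hse
  have hU3 : U ^ 3 = 1 := by rw [hU, conj_pow, hT3]; simp
  let K : Bool → Subgroup ModGroup := fun i => match i with
    | true => (CoprodI.of : ModFactor true →* ModGroup).range
    | false => Subgroup.zpowers U
  have hK : ∀ i, ∀ v ∈ K i, v ≠ 1 → SE i v := by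
    rintro (_ | _) v hv hv1
    · obtain ⟨k, rfl⟩ := hv
      exact (hse.zpow k).resolve_left hv1
    · obtain ⟨a, rfl⟩ := hv
      refine se_of ?_
      rintro rfl
      exact hv1 (map_one _)
  let f : B 3 →* ModGroup := (MulAut.conj c).toMonoidHom.comp (toMod.comp φ.toMonoidHom)
  have hf : Function.Surjective f :=
    (MulAut.conj c).surjective.comp (toMod_surjective.comp φ.surjective)
  have hfD : f D ∈ ⨆ i, K i := by
    refine Subgroup.mem_iSup_of_mem true ?_
    exact ⟨Multiplicative.ofAdd 1, hc.symm⟩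
  have hfd : f d ∈ ⨆ i, K i := by
    refine Subgroup.mem_iSup_of_mem false ?_
    exact ⟨1, by rw [hU]; exact zpow_one _⟩
  have hall : ∀ b, f b ∈ ⨆ i, K i := by
    refine mem_of_s_mem ((⨆ i, K i).comap f) fun i hi => ?_
    have h0 : s 3 0 ∈ (⨆ i, K i).comap f := by
      rw [s0]
      exact mul_mem (inv_mem hfd) hfD
    rcases (by omega : i = 0 ∨ i = 1) with rfl | rfl
    · exact h0
    · rw [s1, ← s0]
      exact mul_mem (inv_mem h0) hfd
  have hT : modT ∈ Subgroup.zpowers U := by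
    obtain ⟨b, hb⟩ := hf modT
    refine mem_of_wd_singleton hK (i := false) (by decide) ?_
    have := hall b
    rw [hb] at this
    exact this
  obtain ⟨k, hk⟩ := hT
  dsimp only at hk
  obtain ⟨g, hg⟩ := toMod_surjective c
  have gD : g * φ D * g⁻¹ = D := by
    apply eq_of_toMod
    · rw [map_mul, map_mul, map_inv, hg, hc, qD]
    · rw [map_mul, map_mul, map_inv, eD', mul_inv_cancel_comm]
  have gd : g * φ d * g⁻¹ = d := by
    have hgU : toMod (g * φ d * g⁻¹) = U := by rw [map_mul, map_mul, map_inv, hg, hU]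
    have he : expo 3 (g * φ d * g⁻¹) = expo 3 d := by
      rw [map_mul, map_mul, map_inv, ed', mul_inv_cancel_comm]
    apply eq_of_toMod _ he
    have hk3 : modT = U ^ (k % 3) := by
      rw [← hk]
      conv_lhs => rw [← Int.emod_add_mul_ediv k 3, zpow_add, zpow_mul]
      rw [show U ^ (3 : ℤ) = 1 from by exact_mod_cast hU3]; simp
    rcases (by omega : k % 3 = 0 ∨ k % 3 = 1 ∨ k % 3 = 2) with h0 | h0 | h0
    · rw [h0, zpow_zero] at hk3
      have := wd_of (M := ModFactor) (i := false) (a := Multiplicative.ofAdd 1) (by decide)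
      rw [show CoprodI.of (M := ModFactor) (i := false) (Multiplicative.ofAdd 1) = 1 from hk3]
        at this
      simp at this
    · rw [h0, zpow_one] at hk3
      rw [hgU, qd, hk3]
    · exfalso
      obtain ⟨j, hj⟩ := exists_tw_zpow_of_toMod (b := g * φ d * g⁻¹ * d) (by
        rw [map_mul, hgU, qd, hk3, h0, ← zpow_one_add]; exact_mod_cast hU3)
      have := htw j
      rw [← hj, map_mul, he, ed] at this
      have h4 : (2 + 2 : ℤ) = 6 * j := this
      omega
  have hfix : ((MulAut.conj g).toMonoidHom.comp φ.toMonoidHom) = MonoidHom.id (B 3) := by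
    have h0 : ((MulAut.conj g).toMonoidHom.comp φ.toMonoidHom) D = D := gD
    have h1 : ((MulAut.conj g).toMonoidHom.comp φ.toMonoidHom) d = d := gd
    apply hom_ext
    intro i hi
    rcases (by omega : i = 0 ∨ i = 1) with rfl | rfl
    · rw [s0, map_mul, map_inv, h0, h1]; rfl
    · rw [s1, map_mul, map_inv, map_mul, map_inv, h0, h1]; rfl
  have hfix' : ∀ b, φ b = g⁻¹ * b * g := fun b => by
    have : g * φ b * g⁻¹ = b := DFunLike.congr_fun hfix b
    nth_rw 2 [← this]; group
  refine ⟨g⁻¹, ?_, fun b => by rw [hfix', inv_inv]⟩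
  refine perm_eq_one_of_commute le_rfl fun b => ?_
  have := h.perm b
  rw [hfix', map_mul, map_mul] at this
  rw [commute_iff_eq]
  nth_rw 2 [← this]
  rw [map_inv]; group

end BraidGroup

namespace BraidGroup

open Equiv Monoid FreeProd

namespace IsLinkPreserving

variable {m : ℕ} {φ : B (m + 1) ≃* B (m + 1)}

theorem perm_apply_up (h : IsLinkPreserving φ) (b : B m) :
    BraidGroup.perm (m + 1) (φ (up b)) m = m := by
  rw [h.perm, perm_up_last]

theorem perm_apply_pure (h : IsLinkPreserving φ) {p : B (m + 1)}
    (hp : BraidGroup.perm (m + 1) p = 1) : BraidGroup.perm (m + 1) (φ p) = 1 := by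
  rw [h.perm, hp]

/-- The automorphism obtained by forgetting the last strand, as a homomorphism. -/
def forgetHom (h : IsLinkPreserving φ) : B m →* B m :=
  MonoidHom.mk' (fun b => forget (φ (up b))) fun a b => by
    rw [map_mul, map_mul, forget_mul (h.perm_apply_up a)]

theorem forgetHom_apply (h : IsLinkPreserving φ) (b : B m) :
    h.forgetHom b = forget (φ (up b)) := rfl

theorem isPureMap (h : IsLinkPreserving φ) :
    IsPureMap (Nat.le_succ m) fun p => forget (φ p) where
  mul p q hp hq := by
    rw [map_mul, forget_mul]
    rw [h.perm, hp]; rfl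
  pure p hp := by
    rw [perm_forget, h.perm, hp]
    rw [h.perm, hp]; rfl
  lk_eq p hp i j hij hj := by
    rw [lk_forget (h.perm_apply_pure hp) hij hj, h.lk p hp i j hij (by omega)]
  surj q hq := by
    have h1 : BraidGroup.perm (m + 1) (up q) = 1 := by rw [perm_incl, hq]
    refine ⟨φ.symm (up q), by rw [h.symm.perm, h1], ?_⟩
    rw [φ.apply_symm_apply, forget_up]
  conj b := by
    refine ⟨forget (φ (up b)) * b⁻¹, ?_, fun p hp => ?_⟩
    · rw [map_mul, perm_forget (h.perm_apply_up b), h.perm, perm_incl, map_inv, mul_inv_cancel]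
    · have h1 : BraidGroup.perm (m + 1) (φ (up b) * φ p) m = m := by
        rw [map_mul, h.perm_apply_pure hp, mul_one, h.perm_apply_up]
      change forget (φ (up b * p * (up b)⁻¹)) = _
      rw [map_mul, map_mul, map_inv, forget_mul h1, forget_mul (h.perm_apply_up b),
        forget_inv (h.perm_apply_up b)]
      group

theorem forget_apply_pf (h : IsLinkPreserving φ) (f : FreeGroup ℕ) : forget (φ (pf m f)) = 1 := by
  let K : FreeGroup ℕ →* B m := MonoidHom.mk' (fun f => forget (φ (pf m f))) fun a b => by
    rw [map_mul, h.isPureMap.mul _ _ (perm_pf _) (perm_pf _)]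
  have : K = 1 := by
    ext i
    change forget (φ (pf m (x i))) = 1
    rw [pf_x]
    obtain hi | hi := lt_or_ge i m
    · have := h.isPureMap.map_xbar hi le_rfl (Nat.lt_succ_self m)
      rwa [incl_refl] at this
    · rw [xbar_of_le hi]
      exact h.isPureMap.map_one
  exact DFunLike.congr_fun this f

theorem apply_pf (h : IsLinkPreserving φ) (f : FreeGroup ℕ) :
    φ (pf m f) = pf m (fpart (φ (pf m f))) := by
  have := eq_pf_mul_up (b := φ (pf m f)) (by rw [h.perm_apply_pure (perm_pf _)]; rfl)
  rwa [h.forget_apply_pf, map_one, mul_one] at this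

theorem apply_up (h : IsLinkPreserving φ) (b : B m) :
    φ (up b) = pf m (fpart (φ (up b))) * up (h.forgetHom b) :=
  eq_pf_mul_up (h.perm_apply_up b)

theorem forgetHom_symm_apply (h : IsLinkPreserving φ) (b : B m) :
    h.forgetHom (h.symm.forgetHom b) = b := by
  have h1 : up (h.symm.forgetHom b) =
      (pf m (fpart (φ.symm (up b))))⁻¹ * φ.symm (up b) := by
    nth_rw 2 [h.symm.apply_up b]; group
  rw [forgetHom_apply, h1, map_mul, φ.apply_symm_apply, forget_mul, ← map_inv, h.forget_apply_pf,
    one_mul, forget_up]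
  rw [h.perm, map_inv, perm_pf, inv_one]; rfl

/-- The automorphism obtained by forgetting the last strand. -/
def forgetEquiv (h : IsLinkPreserving φ) : B m ≃* B m :=
  MonoidHom.toMulEquiv h.forgetHom h.symm.forgetHom
    (MonoidHom.ext fun b => h.symm.forgetHom_symm_apply b)
    (MonoidHom.ext fun b => h.forgetHom_symm_apply b)

theorem isLinkPreserving_forgetEquiv (h : IsLinkPreserving φ) :
    IsLinkPreserving h.forgetEquiv where
  perm b := by
    change BraidGroup.perm m (forget (φ (up b))) = _
    rw [perm_forget (h.perm_apply_up b), h.perm, perm_incl]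
  lk p hp i j hij hj := by
    change BraidGroup.lk (forget (φ (up p))) i j = _
    rw [h.isPureMap.lk_eq _ (by rw [perm_incl, hp]) i j hij hj, lk_incl]

/-- The action on the free kernel of forgetting the last strand. -/
def kerHom (h : IsLinkPreserving φ) : FreeGroup ℕ →* FreeGroup ℕ :=
  MonoidHom.mk' (fun f => fpart (φ (pf m f))) fun a b => by
    rw [map_mul, map_mul, h.apply_pf a, h.apply_pf b, ← map_mul, fpart_pf, fpart_pf, fpart_pf,
      map_mul]

theorem pf_kerHom (h : IsLinkPreserving φ) (f : FreeGroup ℕ) : pf m (h.kerHom f) = φ (pf m f) :=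
  (h.apply_pf f).symm

theorem retr_kerHom (h : IsLinkPreserving φ) (f : FreeGroup ℕ) :
    retr m (h.kerHom f) = h.kerHom f :=
  retr_fpart (by rw [h.perm_apply_pure (perm_pf _)]; rfl)

theorem fexp_kerHom (h : IsLinkPreserving φ) (f : FreeGroup ℕ) {i : ℕ} (hi : i < m) :
    fexp i (h.kerHom f) = fexp i (retr m f) := by
  have h1 := h.lk _ (perm_pf f) i m hi (Nat.lt_succ_self m)
  rw [lk_last (h.perm_apply_pure (perm_pf f)) hi, lk_last (perm_pf f) hi, fpart_pf] at h1
  apply Multiplicative.toAdd.injective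
  exact mul_left_cancel₀ two_ne_zero h1

theorem kerHom_symm (h : IsLinkPreserving φ) (f : FreeGroup ℕ) :
    h.kerHom (h.symm.kerHom f) = retr m f := by
  apply pf_injective (h.retr_kerHom _) (retr_retr _ _ )
  rw [h.pf_kerHom, h.symm.pf_kerHom, φ.apply_symm_apply, pf_retr]

end IsLinkPreserving

end BraidGroup

namespace BraidGroup

open Equiv Monoid FreeProd

/-! ### Free splittings of the free group -/

/-- The factors of the splitting of the free group isolating one generator. -/
abbrev SplitFactor : Bool → Type
  | true => FreeGroup ℕ
  | false => Multiplicative ℤ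

instance : ∀ i, Group (SplitFactor i)
  | true => inferInstanceAs (Group (FreeGroup ℕ))
  | false => inferInstanceAs (Group (Multiplicative ℤ))

/-- The splitting isolating the generator `x k`. -/
def split (k : ℕ) : FreeGroup ℕ →* CoprodI SplitFactor :=
  FreeGroup.lift fun i => if i = k then
    CoprodI.of (M := SplitFactor) (i := false) (Multiplicative.ofAdd (1 : ℤ)) else
    CoprodI.of (M := SplitFactor) (i := true) (x i)

theorem split_self (k : ℕ) : split k (x k) =
    CoprodI.of (M := SplitFactor) (i := false) (Multiplicative.ofAdd (1 : ℤ)) := by simp [split]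

theorem split_ne {i k : ℕ} (h : i ≠ k) : split k (x i) =
    CoprodI.of (M := SplitFactor) (i := true) (x i) := by simp [split, h]

/-- Homomorphisms out of the splitting. -/
def splitLift {G : Type*} [Group G] (f : FreeGroup ℕ →* G) (g : Multiplicative ℤ →* G) :
    CoprodI SplitFactor →* G :=
  CoprodI.lift fun i => match i with
    | true => f
    | false => g

theorem splitLift_true {G : Type*} [Group G] (f : FreeGroup ℕ →* G) (g : Multiplicative ℤ →* G)
    (a : FreeGroup ℕ) : splitLift f g (CoprodI.of (M := SplitFactor) (i := true) a) = f a :=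
  CoprodI.lift_of _ _

theorem splitLift_false {G : Type*} [Group G] (f : FreeGroup ℕ →* G) (g : Multiplicative ℤ →* G)
    (a : Multiplicative ℤ) : splitLift f g (CoprodI.of (M := SplitFactor) (i := false) a) = g a :=
  CoprodI.lift_of _ _

/-- The inverse of the splitting. -/
def unsplit (k : ℕ) : CoprodI SplitFactor →* FreeGroup ℕ :=
  splitLift (MonoidHom.id _) (zpowersHom _ (x k))

theorem unsplit_split (k : ℕ) (f : FreeGroup ℕ) : unsplit k (split k f) = f := by
  have : (unsplit k).comp (split k) = MonoidHom.id _ := FreeGroup.ext_hom _ _ fun i => by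
    rw [MonoidHom.comp_apply]
    obtain rfl | h := eq_or_ne i k
    · rw [split_self, unsplit, splitLift_false]; simp
    · rw [split_ne h, unsplit, splitLift_true]
  exact DFunLike.congr_fun this f

/-- The action of a full twist on the splitting. -/
def twistT (k : ℕ) : ∀ i, SplitFactor i →* SplitFactor i
  | true => (MulAut.conj (W k)⁻¹).toMonoidHom
  | false => MonoidHom.id _

theorem twistT_injective (k : ℕ) : ∀ i, Function.Injective (twistT k i)
  | true => (MulAut.conj (W k)⁻¹).injective
  | false => Function.injective_id

theorem twistT_iterate (k r : ℕ) (a : FreeGroup ℕ) :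
    (twistT k true)^[r] a = (W k ^ r)⁻¹ * a * W k ^ r := by
  induction r with
  | zero => simp
  | succ r ih =>
    rw [Function.iterate_succ_apply', ih]
    change (W k)⁻¹ * _ * (W k)⁻¹⁻¹ = _
    rw [pow_succ]; group

theorem hat_twistT (k : ℕ) (f : FreeGroup ℕ) :
    hat (twistT k) (split k (retr (k + 1) f)) =
      split k (artin (k + 1) (incl (Nat.le_succ k) (tw k)) (retr (k + 1) f)) := by
  have : ((hat (twistT k)).comp (split k)).comp (retr (k + 1)) = ((split k).comp
      (artin (k + 1) (incl (Nat.le_succ k) (tw k))).toMonoidHom).comp (retr (k + 1)) :=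
    FreeGroup.ext_hom _ _ fun i => by
      simp only [MonoidHom.comp_apply, MulEquiv.coe_toMonoidHom]
      rcases lt_trichotomy i k with h | rfl | h
      · rw [retr_x (by omega), artin_tw_incl _ h, split_ne h.ne]
        have hw : split k (W k) = CoprodI.of (M := SplitFactor) (i := true) (W k) := by
          have : ∀ l ≤ k, split k (W l) = CoprodI.of (M := SplitFactor) (i := true) (W l) := by
            intro l
            induction l with
            | zero => intro _; simp only [W, map_one]
            | succ l ih =>
              intro hl
              rw [W, map_mul, map_mul, ih (by omega), split_ne (by omega)]
          exact this k le_rfl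
        rw [map_mul, map_mul, map_inv, hw, split_ne h.ne, ← map_inv, ← map_mul, ← map_mul, hat,
          CoprodI.lift_of]
        change CoprodI.of (M := SplitFactor) (i := true) ((W k)⁻¹ * x i * (W k)⁻¹⁻¹) = _
        rw [inv_inv]
      · rw [retr_x (by omega), artin_incl, artin_x _ le_rfl, split_self, hat, CoprodI.lift_of]
        rfl
      · rw [retr_x' (by omega)]; simp
  exact DFunLike.congr_fun this f

theorem mem_closure_of_wd {k : ℕ} (hk : 0 < k) {l : List (Σ i, SplitFactor i)} {r : ℕ} (hr : 0 < r)
    (h : ∀ a ∈ l, (twistT k a.1)^[r] a.2 = a.2) :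
    unsplit k (lprod l) ∈ Subgroup.closure {W (k + 1), x k} := by
  have hx : x k ∈ Subgroup.closure {W (k + 1), x k} := Subgroup.subset_closure (by simp)
  have hW : W k ∈ Subgroup.closure {W (k + 1), x k} := by
    have : W k = (x k)⁻¹ * W (k + 1) := by rw [W]; group
    rw [this]
    exact mul_mem (inv_mem hx) (Subgroup.subset_closure (by simp))
  induction l with
  | nil => rw [lprod_nil, map_one]; exact one_mem _
  | cons b t ih =>
    rw [lprod_cons, map_mul]
    refine mul_mem ?_ (ih fun a ha => h a (List.mem_cons_of_mem _ ha))
    have hb := h b (by simp)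
    rcases b with ⟨_ | _, b⟩
    · rw [unsplit, splitLift_false]
      exact Subgroup.zpow_mem _ hx _
    · rw [unsplit, splitLift_true]
      dsimp only at hb
      rw [twistT_iterate] at hb
      have hc : Commute b (W k ^ (r : ℤ)) := by
        rw [zpow_natCast, commute_iff_eq]
        nth_rw 2 [← hb]; group
      have := mem_zpowers_of_commute (fexp 0) (W := W k) (by rw [fexp_W, if_pos hk])
        (by omega) hc
      obtain ⟨j, hj⟩ := this
      rw [MonoidHom.id_apply, ← hj]
      exact Subgroup.zpow_mem _ hW _

theorem exists_conj_mem_closure {k : ℕ} (hk : 0 < k) {f y : FreeGroup ℕ}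
    (hy : retr (k + 1) y = y)
    (he : f * artin (k + 1) (incl (Nat.le_succ k) (tw k)) y * f⁻¹ = y)
    (h0 : fexp 0 y ≠ 1) (h1 : fexp k y ≠ 1) :
    ∃ c, c * y * c⁻¹ ∈ Subgroup.closure {W (k + 1), x k} := by
  have e1 : (split k f)⁻¹ * split k y * (split k f)⁻¹⁻¹ = hat (twistT k) (split k y) := by
    have := hat_twistT k y
    rw [hy] at this
    have h2 := congrArg (split k) he
    rw [map_mul, map_mul, map_inv] at h2
    rw [this, ← h2]; group
  obtain ⟨c, l, e, h⟩ := exists_conj_fixed (twistT_injective k) e1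
  refine ⟨unsplit k c, ?_⟩
  have e2 : unsplit k c * y * (unsplit k c)⁻¹ = unsplit k (lprod l) := by
    rw [← e, map_mul, map_mul, map_inv, unsplit_split]
  rw [e2]
  rcases h with h | ⟨r, hr, h⟩
  · exfalso
    have key : ∀ χ : CoprodI SplitFactor →* Multiplicative ℤ, χ (split k y) = χ (lprod l) := by
      intro χ
      rw [← e, map_mul, map_mul, map_inv, mul_inv_cancel_comm]
    have k0 : ∀ f, splitLift (fexp 0) 1 (split k f) = fexp 0 f := by
      intro f
      have : (splitLift (fexp 0) 1).comp (split k) = fexp 0 := FreeGroup.ext_hom _ _ fun i => by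
        rw [MonoidHom.comp_apply]
        obtain rfl | h := eq_or_ne i k
        · rw [split_self, splitLift_false, fexp_x, if_neg (by omega)]; rfl
        · rw [split_ne h, splitLift_true]
      exact DFunLike.congr_fun this f
    have k1 : ∀ f, splitLift 1 (MonoidHom.id _) (split k f) = fexp k f := by
      intro f
      have : (splitLift 1 (MonoidHom.id _)).comp (split k) = fexp k :=
        FreeGroup.ext_hom _ _ fun i => by
          rw [MonoidHom.comp_apply]
          obtain rfl | h := eq_or_ne i k
          · rw [split_self, splitLift_false, fexp_x, if_pos rfl]; rfl
          · rw [split_ne h, splitLift_true, fexp_x, if_neg h]; rfl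
      exact DFunLike.congr_fun this f
    have a0 := key (splitLift (fexp 0) 1)
    have a1 := key (splitLift 1 (MonoidHom.id _))
    rw [k0] at a0
    rw [k1] at a1
    match l, h with
    | [], _ => rw [lprod_nil, map_one] at a0; exact h0 a0
    | [⟨true, b⟩], _ =>
      rw [lprod_cons, lprod_nil, mul_one, splitLift_true] at a1; exact h1 a1
    | [⟨false, b⟩], _ =>
      rw [lprod_cons, lprod_nil, mul_one, splitLift_false] at a0; exact h0 a0
  · exact mem_closure_of_wd hk hr h

/-- An endomorphism sending the boundary word to itself and killing the last generator. -/
def shiftHom (k : ℕ) : FreeGroup ℕ →* FreeGroup ℕ :=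
  FreeGroup.lift fun i => if i = 0 then (x (k + 1))⁻¹ * W (k + 2) else
    if i = k then x (k + 1) else 1

theorem shiftHom_W {k : ℕ} (hk : 0 < k) : shiftHom k (W (k + 2)) = W (k + 2) := by
  have h : ∀ l, l < k → shiftHom k (W (l + 1)) = (x (k + 1))⁻¹ * W (k + 2) := by
    intro l
    induction l with
    | zero => intro _; rw [W, W, mul_one]; simp [shiftHom]
    | succ l ih =>
      intro hl
      rw [W, map_mul, ih (by omega)]
      simp [shiftHom, show l + 1 ≠ k by omega]
  obtain ⟨l, rfl⟩ : ∃ l, k = l + 1 := ⟨k - 1, by omega⟩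
  nth_rw 1 [W, W]
  rw [map_mul, map_mul, h l (by omega)]
  simp [shiftHom]

theorem exists_conj_W {k : ℕ} (hk : 0 < k) {c f y : FreeGroup ℕ}
    (hc : c * y * c⁻¹ ∈ Subgroup.closure {W (k + 2), x (k + 1)})
    (he : f * artin (k + 2) (s (k + 2) k) y * f⁻¹ = y)
    (h0 : fexp 0 y = Multiplicative.ofAdd 1) : ∃ d, y = d * W (k + 2) * d⁻¹ := by
  obtain ⟨u, hu⟩ : ∃ u, u = c * y * c⁻¹ := ⟨_, rfl⟩
  obtain ⟨ψ, hψ⟩ : ∃ ψ, ψ = shiftHom k := ⟨_, rfl⟩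
  rw [← hu] at hc
  have hsW : artinFun k (W (k + 2)) = W (k + 2) := artinFun_W (by omega)
  have e1 : ψ (artinFun k u) = u := by
    have : Subgroup.closure {W (k + 2), x (k + 1)} ≤
        (ψ.comp (artinFun k)).eqLocus (MonoidHom.id _) := by
      rw [Subgroup.closure_le]
      rintro _ (rfl | rfl)
      · change ψ (artinFun k _) = _
        rw [hsW, hψ, shiftHom_W hk]; rfl
      · change ψ (artinFun k _) = _
        rw [artinFun_succ rfl, hψ]
        simp [shiftHom, hk.ne']
    exact this hc
  have e2 : ψ u ∈ Subgroup.zpowers (W (k + 2)) := by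
    have : Subgroup.closure {W (k + 2), x (k + 1)} ≤ (Subgroup.zpowers (W (k + 2))).comap ψ := by
      rw [Subgroup.closure_le]
      rintro _ (rfl | rfl)
      · rw [SetLike.mem_coe, Subgroup.mem_comap, hψ, shiftHom_W hk]
        exact Subgroup.mem_zpowers _
      · rw [SetLike.mem_coe, Subgroup.mem_comap, hψ,
          show shiftHom k (x (k + 1)) = 1 by simp [shiftHom]]
        exact one_mem _
    exact this hc
  obtain ⟨e, he2⟩ := e2
  rw [artin_s (by omega)] at he
  have hy : y = c⁻¹ * u * c := by rw [hu]; group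
  have h1 : ∃ d, y = d * W (k + 2) ^ e * d⁻¹ := by
    refine ⟨c⁻¹ * ψ (artinFun k c) * ψ f⁻¹ * ψ c⁻¹, ?_⟩
    dsimp only at he2
    rw [he2]
    have e3 : artinFun k y = f⁻¹ * y * f := by nth_rw 2 [← he]; group
    have e4 : u = ψ (artinFun k c) * ψ (f⁻¹ * y * f) * (ψ (artinFun k c))⁻¹ := by
      rw [← e3, ← map_inv, ← map_inv, ← map_mul, ← map_mul, ← map_mul, ← map_mul, ← hu, e1]
    have e5 : ψ y = (ψ c)⁻¹ * ψ u * ψ c := by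
      rw [hy, map_mul, map_mul, map_inv]
    nth_rw 1 [hy]
    nth_rw 1 [e4]
    simp only [map_mul, map_inv, e5]
    group
  obtain ⟨d, hd⟩ := h1
  refine ⟨d, ?_⟩
  have h2 : e = 1 := by
    rw [hd, map_mul, map_mul, map_inv, mul_inv_cancel_comm, map_zpow, fexp_W,
      if_pos (by omega)] at h0
    have := congrArg Multiplicative.toAdd h0
    simpa using this
  rw [hd, h2, zpow_one]

end BraidGroup

namespace BraidGroup

open Equiv Monoid FreeProd

theorem FreeProd.exists_strip {M : Bool → Type*} [∀ i, Group (M i)] (g : CoprodI M) :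
    ∃ (a b : M true) (h : CoprodI M), g = CoprodI.of a * h * CoprodI.of b ∧
      (h = 1 ∨ SE false h) := by
  have h1 : ∃ (a : M true) (l : List (Σ i, M i)), g = CoprodI.of a * lprod l ∧ Red l ∧
      ∀ y ∈ l.head?, y.1 = false := by
    have hr := red_wd g
    match hl : wd g with
    | [] => exact ⟨1, [], by simpa using wd_eq_nil hl, red_nil, by simp⟩
    | ⟨false, c⟩ :: t =>
      refine ⟨1, ⟨false, c⟩ :: t, by rw [← hl]; simp, hl ▸ hr, by simp⟩
    | ⟨true, c⟩ :: t =>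
      rw [hl] at hr
      refine ⟨c, t, by rw [← lprod_wd g, hl, lprod_cons], (red_cons.1 hr).2.1, fun y hy => ?_⟩
      have := (red_cons.1 hr).2.2 y hy
      simpa using this.symm
  obtain ⟨a, l, rfl, hr, hh⟩ := h1
  rcases List.eq_nil_or_concat l with rfl | ⟨q, ⟨_ | _, b⟩, rfl⟩
  · exact ⟨a, 1, 1, by simp, Or.inl rfl⟩
  · rw [List.concat_eq_append] at hr hh ⊢
    refine ⟨a, 1, lprod (q ++ [⟨false, b⟩]), by simp, Or.inr ?_⟩
    rw [SE, hr.wd_lprod]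
    refine ⟨?_, ⟨_, List.getLast?_concat, rfl⟩⟩
    obtain ⟨y, hy⟩ := Option.isSome_iff_exists.1
      (by simp : (q ++ [(⟨false, b⟩ : Σ i, M i)]).head?.isSome)
    exact ⟨y, hy, hh y hy⟩
  · rw [List.concat_eq_append] at hr hh ⊢
    refine ⟨a, b, lprod q, by simp [mul_assoc], ?_⟩
    obtain rfl | hq := eq_or_ne q []
    · left; simp
    · right
      rw [SE, hr.left.wd_lprod]
      obtain ⟨y, hy⟩ := Option.isSome_iff_exists.1 (by simpa using hq : q.head?.isSome)
      obtain ⟨z, hz⟩ := Option.isSome_iff_exists.1 (by simpa using hq : q.getLast?.isSome)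
      refine ⟨⟨y, hy, hh y ?_⟩, z, hz, ?_⟩
      · rw [List.head?_append_of_ne_nil _ hq]; exact hy
      · have := (red_append.1 hr).2.2 z hz ⟨true, b⟩ (by simp)
        simpa using this

/-- The free group of rank two as a free product. -/
abbrev FreeTwo : Type := CoprodI fun _ : Bool => Multiplicative ℤ

/-- The retraction onto the free group on the boundary word and the last generator. -/
def pairHom (k : ℕ) : FreeGroup ℕ →* FreeTwo :=
  FreeGroup.lift fun i => if i = k then CoprodI.of (i := false) (Multiplicative.ofAdd (1 : ℤ)) else
    if i = 0 then (CoprodI.of (i := false) (Multiplicative.ofAdd (1 : ℤ)))⁻¹ *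
      CoprodI.of (i := true) (Multiplicative.ofAdd (1 : ℤ)) else 1

theorem pairHom_W {k : ℕ} (hk : 0 < k) :
    pairHom k (W (k + 1)) = CoprodI.of (i := true) (Multiplicative.ofAdd (1 : ℤ)) := by
  have h : ∀ l, l < k → pairHom k (W (l + 1)) =
      (CoprodI.of (i := false) (Multiplicative.ofAdd (1 : ℤ)))⁻¹ *
      CoprodI.of (i := true) (Multiplicative.ofAdd (1 : ℤ)) := by
    intro l
    induction l with
    | zero => intro _; rw [W, W, mul_one]; simp [pairHom, hk.ne]
    | succ l ih =>
      intro hl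
      rw [W, map_mul, ih (by omega)]
      simp [pairHom, show l + 1 ≠ k by omega]
  obtain ⟨l, rfl⟩ : ∃ l, k = l + 1 := ⟨k - 1, by omega⟩
  rw [W, map_mul, h l (by omega)]
  simp [pairHom]

/-- The section of `pairHom`. -/
def unpairHom (k : ℕ) : FreeTwo →* FreeGroup ℕ :=
  CoprodI.lift fun i => zpowersHom _ (if i then W (k + 1) else x k)

theorem unpairHom_true (k : ℕ) (a : Multiplicative ℤ) :
    unpairHom k (CoprodI.of (i := true) a) = W (k + 1) ^ (Multiplicative.toAdd a) := by
  rw [unpairHom, CoprodI.lift_of]; simp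

theorem unpairHom_false (k : ℕ) (a : Multiplicative ℤ) :
    unpairHom k (CoprodI.of (i := false) a) = x k ^ (Multiplicative.toAdd a) := by
  rw [unpairHom, CoprodI.lift_of]; simp

theorem unpairHom_pairHom {k : ℕ} (hk : 0 < k) {f : FreeGroup ℕ}
    (hf : f ∈ Subgroup.closure {W (k + 1), x k}) : unpairHom k (pairHom k f) = f := by
  have : Subgroup.closure {W (k + 1), x k} ≤
      ((unpairHom k).comp (pairHom k)).eqLocus (MonoidHom.id _) := by
    rw [Subgroup.closure_le]
    rintro _ (rfl | rfl)
    · change unpairHom k (pairHom k _) = _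
      rw [pairHom_W hk, unpairHom_true]; simp
    · change unpairHom k (pairHom k _) = _
      rw [show pairHom k (x k) = CoprodI.of (i := false) (Multiplicative.ofAdd (1 : ℤ)) by
        simp [pairHom], unpairHom_false]; simp
  exact this hf

theorem exists_eq_conj_W {k : ℕ} (hk : 0 < k) {v : FreeGroup ℕ}
    (hv : v ∈ Subgroup.closure {W (k + 1), x k}) (hx : x k ∈ Subgroup.closure {W (k + 1), v})
    (h0 : fexp 0 v = 1) (h1 : fexp k v = Multiplicative.ofAdd 1) :
    ∃ i : ℤ, v = W (k + 1) ^ i * x k * (W (k + 1) ^ i)⁻¹ := by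
  obtain ⟨a, b, h, hg, hse⟩ := exists_strip (pairHom k v)
  have hxk : pairHom k (x k) = CoprodI.of (i := false) (Multiplicative.ofAdd (1 : ℤ)) := by
    simp [pairHom]
  let K : Bool → Subgroup FreeTwo := fun i => match i with
    | true => (CoprodI.of (M := fun _ : Bool => Multiplicative ℤ) (i := true)).range
    | false => Subgroup.zpowers h
  have hK : ∀ i, ∀ v ∈ K i, v ≠ 1 → SE i v := by
    rintro (_ | _) v hv hv1
    · obtain ⟨k, rfl⟩ := hv
      rcases hse with hse | hse
      · exact absurd (by simp [hse]) hv1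
      · exact (hse.zpow k).resolve_left hv1
    · obtain ⟨a, rfl⟩ := hv
      refine se_of ?_
      rintro rfl
      exact hv1 (map_one _)
  have hA : ∀ a : Multiplicative ℤ, (CoprodI.of (i := true) a : FreeTwo) ∈ ⨆ i, K i := fun a =>
    Subgroup.mem_iSup_of_mem true ⟨a, rfl⟩
  have hh : h ∈ ⨆ i, K i := Subgroup.mem_iSup_of_mem false ⟨1, zpow_one _⟩
  have hle : Subgroup.closure {W (k + 1), v} ≤ (⨆ i, K i).comap (pairHom k) := by
    rw [Subgroup.closure_le]
    rintro _ (rfl | rfl)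
    · rw [SetLike.mem_coe, Subgroup.mem_comap, pairHom_W hk]; exact hA _
    · rw [SetLike.mem_coe, Subgroup.mem_comap, hg]
      exact mul_mem (mul_mem (hA _) hh) (hA _)
  have hz := hle hx
  rw [Subgroup.mem_comap, hxk] at hz
  have hz' := mem_of_wd_singleton hK (i := false) (by decide) hz
  obtain ⟨e, he⟩ := hz'
  dsimp only at he
  have he' : unpairHom k h ^ e = x k := by
    rw [← map_zpow, he, unpairHom_false]; simp
  have hc : Commute (unpairHom k h) (x k ^ (1 : ℤ)) := by
    rw [zpow_one, ← he']
    exact (Commute.refl _).zpow_right e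
  obtain ⟨j, hj⟩ := mem_zpowers_of_commute (fexp k) (by rw [fexp_x, if_pos rfl]) one_ne_zero hc
  dsimp only at hj
  have hvv := unpairHom_pairHom hk hv
  rw [hg, map_mul, map_mul, unpairHom_true, unpairHom_true, ← hj] at hvv
  obtain ⟨a, rfl⟩ := Multiplicative.ofAdd.surjective a
  obtain ⟨b, rfl⟩ := Multiplicative.ofAdd.surjective b
  rw [toAdd_ofAdd, toAdd_ofAdd] at hvv
  rw [← hvv] at h0 h1
  simp only [map_mul, map_zpow, fexp_W, fexp_x] at h0 h1
  rw [if_pos (by omega), if_neg (by omega)] at h0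
  rw [if_pos (by omega), if_pos trivial] at h1
  have e0 := congrArg Multiplicative.toAdd h0
  have e1 := congrArg Multiplicative.toAdd h1
  simp at e0 e1
  refine ⟨a, ?_⟩
  rw [← hvv, show j = 1 by omega, show b = -a by omega, zpow_one, zpow_neg]

end BraidGroup

namespace BraidGroup

open Equiv Monoid FreeProd

namespace IsLinkPreserving

/-- Being conjugation by a pure braid. -/
def _root_.BraidGroup.IsPureInner {n : ℕ} (φ : B n ≃* B n) : Prop :=
  ∃ g, BraidGroup.perm n g = 1 ∧ ∀ b, φ b = g * b * g⁻¹

theorem _root_.BraidGroup.IsPureInner.of_conj {n : ℕ} {φ : B n ≃* B n} {g : B n}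
    (hg : BraidGroup.perm n g = 1) (h : IsPureInner (φ.trans (MulAut.conj g))) :
    IsPureInner φ := by
  obtain ⟨c, hc, h⟩ := h
  refine ⟨g⁻¹ * c, by rw [map_mul, map_inv, hg, hc, inv_one, one_mul], fun b => ?_⟩
  have := h b
  rw [MulEquiv.trans_apply, MulAut.conj_apply] at this
  rw [mul_inv_rev, inv_inv, ← mul_assoc, mul_assoc _ _ g, mul_assoc, mul_assoc g⁻¹,
    ← mul_assoc c, ← mul_assoc (c * b), ← this]
  group

variable {k : ℕ} {φ : B (k + 3) ≃* B (k + 3)}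

theorem apply_eq_of_fixed (h : IsLinkPreserving φ) (hu : ∀ b : B (k + 2), φ (up b) = up b)
    (hx : φ (pf (k + 2) (x (k + 1))) = pf (k + 2) (x (k + 1))) (b : B (k + 3)) : φ b = b := by
  have hxbar : ∀ i j, i + j = k + 1 → φ (xbar (k + 2) j) = xbar (k + 2) j := by
    intro i
    induction i with
    | zero =>
      intro j hj
      rw [pf_x] at hx
      rwa [show j = k + 1 by omega]
    | succ i ih =>
      intro j hj
      rw [xbar_eq (show j + 1 < k + 2 by omega), map_mul, map_mul, map_inv, hu,
        ih (j + 1) (by omega)]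
  have hpf : ∀ f, φ (pf (k + 2) f) = pf (k + 2) f := by
    intro f
    have : (φ : B (k + 3) →* B (k + 3)).comp (pf (k + 2)) = pf (k + 2) := by
      ext i
      change φ (pf (k + 2) (x i)) = pf (k + 2) (x i)
      rw [pf_x]
      obtain hi | hi := lt_or_ge i (k + 2)
      · exact hxbar (k + 1 - i) i (by omega)
      · rw [xbar_of_le hi, map_one]
    exact DFunLike.congr_fun this f
  have hp : ∀ p, BraidGroup.perm (k + 3) p = 1 → φ p = p := by
    intro p hp
    rw [eq_pf_mul_up (b := p) (by rw [hp]; rfl), map_mul, hpf, hu]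
  have hs : φ (s (k + 3) (k + 1)) = s (k + 3) (k + 1) := by
    set t := s (k + 3) (k + 1) with ht
    obtain ⟨e, he⟩ := eq_tw_zpow (c := t⁻¹ * φ t)
      (by rw [map_mul, h.perm, map_inv, inv_mul_cancel]) (by
        intro p hpp
        have h1 := hp (t * p * t⁻¹)
          (by rw [map_mul, map_mul, hpp, map_inv, mul_one, mul_inv_cancel])
        rw [map_mul, map_mul, map_inv, hp p hpp] at h1
        rw [Commute, SemiconjBy]
        calc t⁻¹ * φ t * p = t⁻¹ * (φ t * p * (φ t)⁻¹) * φ t := by group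
          _ = _ := by rw [h1]; group)
    have h2 : φ t = t * tw (k + 3) ^ e := by rw [← he]; group
    have h3 := hp (t ^ 2) perm_s_sq
    rw [map_pow, h2, ((commute_tw t).zpow_right e).mul_pow] at h3
    have h4 : (tw (k + 3) ^ e) ^ 2 = 1 := by simpa using h3
    rw [← zpow_natCast, ← zpow_mul] at h4
    have h5 := congrArg (fun b => BraidGroup.lk b 0 1) h4
    simp only [lk_zpow (perm_tw _), lk_tw (n := k + 3) Nat.zero_lt_one (by omega), lk_one] at h5
    have h6 : e = 0 := by
      push_cast at h5; omega
    rw [h2, h6, zpow_zero, mul_one]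
  have : (φ : B (k + 3) →* B (k + 3)) = MonoidHom.id _ := by
    apply hom_ext
    intro i hi
    obtain hi' | rfl := (show i < k + 1 ∨ i = k + 1 by omega)
    · change φ (s (k + 3) i) = s (k + 3) i
      rw [← up_s (by omega), hu]
    · exact hs
  exact DFunLike.congr_fun this b

theorem apply_up_eq (h : IsLinkPreserving φ) (hu : ∀ b, h.forgetHom b = b)
    (hW : φ (pf (k + 2) (W (k + 2))) = pf (k + 2) (W (k + 2))) (b : B (k + 2)) :
    φ (up b) = up b := by
  have hs : ∀ j, j + 1 < k + 2 → φ (up (s (k + 2) j)) = up (s (k + 2) j) := by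
    intro j hj
    set t := s (k + 2) j
    have h1 := h.apply_up t
    rw [hu] at h1
    set f := fpart (φ (up t))
    have hf : retr (k + 2) f = f := retr_fpart (h.perm_apply_up t)
    have h2 : Commute (φ (up t)) (pf (k + 2) (W (k + 2))) := by
      have := (commute_up_pf_W t).map φ
      rwa [hW] at this
    have h3 : Commute (pf (k + 2) f) (pf (k + 2) (W (k + 2))) := by
      rw [eq_mul_inv_of_mul_eq h1.symm]
      exact h2.mul_left (commute_up_pf_W t).inv_left
    have h4 : Commute f (W (k + 2) ^ (1 : ℤ)) := by
      rw [zpow_one]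
      apply pf_injective
      · rw [map_mul, hf, retr_W le_rfl]
      · rw [map_mul, hf, retr_W le_rfl]
      · rw [map_mul, map_mul]; exact h3
    obtain ⟨e, he⟩ := mem_zpowers_of_commute (fexp 0)
      (by rw [fexp_W, if_pos (by omega)]) one_ne_zero h4
    dsimp only at he
    have h5 : φ (up t ^ 2) = pf (k + 2) (W (k + 2)) ^ (2 * e) * up t ^ 2 := by
      rw [map_pow, h1, ← he, map_zpow, (((commute_up_pf_W t).zpow_right e).symm).mul_pow,
        ← zpow_natCast (_ ^ e), ← zpow_mul, mul_comm e]
      rfl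
    have hpt : BraidGroup.perm (k + 3) (up t ^ 2) = 1 := by
      rw [up_s hj, perm_s_sq]
    have h6 := h.lk (up t ^ 2) hpt 0 (k + 2) (by omega) (by omega)
    have hpz : BraidGroup.perm (k + 3) (pf (k + 2) (W (k + 2)) ^ (2 * e)) = 1 := by
      rw [map_zpow, perm_pf, one_zpow]
    rw [h5, lk_mul_of_pure hpz, lk_zpow (perm_pf _), lk_pf _ _ _ (by omega), if_pos rfl,
      retr_W le_rfl, fexp_W, if_pos (by omega), toAdd_ofAdd] at h6
    have h7 : e = 0 := by omega
    rw [h1, ← he, h7, zpow_zero, map_one, one_mul]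
  have : (φ : B (k + 3) →* B (k + 3)).comp up = up := by
    apply hom_ext
    intro i hi
    exact hs i hi
  exact DFunLike.congr_fun this b

theorem kerHom_x_mem_closure {k : ℕ} {φ : B (k + 3) ≃* B (k + 3)} (h : IsLinkPreserving φ)
    (hu : ∀ b : B (k + 2), φ (up b) = up b) :
    h.kerHom (x (k + 1)) ∈ Subgroup.closure {W (k + 2), x (k + 1)} := by
  set v := h.kerHom (x (k + 1))
  have hv : retr (k + 2) v = v := h.retr_kerHom _
  set t : B (k + 2) := incl (Nat.le_succ (k + 1)) (tw (k + 1))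
  have h1 : artin (k + 2) t (x (k + 1)) = x (k + 1) := by
    rw [artin_incl, artin_x _ le_rfl]
  have h2 : artin (k + 2) t v = v := by
    apply pf_injective (by rw [retr_artin, hv]) hv
    rw [← up_mul_pf, h.pf_kerHom, ← hu t, ← map_inv, ← map_mul, ← map_mul, up_mul_pf, h1]
  have h3 := hat_twistT (k + 1) v
  rw [hv, h2] at h3
  have h4 := map_eq_self_of_hat_eq (twistT_injective (k + 1)) h3
  have := mem_closure_of_wd (k := k + 1) (by omega) zero_lt_one (l := wd (split (k + 1) v))
    (by simpa using h4)
  rwa [lprod_wd, unsplit_split] at this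

theorem isPureInner_of_apply_up (h : IsLinkPreserving φ) (hu : ∀ b : B (k + 2), φ (up b) = up b)
    (hW : φ (pf (k + 2) (W (k + 2))) = pf (k + 2) (W (k + 2))) : IsPureInner φ := by
  have hu' : ∀ b : B (k + 2), φ.symm (up b) = up b := fun b => by
    rw [MulEquiv.symm_apply_eq, hu]
  set v := h.kerHom (x (k + 1)) with hv
  have hWv : h.kerHom (W (k + 2)) = W (k + 2) := by
    apply pf_injective (h.retr_kerHom _) (retr_W le_rfl)
    rw [h.pf_kerHom, hW]
  have h1 : x (k + 1) ∈ Subgroup.closure {W (k + 2), v} := by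
    have := Subgroup.mem_map_of_mem h.kerHom (h.symm.kerHom_x_mem_closure hu')
    rw [h.kerHom_symm, retr_x (by omega), MonoidHom.map_closure, Set.image_pair, hWv] at this
    exact this
  obtain ⟨i, hi⟩ := exists_eq_conj_W (k := k + 1) (by omega) (h.kerHom_x_mem_closure hu) h1
    (by rw [h.fexp_kerHom _ (by omega), retr_x (by omega), fexp_x, if_neg (by omega)])
    (by rw [h.fexp_kerHom _ (by omega), retr_x (by omega), fexp_x, if_pos rfl])
  have hg : BraidGroup.perm (k + 3) (pf (k + 2) ((W (k + 2) ^ i)⁻¹)) = 1 := perm_pf _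
  refine IsPureInner.of_conj hg ⟨1, map_one _, fun b => ?_⟩
  rw [one_mul, inv_one, mul_one]
  refine apply_eq_of_fixed (h.conj hg) (fun b => ?_) ?_ b
  · rw [MulEquiv.trans_apply, MulAut.conj_apply, hu, mul_inv_eq_iff_eq_mul, map_inv, map_zpow]
    exact ((commute_up_pf_W b).zpow_right i).inv_right.symm
  · rw [MulEquiv.trans_apply, MulAut.conj_apply, ← h.pf_kerHom, ← map_inv, ← map_mul, ← map_mul]
    congr 1
    rw [hi]; group

theorem isPureInner_of_forgetHom (hk : 0 < k) (h : IsLinkPreserving φ)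
    (hu : ∀ b, h.forgetHom b = b) : IsPureInner φ := by
  set y := h.kerHom (W (k + 2)) with hy
  have hyr : retr (k + 2) y = y := h.retr_kerHom _
  have hye : ∀ i, i < k + 2 → fexp i y = Multiplicative.ofAdd 1 := fun i hi => by
    rw [hy, h.fexp_kerHom _ hi, retr_W le_rfl, fexp_W, if_pos hi]
  have hf : ∀ b : B (k + 2), ∃ f, f * artin (k + 2) b y * f⁻¹ = y := by
    intro b
    have h1 := h.apply_up b
    rw [hu] at h1
    set f := fpart (φ (up b))
    have hfr : retr (k + 2) f = f := retr_fpart (h.perm_apply_up b)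
    refine ⟨f, ?_⟩
    apply pf_injective ?_ hyr
    · have h2 := (commute_up_pf_W b).map φ
      rw [← h.pf_kerHom, h1] at h2
      rw [map_mul, map_mul, map_inv, ← up_mul_pf, hy]
      calc _ = (pf (k + 2) f * up b) * pf (k + 2) (h.kerHom (W (k + 2))) *
            (pf (k + 2) f * up b)⁻¹ := by group
        _ = _ := by rw [h2.eq]; group
    · rw [map_mul, map_mul, map_inv, hfr, retr_artin, hyr]
  obtain ⟨f, hf1⟩ := hf (incl (Nat.le_succ (k + 1)) (tw (k + 1)))
  obtain ⟨f', hf2⟩ := hf (s (k + 2) k)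
  obtain ⟨c, hc⟩ := exists_conj_mem_closure (k := k + 1) (by omega) hyr hf1
    (by rw [hye 0 (by omega)]; decide) (by rw [hye (k + 1) (by omega)]; decide)
  obtain ⟨d, hd⟩ := exists_conj_W hk hc hf2 (hye 0 (by omega))
  have hg : BraidGroup.perm (k + 3) (pf (k + 2) d⁻¹) = 1 := perm_pf _
  refine IsPureInner.of_conj hg ?_
  have hg' : BraidGroup.perm (k + 3) (pf (k + 2) d⁻¹) (k + 2) = k + 2 := by rw [hg]; rfl
  have hu' : ∀ b, (h.conj hg).forgetHom b = b := by
    intro b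
    rw [forgetHom_apply, MulEquiv.trans_apply, MulAut.conj_apply, mul_assoc, forget_mul hg',
      forget_mul (h.perm_apply_up b), forget_inv hg', forget_pf, ← h.forgetHom_apply, hu]
    group
  have hW' : (φ.trans (MulAut.conj (pf (k + 2) d⁻¹))) (pf (k + 2) (W (k + 2))) =
      pf (k + 2) (W (k + 2)) := by
    rw [MulEquiv.trans_apply, MulAut.conj_apply, ← h.pf_kerHom, ← hy, hd, ← map_inv, ← map_mul,
      ← map_mul]
    congr 1; group
  exact isPureInner_of_apply_up (h.conj hg) (apply_up_eq _ hu' hW') hW'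

theorem isPureInner {k : ℕ} {φ : B (k + 3) ≃* B (k + 3)} (h : IsLinkPreserving φ) :
    IsPureInner φ := by
  induction k with
  | zero => exact h.exists_conj_three
  | succ k ih =>
    obtain ⟨g, hg, H⟩ := ih h.isLinkPreserving_forgetEquiv
    have hg' : BraidGroup.perm (k + 4) (up g⁻¹) = 1 := by rw [perm_incl, map_inv, hg, inv_one]
    refine IsPureInner.of_conj hg' ?_
    have hg'' : BraidGroup.perm (k + 4) (up g⁻¹) (k + 3) = k + 3 := perm_up_last _
    refine isPureInner_of_forgetHom (Nat.succ_pos k) (h.conj hg') fun b => ?_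
    rw [forgetHom_apply, MulEquiv.trans_apply, MulAut.conj_apply, mul_assoc, forget_mul hg'',
      forget_mul (h.perm_apply_up b), forget_inv hg'', forget_up, ← h.forgetHom_apply]
    have := H b
    change h.forgetHom b = _ at this
    rw [this]; group

end IsLinkPreserving

end BraidGroup

namespace BraidGroup

open Equiv Finset

/-- An automorphism compatible with the permutation and the exponent sum. -/
structure IsExpoPreserving {n : ℕ} (φ : B n ≃* B n) : Prop where
  perm : ∀ b, perm n (φ b) = perm n b
  expo : ∀ b, expo n (φ b) = expo n b

/-- Kronecker delta. -/
def ind (u i : ℕ) : ℤ := if u = i then 1 else 0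

theorem ind_perm_inv {p : Perm ℕ} {a i : ℕ} (h : p a = i) (u : ℕ) : ind (p⁻¹ u) a = ind u i := by
  subst h
  simp only [ind, Perm.inv_eq_iff_eq]

theorem ind_of_eq {u i : ℕ} (h : u = i) : ind u i = 1 := if_pos h

theorem ind_of_ne {u i : ℕ} (h : u ≠ i) : ind u i = 0 := if_neg h

theorem lk_s_sq {n : ℕ} (hn : 1 < n) (u v : ℕ) :
    lk (s n 0 ^ 2) u v = 2 * (ind u 0 * ind v 1 + ind u 1 * ind v 0) := by
  rw [sq, lk_mul, lk_s (by omega), lk_s (by omega), perm_s (by omega), swap_inv, adj_swap]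
  simp only [adj, ind]
  split_ifs <;> omega

theorem sum_ind {n i : ℕ} (hi : i < n) : ∑ w ∈ range n, ind w i = 1 := by
  simp [ind, hi]

/-- Total linking number of a strand. -/
def deg {n : ℕ} (b : B n) (u : ℕ) : ℤ := ∑ w ∈ range n, lk b u w

theorem sum_deg {n : ℕ} (b : B n) :
    ∑ u ∈ range n, deg b u = 2 * Multiplicative.toAdd (expo n b) := by
  rw [← sum_lk, Finset.sum_range]
  refine Finset.sum_congr rfl fun u _ => ?_
  rw [deg, Finset.sum_range]

theorem deg_mul_of_pure {n : ℕ} {a : B n} (ha : perm n a = 1) (b : B n) (u : ℕ) :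
    deg (a * b) u = deg a u + deg b u := by
  simp only [deg, lk_mul_of_pure ha, Finset.sum_add_distrib]

namespace IsExpoPreserving

variable {n : ℕ} {φ : B n ≃* B n}

theorem symm (h : IsExpoPreserving φ) : IsExpoPreserving φ.symm where
  perm b := by rw [← h.perm, φ.apply_symm_apply]
  expo b := by rw [← h.expo, φ.apply_symm_apply]

theorem lk_apply_s_sq (h : IsExpoPreserving φ) (hn : 4 ≤ n) : ∃ α β c : ℤ, (∀ u v, u ≠ v → u < n →
    v < n → BraidGroup.lk (φ (s n 0 ^ 2)) u v = 2 * (α * (ind u 0 * ind v 1 + ind u 1 * ind v 0) +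
      β * (ind u 0 + ind u 1 + ind v 0 + ind v 1) + c)) ∧ Odd (α + 2 * β + c) := by
  set L := BraidGroup.lk (φ (s n 0 ^ 2)) with hL
  have hpure : BraidGroup.perm n (φ (s n 0 ^ 2)) = 1 := by rw [h.perm, perm_s_sq]
  have hinv : ∀ i, i + 1 < n → Commute (s n i) (s n 0) → ∀ u v,
      L (swap i (i + 1) u) (swap i (i + 1) v) = L u v := by
    intro i hi hc u v
    have h1 := lk_conj (φ (s n i)) hpure u v
    rw [← map_inv, ← map_mul, ← map_mul, (hc.pow_right 2).eq, mul_inv_cancel_right, h.perm,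
      perm_s hi, swap_inv] at h1
    exact h1.symm
  have hfar : ∀ i, 2 ≤ i → i + 1 < n → ∀ u v,
      L (swap i (i + 1) u) (swap i (i + 1) v) = L u v := fun i h2 hi =>
    hinv i hi (s_comm (n := n) (i := 0) (j := i) (by omega)).symm
  have h0v : ∀ v, v + 2 < n → L 0 (v + 2) = L 0 2 := by
    intro v
    induction v with
    | zero => intro _; rfl
    | succ v ih =>
      intro hv
      rw [← ih (by omega), ← hfar (v + 2) (by omega) (by omega) 0 (v + 2), swap_apply_left,
        swap_apply_of_ne_of_ne (by omega) (by omega)]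
  have h1v : ∀ v, 2 ≤ v → v < n → L 1 v = L 0 2 := by
    intro v h2 hv
    have := hinv 0 (by omega) (Commute.refl _) 0 v
    rw [swap_apply_left, swap_apply_of_ne_of_ne (by omega) (by omega)] at this
    obtain ⟨w, rfl⟩ := Nat.exists_eq_add_of_le' h2
    rw [this, h0v w hv]
  have hdiag : ∀ u, u + 3 < n → L (u + 2) (u + 3) = L 2 3 := by
    intro u
    induction u with
    | zero => intro _; rfl
    | succ u ih =>
      intro hu
      rw [← ih (by omega)]
      have e1 := hfar (u + 3) (by omega) (by omega) (u + 2) (u + 3)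
      rw [swap_apply_left, swap_apply_of_ne_of_ne (by omega) (by omega)] at e1
      have e2 := hfar (u + 2) (by omega) (by omega) (u + 2) (u + 4)
      rw [swap_apply_left, swap_apply_of_ne_of_ne (by omega) (by omega)] at e2
      exact e2.trans e1
  have huv : ∀ d u, 2 ≤ u → u + d + 1 < n → L u (u + d + 1) = L 2 3 := by
    intro d
    induction d with
    | zero =>
      intro u h2 hu
      obtain ⟨w, rfl⟩ := Nat.exists_eq_add_of_le' h2
      exact hdiag w hu
    | succ d ih =>
      intro u h2 hu
      rw [← ih u h2 (by omega), ← hfar (u + d + 1) (by omega) (by omega) u (u + d + 1),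
        swap_apply_left, swap_apply_of_ne_of_ne (by omega) (by omega)]
      rfl
  obtain ⟨b, hb⟩ := (even_lk hpure 0 2).two_dvd
  rw [← hL] at hb
  obtain ⟨c, hc⟩ := (even_lk hpure 2 3).two_dvd
  rw [← hL] at hc
  have h01 : L 0 1 = 2 * BraidGroup.lk (φ (s n 0)) 0 1 := by
    rw [hL, map_pow, sq, lk_mul, h.perm, perm_s (by omega), swap_inv, swap_apply_left,
      swap_apply_right, lk_symm _ 1 0]
    ring
  have hodd : Odd (BraidGroup.lk (φ (s n 0)) 0 1) := by
    rw [odd_lk_iff _ _ _ zero_ne_one, h.perm, perm_s (by omega), swap_inv, zero_add,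
      swap_apply_left, swap_apply_right]
    simp
  set a := BraidGroup.lk (φ (s n 0)) 0 1
  have key : ∀ u v, u < v → v < n → L u v = 2 * ((a - 2 * b + c) * (ind u 0 * ind v 1 +
      ind u 1 * ind v 0) + (b - c) * (ind u 0 + ind u 1 + ind v 0 + ind v 1) + c) := by
    intro u v huv' hv
    rcases (by omega : (u = 0 ∧ v = 1) ∨ (u = 0 ∧ 2 ≤ v) ∨ (u = 1 ∧ 2 ≤ v) ∨ 2 ≤ u) with
      ⟨rfl, rfl⟩ | ⟨rfl, h2⟩ | ⟨rfl, h2⟩ | h2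
    · rw [h01]; simp [ind]; ring
    · obtain ⟨w, rfl⟩ := Nat.exists_eq_add_of_le' h2
      rw [h0v w hv, hb]; simp [ind]
    · rw [h1v v h2 hv, hb, ind_of_ne (show v ≠ 0 by omega), ind_of_ne (show v ≠ 1 by omega)]
      simp [ind]
    · obtain ⟨d, rfl⟩ := Nat.exists_eq_add_of_lt huv'
      rw [huv d u h2 hv, hc, ind_of_ne (show u ≠ 0 by omega), ind_of_ne (show u ≠ 1 by omega),
        ind_of_ne (show u + d + 1 ≠ 0 by omega), ind_of_ne (show u + d + 1 ≠ 1 by omega)]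
      simp
  refine ⟨a - 2 * b + c, b - c, c, fun u v huv' hu hv => ?_, ?_⟩
  · obtain hlt | hlt := huv'.lt_or_gt
    · exact key u v hlt hv
    · rw [hL, lk_symm, ← hL, key v u hlt hu]; ring
  · convert hodd using 1; ring

theorem lk_apply (h : IsExpoPreserving φ) (hn : 4 ≤ n) : ∃ α β c : ℤ,
    (∀ p, BraidGroup.perm n p = 1 → ∀ u v, u ≠ v → u < n → v < n →
      BraidGroup.lk (φ p) u v = α * BraidGroup.lk p u v +
      β * (deg p u + deg p v) + c * Multiplicative.toAdd (BraidGroup.expo n p)) ∧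
      Odd (α + 2 * β + c) := by
  obtain ⟨α, β, c, hL, hodd⟩ := h.lk_apply_s_sq hn
  refine ⟨α, β, c, fun p hp => ?_, hodd⟩
  let H : Subgroup (B n) :=
    { carrier := {p | BraidGroup.perm n p = 1 ∧ ∀ u v, u ≠ v → u < n → v < n →
        BraidGroup.lk (φ p) u v = α * BraidGroup.lk p u v +
        β * (deg p u + deg p v) + c * Multiplicative.toAdd (BraidGroup.expo n p)}
      one_mem' := ⟨map_one _, fun u v _ _ _ => by simp [lk_one, deg]⟩
      mul_mem' := by
        rintro p q ⟨hp, hp'⟩ ⟨hq, hq'⟩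
        refine ⟨by rw [map_mul, hp, hq, mul_one], fun u v h1 h2 h3 => ?_⟩
        rw [map_mul, lk_mul_of_pure (by rw [h.perm, hp]), lk_mul_of_pure hp, deg_mul_of_pure hp,
          deg_mul_of_pure hp, map_mul, toAdd_mul, hp' u v h1 h2 h3, hq' u v h1 h2 h3]
        ring
      inv_mem' := by
        rintro p ⟨hp, hp'⟩
        refine ⟨by rw [map_inv, hp, inv_one], fun u v h1 h2 h3 => ?_⟩
        have hd : ∀ u, deg p⁻¹ u = - deg p u := fun u => by
          simp only [deg, lk_inv_of_pure hp, Finset.sum_neg_distrib]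
        rw [map_inv, lk_inv_of_pure (by rw [h.perm, hp]), lk_inv_of_pure hp, hd, hd, map_inv,
          toAdd_inv, hp' u v h1 h2 h3]
        ring }
  refine (mem_of_forget H (fun i j hij hj => ?_) p hp).2
  obtain ⟨b, hb, h0, h1⟩ := exists_conj_xbar hij hj
  refine ⟨perm_incl_xbar _, fun u v huv hu hv => ?_⟩
  rw [hb]
  have hlk : ∀ u v, BraidGroup.lk (b * s n 0 ^ 2 * b⁻¹) u v =
      2 * (ind u i * ind v j + ind u j * ind v i) := fun u v => by
    rw [lk_conj b perm_s_sq, lk_s_sq (by omega), ind_perm_inv h0, ind_perm_inv h0,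
      ind_perm_inv h1, ind_perm_inv h1]
  have hdeg : ∀ u, deg (b * s n 0 ^ 2 * b⁻¹) u = 2 * (ind u i + ind u j) := fun u => by
    simp only [deg, hlk]
    rw [← Finset.mul_sum, Finset.sum_add_distrib, ← Finset.mul_sum, ← Finset.mul_sum, sum_ind hj,
      sum_ind (hij.trans hj), mul_one, mul_one]
  have hexp : Multiplicative.toAdd (BraidGroup.expo n (b * s n 0 ^ 2 * b⁻¹)) = 2 := by
    rw [map_mul (BraidGroup.expo n), map_mul (BraidGroup.expo n), map_inv, mul_inv_cancel_comm,
      map_pow, expo_s (by omega)]; rfl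
  rw [hlk, hdeg, hdeg, hexp, map_mul, map_mul, map_inv, lk_conj _ (by rw [h.perm, perm_s_sq]),
    h.perm, hL _ _ (fun e => huv ((BraidGroup.perm n b)⁻¹.injective e))
      (by rwa [← map_inv, perm_lt_iff]) (by rwa [← map_inv, perm_lt_iff]), ind_perm_inv h0,
    ind_perm_inv h0, ind_perm_inv h1, ind_perm_inv h1]
  ring

theorem isLinkPreserving (h : IsExpoPreserving φ) (hn : 4 ≤ n) : IsLinkPreserving φ := by
  obtain ⟨α, β, c, hL, hodd⟩ := h.lk_apply hn
  have hdeg : ∀ p, BraidGroup.perm n p = 1 → ∀ u, u < n → deg (φ p) u =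
      (α + (n - 2) * β) * deg p u +
        (2 * β + (n - 1) * c) * Multiplicative.toAdd (BraidGroup.expo n p) := by
    intro p hp u hu
    set S := Multiplicative.toAdd (BraidGroup.expo n p) with hS
    have h1 : ∀ w ∈ range n, BraidGroup.lk (φ p) u w = (α * BraidGroup.lk p u w +
        β * (deg p u + deg p w) + c * S) - ind w u * (2 * β * deg p u + c * S) := by
      intro w hw
      obtain rfl | hne := eq_or_ne w u
      · rw [lk_self, lk_self, ind_of_eq rfl]; ring
      · rw [hL p hp u w hne.symm hu (mem_range.1 hw), ind_of_ne hne]; ring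
    rw [deg, Finset.sum_congr rfl h1, Finset.sum_sub_distrib, ← Finset.sum_mul, sum_ind hu,
      Finset.sum_add_distrib, Finset.sum_add_distrib, ← Finset.mul_sum, ← Finset.mul_sum,
      Finset.sum_add_distrib, sum_deg, ← hS, Finset.sum_const, Finset.sum_const, card_range, ← deg]
    simp only [nsmul_eq_mul]
    ring
  have hs0 : BraidGroup.perm n (s n 0 ^ 2) = 1 := perm_s_sq
  have hS0 : Multiplicative.toAdd (BraidGroup.expo n (s n 0 ^ 2)) = 2 := by
    rw [map_pow, expo_s (by omega)]; rfl
  have htot : 2 * (α + (n - 2) * β) + n * (2 * β + (n - 1) * c) = 2 := by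
    have h1 := sum_deg (φ (s n 0 ^ 2))
    rw [h.expo, Finset.sum_congr rfl fun u hu => hdeg _ hs0 u (mem_range.1 hu),
      Finset.sum_add_distrib, ← Finset.mul_sum, sum_deg, hS0, Finset.sum_const, card_range,
      nsmul_eq_mul] at h1
    linarith
  set q := φ.symm (s n 0 ^ 2) with hq
  have hφq : φ q = s n 0 ^ 2 := φ.apply_symm_apply _
  have hqp : BraidGroup.perm n q = 1 := by rw [hq, h.symm.perm, hs0]
  have hqd : ∀ u, 2 ∣ deg q u := fun u =>
    Finset.dvd_sum fun w _ => (even_lk hqp u w).two_dvd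
  have hα : IsUnit α := by
    have h02 := hL q hqp 0 1 (by omega) (by omega) (by omega)
    have h13 := hL q hqp 2 3 (by omega) (by omega) (by omega)
    have h03 := hL q hqp 0 3 (by omega) (by omega) (by omega)
    have h12 := hL q hqp 2 1 (by omega) (by omega) (by omega)
    rw [hφq, lk_s_sq (by omega)] at h02 h13 h03 h12
    simp [ind] at h02 h13 h03 h12
    obtain ⟨x1, e1⟩ := (even_lk hqp 0 1).two_dvd
    obtain ⟨x2, e2⟩ := (even_lk hqp 2 3).two_dvd
    obtain ⟨x3, e3⟩ := (even_lk hqp 0 3).two_dvd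
    obtain ⟨x4, e4⟩ := (even_lk hqp 2 1).two_dvd
    rw [e1] at h02
    rw [e2] at h13
    rw [e3] at h03
    rw [e4] at h12
    exact IsUnit.of_mul_eq_one (x1 + x2 - x3 - x4) (by linarith)
  have hγ : IsUnit (α + (n - 2) * β) := by
    have h1 := hdeg q hqp 0 (by omega)
    have h2 := hdeg q hqp 2 (by omega)
    have e : ∀ u, deg (s n 0 ^ 2) u = 2 * (ind u 0 + ind u 1) := fun u => by
      simp only [deg, lk_s_sq (show 1 < n by omega)]
      rw [← Finset.mul_sum, Finset.sum_add_distrib, ← Finset.mul_sum, ← Finset.mul_sum,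
        sum_ind (by omega), sum_ind (by omega), mul_one, mul_one]
    rw [hφq, e] at h1 h2
    simp [ind] at h1 h2
    obtain ⟨x1, e1⟩ := hqd 0
    obtain ⟨x2, e2⟩ := hqd 2
    rw [e1] at h1
    rw [e2] at h2
    exact IsUnit.of_mul_eq_one (x1 - x2) (by linarith)
  have hfin : α = 1 ∧ β = 0 ∧ c = 0 := by
    rw [Int.isUnit_iff] at hα hγ
    obtain rfl | h5 := hn.eq_or_lt
    · push_cast at hγ htot
      obtain ⟨d, hd⟩ := hodd
      omega
    · have h5' : (5 : ℤ) ≤ n := by exact_mod_cast h5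
      have hβ : β = 0 := by
        obtain hlt | rfl | hlt := lt_trichotomy β 0
        · have : ((n : ℤ) - 2) * β ≤ ((n : ℤ) - 2) * (-1) :=
            mul_le_mul_of_nonneg_left (by omega) (by omega)
          omega
        · rfl
        · have : ((n : ℤ) - 2) * 1 ≤ ((n : ℤ) - 2) * β :=
            mul_le_mul_of_nonneg_left (by omega) (by omega)
          omega
      subst hβ
      have hn20 : (20 : ℤ) ≤ n * (n - 1) := by nlinarith
      have hc : (n : ℤ) * (n - 1) * c = 2 - 2 * α := by linarith
      have hc0 : c = 0 := by
        obtain hlt | rfl | hlt := lt_trichotomy c 0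
        · have : (n : ℤ) * (n - 1) * c ≤ n * (n - 1) * (-1) :=
            mul_le_mul_of_nonneg_left (by omega) (by omega)
          omega
        · rfl
        · have : (n : ℤ) * (n - 1) * 1 ≤ n * (n - 1) * c :=
            mul_le_mul_of_nonneg_left (by omega) (by omega)
          omega
      subst hc0
      exact ⟨by linarith, rfl, rfl⟩
  obtain ⟨rfl, rfl, rfl⟩ := hfin
  refine ⟨h.perm, fun p hp i j hij hj => ?_⟩
  rw [hL p hp i j hij.ne (hij.trans hj) hj]
  ring

end IsExpoPreserving

end BraidGroup

namespace BraidGroup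

open Equiv

/-! ### Homomorphisms from braid groups to small symmetric groups -/

theorem eq_of_commute_of_braid {G : Type*} [Group G] {a b : G} (h : Commute a b)
    (hb : a * b * a = b * a * b) : a = b := by
  rw [h.eq, mul_assoc, mul_assoc] at hb
  exact mul_left_cancel (mul_left_cancel hb)

section Hom

variable {G : Type*} [Group G] {k : ℕ}

theorem map_s_braid (ψ : B k →* G) {i : ℕ} (hi : i + 2 < k) :
    ψ (s k i) * ψ (s k (i + 1)) * ψ (s k i) =
      ψ (s k (i + 1)) * ψ (s k i) * ψ (s k (i + 1)) := by
  simp only [← map_mul, s_braid hi]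

theorem map_s_eq_of_eq (ψ : B k →* G) {i : ℕ} (hi : i + 2 < k)
    (h : ψ (s k i) = ψ (s k (i + 1))) : ∀ j, j + 1 < k → ψ (s k j) = ψ (s k 0) := by
  have hcomm : ∀ i, Commute (ψ (s k i)) (ψ (s k (i + 2))) := fun i => by
    rw [Commute, SemiconjBy, ← map_mul, ← map_mul, (s_comm (n := k) (i := i) (j := i + 2) le_rfl)]
  have down : ∀ i, i + 2 < k → ψ (s k i) = ψ (s k (i + 1)) → ψ (s k 0) = ψ (s k 1) := by
    intro i
    induction i with
    | zero => exact fun _ h => h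
    | succ i ih =>
      intro hi h
      refine ih (by omega) (eq_of_commute_of_braid ?_ (map_s_braid ψ (by omega)))
      rw [h]; exact hcomm i
  have up : ∀ i, i + 2 < k → ψ (s k i) = ψ (s k (i + 1)) := by
    intro j
    induction j with
    | zero => exact fun _ => down i hi h
    | succ j ih =>
      intro hj
      refine eq_of_commute_of_braid ?_ (map_s_braid ψ (by omega))
      rw [← ih (by omega)]; exact hcomm j
  intro j
  induction j with
  | zero => exact fun _ => rfl
  | succ j ih => exact fun hj => (up j (by omega)).symm.trans (ih (by omega))

theorem map_s_eq_of_map_eq_one (ψ : B k →* G) {i : ℕ} (hi : i + 1 < k) (h : ψ (s k i) = 1) :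
    ∀ j, j + 1 < k → ψ (s k j) = 1 := by
  have h0 : ψ (s k 0) = 1 := by
    obtain ⟨b, hb, -⟩ := exists_conj_s i hi
    rw [hb, map_mul, map_mul, map_inv, conj_eq_one_iff] at h
    exact h
  intro j hj
  obtain ⟨b, hb, -⟩ := exists_conj_s j hj
  rw [hb, map_mul, map_mul, map_inv, h0, mul_one, mul_inv_cancel]

end Hom

section Restrict

variable {G α : Type*} [Group G]

/-- Restriction of an action to an invariant subset. -/
def restrictHom (ψ : G →* Perm α) (p : α → Prop) (h : ∀ g x, p (ψ g x) ↔ p x) :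
    G →* Perm {x // p x} :=
  MonoidHom.mk' (fun g => (ψ g).subtypePerm (h g)) fun a b => by
    ext x
    change ψ (a * b) x = ψ a (ψ b x)
    rw [map_mul]; rfl

theorem restrictHom_apply (ψ : G →* Perm α) (p : α → Prop) (h : ∀ g x, p (ψ g x) ↔ p x) (g : G)
    (x : {x // p x}) : (restrictHom ψ p h g x : α) = ψ g x := rfl

theorem apply_ne_iff_of_commute {t a : Perm α} (h : Commute a t) (x : α) :
    t (a x) ≠ a x ↔ t x ≠ x := by
  rw [← Perm.mul_apply, ← h.eq, Perm.mul_apply, Ne, a.injective.eq_iff]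

theorem SameCycle.of_commute {t a : Perm α} (h : Commute a t) {x y : α} (hxy : t.SameCycle x y) :
    t.SameCycle (a x) (a y) := by
  obtain ⟨i, rfl⟩ := hxy
  refine ⟨i, ?_⟩
  rw [← Perm.mul_apply, ← (h.zpow_right i).eq, Perm.mul_apply]

/-- The induced action on the cycles of a commuting permutation. -/
def cycleHom (ψ : G →* Perm α) (t : Perm α) (h : ∀ g, Commute (ψ g) t) :
    G →* Perm (Quotient (Perm.SameCycle.setoid t)) :=
  MonoidHom.mk' (fun g => Quotient.congr (ψ g) fun x y => by
    refine ⟨fun hxy => SameCycle.of_commute (h g) hxy, fun hxy => ?_⟩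
    have := SameCycle.of_commute (h g).inv_left hxy
    rwa [inv_app_self', inv_app_self'] at this) fun a b => by
    ext x
    induction x using Quotient.inductionOn with
    | h x => simp

theorem cycleHom_mk (ψ : G →* Perm α) (t : Perm α) (h : ∀ g, Commute (ψ g) t) (g : G) (x : α) :
    cycleHom ψ t h g ⟦x⟧ = ⟦ψ g x⟧ := rfl

theorem commute_of_sameCycle {t a b : Perm α} (ha : Commute a t) (hb : Commute b t)
    (ha' : ∀ x, t.SameCycle x (a x)) (hb' : ∀ x, t.SameCycle x (b x)) : Commute a b := by
  ext x
  obtain ⟨i, hi⟩ := ha' x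
  obtain ⟨j, hj⟩ := hb' x
  rw [Perm.mul_apply, Perm.mul_apply, ← hi, ← hj, ← Perm.mul_apply, (ha.zpow_right j).eq,
    ← Perm.mul_apply, (hb.zpow_right i).eq, Perm.mul_apply, Perm.mul_apply, ← hi, ← hj,
    ← Perm.mul_apply, ← Perm.mul_apply, ← zpow_add, ← zpow_add, add_comm]

theorem two_mul_card_cycles_le [Finite α] {t : Perm α} (ht : ∀ x, t x ≠ x) :
    2 * Nat.card (Quotient (Perm.SameCycle.setoid t)) ≤ Nat.card α := by
  let Q := Quotient (Perm.SameCycle.setoid t)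
  let f : Q × Bool → α := fun q => if q.2 then q.1.out else t q.1.out
  have hf : ∀ q, (⟦f q⟧ : Q) = q.1 := by
    rintro ⟨q, _ | _⟩
    · rw [← Quotient.out_eq q]
      exact Quotient.sound ⟨-1, by simp [f]⟩
    · exact Quotient.out_eq q
  have hinj : Function.Injective f := by
    rintro ⟨q, b⟩ ⟨q', b'⟩ h
    obtain rfl : q = q' := by
      have := hf (q, b)
      rw [h, hf] at this
      exact this.symm
    cases b <;> cases b' <;> simp [f, ht, (ht _).symm] at h ⊢
  have := Nat.card_le_card_of_injective f hinj
  rw [Nat.card_prod, Nat.card_eq_fintype_card (α := Bool), Fintype.card_bool] at this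
  change 2 * Nat.card Q ≤ _
  omega

end Restrict

/-- A braid group on many strands acts on few points through an abelian quotient. -/
def ActsTrivially (k m : ℕ) : Prop :=
  ∀ (α : Type) [Finite α] (ψ : B k →* Perm α), Nat.card α ≤ m → ψ (s k 0) = ψ (s k 1)

theorem ActsTrivially.of_commute {k : ℕ} (hk : 5 ≤ k) (H : ActsTrivially k (k - 2)) {α : Type}
    [Finite α] (ψ : B k →* Perm α) {t : Perm α} (hc : ∀ g, Commute (ψ g) t)
    (hα : Nat.card α ≤ 2 * (k - 2) + 1) {x : α} (hx : t x ≠ x) {j : ℕ} (hj : j + 1 < k) :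
    ψ (s k j) x = ψ (s k 0) x := by
  let p : α → Prop := fun x => t x ≠ x
  let ψ' := restrictHom ψ p fun g x => apply_ne_iff_of_commute (hc g) x
  let t' : Perm {x // p x} := t.subtypePerm fun x => apply_ne_iff_of_commute (Commute.refl t) x
  have hc' : ∀ g, Commute (ψ' g) t' := fun g => by
    ext x
    exact DFunLike.congr_fun (hc g) x.1
  have ht' : ∀ x, t' x ≠ x := fun x h => x.2 (congrArg Subtype.val h)
  have hcard : Nat.card (Quotient (Perm.SameCycle.setoid t')) ≤ k - 2 := by
    have h1 := two_mul_card_cycles_le ht'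
    have h2 : Nat.card {x // p x} ≤ Nat.card α := Finite.card_subtype_le p
    omega
  have h01 := H _ (cycleHom ψ' t' hc') hcard
  have hall := map_s_eq_of_eq _ (by omega) h01
  have hcyc : ∀ i, i + 1 < k → ∀ x, t'.SameCycle x (ψ' (s k i * (s k 3)⁻¹) x) := by
    intro i hi x
    have h1 : cycleHom ψ' t' hc' (s k i * (s k 3)⁻¹) = 1 := by
      rw [map_mul, map_inv, hall i hi, hall 3 (by omega), mul_inv_cancel]
    have := DFunLike.congr_fun h1 ⟦x⟧
    rw [cycleHom_mk] at this
    exact (Quotient.exact this).symm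
  have hcomm := commute_of_sameCycle (hc' _) (hc' _) (hcyc 0 (by omega)) (hcyc 1 (by omega))
  have e0 : Commute (ψ' (s k 0)) (ψ' (s k 3)) :=
    Commute.map (s_comm (n := k) (i := 0) (j := 3) (by omega)) ψ'
  have e1 : Commute (ψ' (s k 1)) (ψ' (s k 3)) :=
    Commute.map (s_comm (n := k) (i := 1) (j := 3) (by omega)) ψ'
  rw [map_mul, map_mul, map_inv] at hcomm
  have h3 : Commute (ψ' (s k 0)) (ψ' (s k 1)) := by
    have a1 : Commute (ψ' (s k 0) * (ψ' (s k 3))⁻¹) (ψ' (s k 3)) :=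
      e0.mul_left (Commute.refl _).inv_left
    have a2 := hcomm.mul_right a1
    rw [inv_mul_cancel_right] at a2
    have a3 := a2.mul_left e1.symm
    rwa [inv_mul_cancel_right] at a3
  have h4 := eq_of_commute_of_braid h3 (map_s_braid ψ' (by omega))
  have h5 := map_s_eq_of_eq ψ' (by omega) h4 j hj
  exact congrArg Subtype.val (DFunLike.congr_fun h5 ⟨x, hx⟩)

set_option maxRecDepth 100000 in
theorem perm_four_aux : ∀ a : Perm (Fin 4), a ≠ 1 → ∀ b : Perm (Fin 4), a * b = b * a →
    ∀ c : Perm (Fin 4), a * c = c * a → b * c * b = c * b * c → b = c := by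
  decide +kernel

/-- Shifting strands by two. -/
def shiftTwo (k : ℕ) : B k →* B (k + 2) :=
  lift (f := fun i => s (k + 2) (i + 2))
    ⟨fun i j hij hj => s_comm (by omega), fun i hi => s_braid (by omega)⟩

theorem shiftTwo_s {k i : ℕ} (hi : i + 1 < k) : shiftTwo k (s k i) = s (k + 2) (i + 2) :=
  lift_s _ hi

theorem commute_shiftTwo {k : ℕ} (b : B k) : Commute (shiftTwo k b) (s (k + 2) 0) := by
  have := mem_of_s_mem ((Subgroup.centralizer {s (k + 2) 0}).comap (shiftTwo k)) (fun i hi => by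
    rw [Subgroup.mem_comap, shiftTwo_s hi, Subgroup.mem_centralizer_singleton_iff]
    exact (s_comm (by omega)).symm) b
  exact Subgroup.mem_centralizer_singleton_iff.1 this

theorem actsTrivially : ∀ k, 5 ≤ k → ActsTrivially k (k - 2)
  | 0, h => by omega
  | 1, h => by omega
  | k + 2, hk => by
    intro α _ ψ hα
    by_cases h1 : ψ (s (k + 2) 0) = 1
    · rw [h1, map_s_eq_of_map_eq_one ψ (by omega) h1 1 (by omega)]
    have hc : ∀ g, Commute (ψ (shiftTwo k g)) (ψ (s (k + 2) 0)) := fun g =>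
      (commute_shiftTwo g).map ψ
    suffices h : ψ (s (k + 2) 2) = ψ (s (k + 2) 3) from
      (map_s_eq_of_eq ψ (by omega) h 1 (by omega)).symm
    obtain h5 | h5 := lt_or_ge k 5
    · have : Fintype α := Fintype.ofFinite α
      obtain ⟨ι⟩ : Nonempty (α ↪ Fin 4) := Function.Embedding.nonempty_of_card_le (by
        rw [Fintype.card_fin, ← Nat.card_eq_fintype_card]; omega)
      have hι := Perm.viaEmbeddingHom_injective ι
      apply hι
      refine perm_four_aux (Perm.viaEmbeddingHom ι (ψ (s (k + 2) 0))) ?_ _ ?_ _ ?_ ?_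
      · rwa [Ne, map_eq_one_iff _ hι]
      · simp only [← map_mul]
        rw [s_comm (by omega)]
      · simp only [← map_mul]
        rw [s_comm (by omega)]
      · simp only [← map_mul]
        rw [s_braid (by omega)]
    · have ih := actsTrivially k h5
      have hs : ∀ x, ψ (s (k + 2) 0) x ≠ x → ψ (s (k + 2) 2) x = ψ (s (k + 2) 3) x := by
        intro x hx
        have := ih.of_commute h5 (ψ.comp (shiftTwo k)) hc (by omega) hx (j := 1) (by omega)
        rw [MonoidHom.comp_apply, MonoidHom.comp_apply, shiftTwo_s (by omega),
          shiftTwo_s (by omega)] at this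
        exact this.symm
      ext x
      by_cases hx : ψ (s (k + 2) 0) x = x
      · let p : α → Prop := fun x => ψ (s (k + 2) 0) x = x
        have hp : ∀ g x, p (ψ (shiftTwo k g) x) ↔ p x := fun g x =>
          not_iff_not.1 (apply_ne_iff_of_commute (hc g) x)
        have := ih _ (restrictHom (ψ.comp (shiftTwo k)) p hp) ?_
        · have := congrArg Subtype.val (DFunLike.congr_fun this ⟨x, hx⟩)
          rw [restrictHom_apply, restrictHom_apply, MonoidHom.comp_apply, MonoidHom.comp_apply,
            shiftTwo_s (by omega), shiftTwo_s (by omega)] at this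
          exact this
        · classical
          have : Fintype α := Fintype.ofFinite α
          have h2 := Perm.two_le_card_support_of_ne_one h1
          have h3 := Finset.card_filter_add_card_filter_not (s := Finset.univ) p
          rw [Finset.card_univ, ← Nat.card_eq_fintype_card] at h3
          have h4 : Nat.card {x // p x} = (Finset.univ.filter p).card := by
            rw [Nat.card_eq_fintype_card, Fintype.card_subtype]
          change 2 ≤ (Finset.univ.filter fun x => ¬ p x).card at h2
          omega
      · exact hs x hx

end BraidGroup

namespace BraidGroup

open Equiv

/-! ### The images of the generators under an automorphism are transpositions, many strands -/

/-- The underlying permutation of the strands of a braid, as a permutation of `Fin n`. -/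
def permFin (n : ℕ) : B n →* Perm (Fin n) :=
  MonoidHom.mk' (fun b =>
    { toFun := fun u => ⟨perm n b u, perm_apply_lt b u.2⟩
      invFun := fun u => ⟨perm n b⁻¹ u, perm_apply_lt b⁻¹ u.2⟩
      left_inv := fun u => Fin.ext (by simp only [map_inv]; exact inv_app_self' _ _)
      right_inv := fun u => Fin.ext (by simp only [map_inv]; exact app_inv_self' _ _) })
    fun a b => by
      ext u
      change perm n (a * b) u = perm n a (perm n b u)
      rw [map_mul]; rfl

theorem coe_permFin {n : ℕ} (b : B n) (u : Fin n) : (permFin n b u : ℕ) = perm n b u := rfl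

theorem permFin_s {n i : ℕ} (hi : i + 1 < n) :
    permFin n (s n i) = swap ⟨i, by omega⟩ ⟨i + 1, hi⟩ := by
  ext u
  rw [coe_permFin, perm_s hi, swap_apply_def, swap_apply_def]
  simp only [Fin.ext_iff]
  split_ifs <;> rfl

theorem perm_eq_of_permFin_eq {n : ℕ} {a b : B n} (h : permFin n a = permFin n b) :
    perm n a = perm n b := by
  ext u
  obtain hu | hu := lt_or_ge u n
  · have := congrArg Fin.val (DFunLike.congr_fun h ⟨u, hu⟩)
    exact this
  · rw [perm_apply_of_le a hu, perm_apply_of_le b hu]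

theorem permFin_surjective (n : ℕ) : Function.Surjective (permFin n) := by
  obtain _ | n := n
  · exact fun g => ⟨1, Subsingleton.elim _ _⟩
  rw [← MonoidHom.mrange_eq_top, ← top_le_iff, ← Perm.mclosure_swap_castSucc_succ n,
    Submonoid.closure_le]
  rintro _ ⟨i, rfl⟩
  exact ⟨s (n + 1) i, permFin_s (by omega)⟩

theorem sign_permFin {n : ℕ} (b : B n) :
    Perm.sign (permFin n b) = zpowersHom ℤˣ (-1) (expo n b) := by
  have : Perm.sign.comp (permFin n) = (zpowersHom ℤˣ (-1)).comp (expo n) :=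
    hom_ext fun i hi => by
      rw [MonoidHom.comp_apply, MonoidHom.comp_apply, permFin_s hi, expo_s hi,
        Perm.sign_swap (by simp)]
      simp
  exact DFunLike.congr_fun this b

section Surjective

variable {n : ℕ} {ψ : B n →* Perm (Fin n)}

theorem commute_map_s {G : Type*} [Group G] (ψ : B n →* G) {i j : ℕ} (hij : i + 2 ≤ j) :
    Commute (ψ (s n i)) (ψ (s n j)) :=
  Commute.map (s_comm hij) ψ

theorem map_s_ne (hψ : Function.Surjective ψ) {i : ℕ} (hi : i + 2 < n) :
    ψ (s n i) ≠ ψ (s n (i + 1)) := by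
  intro h
  have hall := map_s_eq_of_eq ψ hi h
  have h1 : ∀ b, Commute (ψ b) (ψ (s n 0)) := fun b => by
    have := mem_of_s_mem ((Subgroup.centralizer {ψ (s n 0)}).comap ψ) (fun i hi => by
      rw [Subgroup.mem_comap, Subgroup.mem_centralizer_singleton_iff, hall i hi]) b
    exact Subgroup.mem_centralizer_singleton_iff.1 this
  have h2 : ∀ b c, Commute (ψ b) (ψ c) := fun b c => by
    have := mem_of_s_mem ((Subgroup.centralizer {ψ b}).comap ψ) (fun i hi => by
      rw [Subgroup.mem_comap, Subgroup.mem_centralizer_singleton_iff, hall i hi]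
      exact (h1 b).symm) c
    exact (Subgroup.mem_centralizer_singleton_iff.1 this : _ = _).symm
  obtain ⟨b, hb⟩ := hψ (permFin n (s n 0))
  obtain ⟨c, hc⟩ := hψ (permFin n (s n 1))
  have h3 := h2 b c
  rw [hb, hc, permFin_s (by omega), permFin_s (by omega)] at h3
  have h4 := DFunLike.congr_fun h3 ⟨0, by omega⟩
  simp [swap_apply_def, Fin.ext_iff] at h4

theorem forall_of_invariant (hψ : Function.Surjective ψ) {p : Fin n → Prop}
    (hp : ∀ i, i + 1 < n → ∀ x, p x → p (ψ (s n i) x)) {x : Fin n} (hx : p x) (y : Fin n) :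
    p y := by
  have h : ∀ b x, p x → p (ψ b x) := by
    intro b
    induction b using braid_induction with
    | one => intro x hx; rwa [map_one]
    | gen i hi b ih => intro x hx; rw [map_mul]; exact hp i hi _ (ih x hx)
    | inv i hi b ih =>
      intro x hx
      rw [map_mul, map_inv]
      have hbij := ((Set.toFinite {x | p x}).injOn_iff_bijOn_of_mapsTo
        (fun x hx => hp i hi x hx)).1 (ψ (s n i)).injective.injOn
      obtain ⟨y, hy, hy'⟩ := hbij.surjOn (ih x hx)
      rw [Perm.mul_apply, ← hy', inv_app_self']
      exact hy
  obtain ⟨b, hb⟩ := hψ (swap x y)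
  have := h b x hx
  rwa [hb, swap_apply_left] at this

theorem exists_conj_s_far {i j : ℕ} (hij : i + 2 ≤ j) (hj : j + 1 < n) :
    ∃ b : B n, s n i = b * s n 0 * b⁻¹ ∧ Commute b (s n j) := by
  obtain ⟨b, hb, -⟩ := exists_conj_s (n := j) i (by omega)
  refine ⟨incl (by omega) b, ?_, commute_incl_s _ le_rfl b⟩
  rw [← incl_s (k := j) (by omega) (by omega), ← incl_s (k := j) (n := n) (i := 0) (by omega)
    (by omega), ← map_inv, ← map_mul, ← map_mul, ← hb]

theorem card_support_map_s (ψ : B n →* Perm (Fin n)) {i : ℕ} (hi : i + 1 < n) :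
    (ψ (s n i)).support.card = (ψ (s n 0)).support.card := by
  obtain ⟨b, hb, -⟩ := exists_conj_s i hi
  rw [hb, map_mul, map_mul, map_inv, Perm.card_support_conj]

theorem map_s_ne_one (hψ : Function.Surjective ψ) (hn : 3 ≤ n) : ψ (s n 0) ≠ 1 := fun h =>
  map_s_ne hψ (i := 0) (by omega) (by
    rw [h, map_s_eq_of_map_eq_one ψ (by omega) h 1 (by omega)])

theorem isSwap_map_s_of_seven_le (hψ : Function.Surjective ψ) (hn : 7 ≤ n) :
    (ψ (s n 0)).IsSwap := by
  obtain ⟨k, rfl⟩ : ∃ k, n = k + 2 := ⟨n - 2, by omega⟩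
  have hk : 5 ≤ k := by omega
  set ρ : ℕ → Perm (Fin (k + 2)) := fun i => ψ (s (k + 2) i) with hρ
  have h1 : ∀ x, ρ 0 x ≠ x → ∀ j, 2 ≤ j → j < k + 1 → ρ j x = ρ 2 x := by
    intro x hx j h2 hj
    obtain ⟨j, rfl⟩ : ∃ i, j = i + 2 := ⟨j - 2, by omega⟩
    have := (actsTrivially k hk).of_commute hk (ψ.comp (shiftTwo k)) (t := ρ 0)
      (fun g => (commute_shiftTwo g).map ψ) (by rw [Nat.card_fin]; omega) hx (j := j) (by omega)
    rwa [MonoidHom.comp_apply, MonoidHom.comp_apply, shiftTwo_s (by omega),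
      shiftTwo_s (by omega)] at this
  have h2 : ∀ x, ρ k x ≠ x → ∀ j, j + 1 < k → ρ j x = ρ 0 x := by
    intro x hx j hj
    have := (actsTrivially k hk).of_commute hk (ψ.comp (incl (n := k + 2) (by omega))) (t := ρ k)
      (fun g => (commute_incl_s _ le_rfl g).map ψ) (by rw [Nat.card_fin]; omega) hx (j := j)
      (by omega)
    rwa [MonoidHom.comp_apply, MonoidHom.comp_apply, incl_s _ (by omega),
      incl_s _ (by omega)] at this
  have hY : ∀ x, ρ 0 x ≠ x → ρ k x = x := by
    by_contra! hY
    obtain ⟨x, hx0, hxk⟩ := hY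
    have hall : ∀ x, ρ 0 x ≠ x → ρ k x ≠ x → ∀ j, j < k + 1 → ρ j x = ρ 2 x := by
      intro x hx0 hxk j hj
      obtain h | h := lt_or_ge j 2
      · rw [h2 x hxk j (by omega), h2 x hxk 2 (by omega)]
      · exact h1 x hx0 j h hj
    have hp := forall_of_invariant (p := fun x => ρ 0 x ≠ x ∧ ρ k x ≠ x) hψ (fun i hi x hx => by
      change ρ 0 (ρ i x) ≠ ρ i x ∧ ρ k (ρ i x) ≠ ρ i x
      rw [hall x hx.1 hx.2 i (by omega)]
      exact ⟨(apply_ne_iff_of_commute (commute_map_s ψ (by omega)).symm x).2 hx.1,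
        (apply_ne_iff_of_commute (commute_map_s ψ (by omega)) x).2 hx.2⟩) ⟨hx0, hxk⟩
    refine map_s_ne hψ (i := 0) (by omega) (Equiv.ext fun x => ?_)
    exact (hall x (hp x).1 (hp x).2 0 (by omega)).trans
      (hall x (hp x).1 (hp x).2 1 (by omega)).symm
  have hdisj0 : ∀ x, ρ 0 x ≠ x → ∀ j, 2 ≤ j → j < k + 1 → ρ j x = x := by
    intro x hx j h2 hj
    rw [h1 x hx j h2 hj, ← h1 x hx k (by omega) (by omega), hY x hx]
  have hdisj : ∀ i j, i + 2 ≤ j → j < k + 1 → Disjoint (ρ i).support (ρ j).support := by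
    intro i j hij hj
    rw [Finset.disjoint_left]
    intro x hi
    rw [Perm.mem_support] at hi
    rw [Perm.notMem_support]
    obtain ⟨b, hb, hc⟩ := exists_conj_s_far hij (show j + 1 < k + 2 by omega)
    have e1 : ρ i x = ψ b (ρ 0 ((ψ b)⁻¹ x)) := by
      simp only [hρ, hb, map_mul, map_inv, Perm.mul_apply]
    have e2 : ρ j ((ψ b)⁻¹ x) = (ψ b)⁻¹ x := by
      refine hdisj0 _ (fun h => hi ?_) j (by omega) hj
      rw [e1, h, app_inv_self']
    have e3 : Commute (ψ b)⁻¹ (ρ j) := (hc.map ψ).inv_left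
    rw [← Perm.mul_apply, ← e3.eq, Perm.mul_apply] at e2
    exact (ψ b)⁻¹.injective e2
  have hcard : ((k + 2) / 2) * (ρ 0).support.card ≤ k + 2 := by
    have hd : (Finset.range ((k + 2) / 2) : Set ℕ).PairwiseDisjoint
        fun m => (ρ (2 * m)).support := by
      intro a ha b hb hab
      rw [Finset.mem_coe, Finset.mem_range] at ha hb
      obtain h | h := lt_or_gt_of_ne hab
      · exact hdisj _ _ (by omega) (by omega)
      · exact (hdisj _ _ (by omega) (by omega)).symm
    have e := Finset.card_biUnion hd
    rw [Finset.sum_congr rfl fun m hm => card_support_map_s ψ (i := 2 * m) (by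
      rw [Finset.mem_range] at hm; omega), Finset.sum_const, Finset.card_range, smul_eq_mul] at e
    rw [← e]
    exact (Finset.card_le_univ _).trans (by rw [Fintype.card_fin])
  have h3 := Perm.two_le_card_support_of_ne_one (map_s_ne_one hψ (by omega))
  change 2 ≤ (ρ 0).support.card at h3
  rw [← Perm.card_support_eq_two]
  change (ρ 0).support.card = 2
  by_contra h4
  have : (k + 2) / 2 * 3 ≤ (k + 2) / 2 * (ρ 0).support.card := Nat.mul_le_mul_left _ (by omega)
  omega

end Surjective

end BraidGroup

namespace BraidGroup

open Equiv

/-! ### The images of the generators under an automorphism are transpositions, few strands -/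

theorem mem_of_odd_cycleType {m : Multiset ℕ} (h2 : ∀ x ∈ m, 2 ≤ x) (hs : m.sum ≤ 6)
    (hodd : Odd (m.sum + m.card)) :
    m = {2} ∨ m = {4} ∨ m = {6} ∨ m = {3, 2} ∨ m = {2, 2, 2} := by
  induction m using Quotient.inductionOn with
  | h l =>
    simp only [Multiset.quot_mk_to_coe, Multiset.mem_coe, Multiset.sum_coe, Multiset.coe_card]
      at h2 hs hodd ⊢
    obtain _ | ⟨a, _ | ⟨b, _ | ⟨c, _ | ⟨d, l⟩⟩⟩⟩ := l
    · simp at hodd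
    · have ha := h2 a (by simp)
      simp at hs hodd
      rw [Nat.odd_iff] at hodd
      obtain rfl | rfl | rfl : a = 2 ∨ a = 4 ∨ a = 6 := by omega
      all_goals decide
    · have ha := h2 a (by simp)
      have hb := h2 b (by simp)
      simp at hs hodd
      rw [Nat.odd_iff] at hodd
      obtain ⟨rfl, rfl⟩ | ⟨rfl, rfl⟩ : a = 2 ∧ b = 3 ∨ a = 3 ∧ b = 2 := by omega
      all_goals decide
    · have ha := h2 a (by simp)
      have hb := h2 b (by simp)
      have hc := h2 c (by simp)
      simp at hs hodd
      obtain ⟨rfl, rfl, rfl⟩ : a = 2 ∧ b = 2 ∧ c = 2 := by omega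
      decide
    · have ha := h2 a (by simp)
      have hb := h2 b (by simp)
      have hc := h2 c (by simp)
      have hd := h2 d (by simp)
      simp at hs
      omega

theorem forall_of_cycleType_eq {m : ℕ} {r a : Perm (Fin m)} (h : a.cycleType = r.cycleType)
    (H : ∀ b, r * b = b * r → ∀ c, r * c = c * r → b * c * b = c * b * c → b = c)
    {b c : Perm (Fin m)} (hb : Commute a b) (hc : Commute a c) (hbc : b * c * b = c * b * c) :
    b = c := by
  obtain ⟨g, hg⟩ := isConj_iff.1 (Perm.isConj_iff_cycleType_eq.2 h)
  have key := H (g * b * g⁻¹) (by rw [← hg, conj_mul, conj_mul, hb.eq]) (g * c * g⁻¹)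
    (by rw [← hg, conj_mul, conj_mul, hc.eq]) (by simp only [conj_mul, hbc])
  exact mul_left_cancel (mul_right_cancel key)

set_option maxRecDepth 100000 in
theorem eq_of_commute_four {b c a : Perm (Fin 6)} (ha : a.cycleType = {4}) (hb : Commute a b)
    (hc : Commute a c) (hbc : b * c * b = c * b * c) : b = c :=
  forall_of_cycleType_eq (r := c[0, 1, 2, 3]) (ha.trans (by decide +kernel)) (by decide +kernel)
    hb hc hbc

set_option maxRecDepth 100000 in
theorem eq_of_commute_six {b c a : Perm (Fin 6)} (ha : a.cycleType = {6}) (hb : Commute a b)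
    (hc : Commute a c) (hbc : b * c * b = c * b * c) : b = c :=
  forall_of_cycleType_eq (r := c[0, 1, 2, 3, 4, 5]) (ha.trans (by decide +kernel))
    (by decide +kernel) hb hc hbc

set_option maxRecDepth 100000 in
theorem eq_of_commute_three_two {b c a : Perm (Fin 6)} (ha : a.cycleType = {3, 2})
    (hb : Commute a b) (hc : Commute a c) (hbc : b * c * b = c * b * c) : b = c :=
  forall_of_cycleType_eq (r := c[0, 1, 2] * c[3, 4]) (ha.trans (by decide +kernel))
    (by decide +kernel) hb hc hbc

set_option maxRecDepth 100000 in
theorem apply_ne_of_commute_two_two_two {b c a : Perm (Fin 6)} (ha : a.cycleType = {2, 2, 2})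
    (hb : Commute a b) (hc : Commute a c) (hbc : b * c * b = c * b * c) (hne : b ≠ c)
    (x : Fin 6) : b (c x) ≠ x := by
  obtain ⟨g, hg⟩ := isConj_iff.1 (Perm.isConj_iff_cycleType_eq.2
    (ha.trans (by decide +kernel : _ = (c[0, 1] * c[2, 3] * c[4, 5] : Perm (Fin 6)).cycleType)))
  have H : ∀ b, (c[0, 1] * c[2, 3] * c[4, 5] : Perm (Fin 6)) * b = b * (c[0, 1] * c[2, 3] * c[4, 5])
      → ∀ c, (c[0, 1] * c[2, 3] * c[4, 5] : Perm (Fin 6)) * c = c * (c[0, 1] * c[2, 3] * c[4, 5])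
      → b * c * b = c * b * c → b ≠ c → ∀ x, b (c x) ≠ x := by decide +kernel
  intro h
  refine H (g * b * g⁻¹) (by rw [← hg, conj_mul, conj_mul, hb.eq]) (g * c * g⁻¹)
    (by rw [← hg, conj_mul, conj_mul, hc.eq]) (by simp only [conj_mul, hbc])
    (fun h => hne (mul_left_cancel (mul_right_cancel h))) (g x) ?_
  rw [← Perm.mul_apply, conj_mul, ← Perm.mul_apply, inv_mul_cancel_right, Perm.mul_apply,
    Perm.mul_apply, h]

set_option maxRecDepth 100000 in
theorem exists_bijective_of_pow_three : ∀ c : Perm (Fin 6), (∀ x, c x ≠ x) → c * c * c = 1 →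
    ∃ y, Function.Bijective ![0, c 0, c (c 0), y, c y, c (c y)] := by
  decide +kernel

set_option maxRecDepth 100000 in
theorem exists_bijective_of_four_cycle : ∀ a : Perm (Fin 4), Perm.sign a = -1 → a.support.card ≠ 2 →
    Function.Bijective ![0, a 0, a (a 0), a (a (a 0))] ∧ a * a * a * a = 1 ∧
    ∀ b, a ≠ b → a * b * a = b * a * b → (a * b) * (a * b) * (a * b) = 1 := by
  decide +kernel

end BraidGroup

namespace BraidGroup

open Equiv

theorem eq_of_commute_of_odd {a b c : Perm (Fin 6)} (ha : Perm.sign a = -1)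
    (h2 : a.support.card ≠ 2) (h6 : a.cycleType ≠ {2, 2, 2}) (hb : Commute a b)
    (hc : Commute a c) (hbc : b * c * b = c * b * c) : b = c := by
  have hodd : Odd (a.cycleType.sum + a.cycleType.card) := by
    rw [Perm.sign_of_cycleType] at ha
    by_contra h
    rw [(Nat.not_odd_iff_even.1 h).neg_one_pow] at ha
    exact absurd ha (by decide)
  have hsum : a.cycleType.sum ≤ 6 := by
    rw [Perm.sum_cycleType]
    exact (Finset.card_le_univ _).trans (by rw [Fintype.card_fin])
  obtain h | h | h | h | h :=
    mem_of_odd_cycleType (fun x hx => Perm.two_le_of_mem_cycleType hx) hsum hodd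
  · exact absurd (by rw [← Perm.sum_cycleType, h]; rfl) h2
  · exact eq_of_commute_four h hb hc hbc
  · exact eq_of_commute_six h hb hc hbc
  · exact eq_of_commute_three_two h hb hc hbc
  · exact absurd h h6

theorem sign_map_s {n : ℕ} {φ : B n ≃* B n} (hφ : ∀ b, expo n (φ b) = expo n b) {i : ℕ}
    (hi : i + 1 < n) : Perm.sign (permFin n (φ (s n i))) = -1 := by
  rw [sign_permFin, hφ, expo_s hi]
  simp

theorem isSwap_of_five {ψ : B 5 →* Perm (Fin 5)} (hψ : Function.Surjective ψ)
    (hs : Perm.sign (ψ (s 5 0)) = -1) : (ψ (s 5 0)).IsSwap := by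
  rw [← Perm.card_support_eq_two]
  by_contra h2
  let ι : Fin 5 ↪ Fin 6 := Fin.castSuccEmb
  have hι := Perm.viaEmbeddingHom_injective ι
  refine map_s_ne hψ (i := 2) (by omega) (hι ?_)
  have hc : ∀ g : Perm (Fin 5), (Perm.viaEmbeddingHom ι g).support.card = g.support.card :=
    fun g => @Perm.card_support_extend_domain _ _ _ _ _ _ _ (fun _ => Classical.propDecidable _) _ _
  refine eq_of_commute_of_odd (a := Perm.viaEmbeddingHom ι (ψ (s 5 0))) ?_ ?_ ?_
    ((commute_map_s ψ (by omega)).map _) ((commute_map_s ψ (by omega)).map _) ?_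
  · rw [← hs]; exact @Perm.sign_extendDomain _ _ _ _ _ _ _ _ (fun _ => Classical.propDecidable _) _
  · rwa [hc]
  · intro h
    have h1 := hc (ψ (s 5 0))
    rw [← Perm.sum_cycleType, h] at h1
    have h3 : (ψ (s 5 0)).support.card ≤ Fintype.card (Fin 5) := Finset.card_le_univ _
    rw [← h1] at h3
    exact absurd h3 (by decide)
  · rw [← map_mul, ← map_mul, map_s_braid ψ (by omega), map_mul, map_mul]

theorem lk_apply_of_commute {n : ℕ} {p b : B n} (hp : perm n p = 1) (h : Commute b p)
    (u v : Fin n) : lk p (permFin n b u) (permFin n b v) = lk p u v := by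
  have := lk_conj b hp (permFin n b u) (permFin n b v)
  rw [h.eq, mul_inv_cancel_right, coe_permFin, coe_permFin, inv_app_self', inv_app_self'] at this
  exact this

theorem perm_eq_one_of_permFin {n : ℕ} {b : B n} (h : permFin n b = 1) : perm n b = 1 := by
  rw [perm_eq_of_permFin_eq (h.trans (map_one (permFin n)).symm), map_one]

theorem isSwap_of_six {φ : B 6 ≃* B 6} (hφ : ∀ b, expo 6 (φ b) = expo 6 b) :
    (permFin 6 (φ (s 6 0))).IsSwap := by
  let ψ : B 6 →* Perm (Fin 6) := (permFin 6).comp φ.toMonoidHom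
  have hψ : Function.Surjective ψ := (permFin_surjective 6).comp φ.surjective
  rw [← Perm.card_support_eq_two]
  by_contra h2
  by_cases h6 : (ψ (s 6 0)).cycleType = {2, 2, 2}
  swap
  · exact map_s_ne hψ (i := 2) (by omega) (eq_of_commute_of_odd (a := ψ (s 6 0))
      (sign_map_s hφ (by omega)) h2 h6 (commute_map_s ψ (by omega)) (commute_map_s ψ (by omega))
      (map_s_braid ψ (by omega)))
  have hsq0 : ψ (s 6 0) * ψ (s 6 0) = 1 := by
    rw [← sq, ← orderOf_dvd_iff_pow_eq_one, ← Perm.lcm_cycleType, h6]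
    decide
  have hsq : ∀ i, i + 1 < 6 → ψ (s 6 i) * ψ (s 6 i) = 1 := by
    intro i hi
    obtain ⟨b, hb, -⟩ := exists_conj_s i hi
    rw [hb, map_mul, map_mul, map_inv, conj_mul, hsq0, mul_one, mul_inv_cancel]
  have hbr : ψ (s 6 2) * ψ (s 6 3) * ψ (s 6 2) = ψ (s 6 3) * ψ (s 6 2) * ψ (s 6 3) :=
    map_s_braid ψ (by omega)
  set c : Perm (Fin 6) := ψ (s 6 2 * s 6 3) with hc
  have hc1 : ∀ x, c x ≠ x := by
    intro x
    rw [hc, map_mul, Perm.mul_apply]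
    exact apply_ne_of_commute_two_two_two h6 (commute_map_s ψ (by omega))
      (commute_map_s ψ (by omega)) hbr (map_s_ne hψ (by omega)) x
  have hc3 : c * c * c = 1 := by
    rw [hc, map_mul]
    calc ψ (s 6 2) * ψ (s 6 3) * (ψ (s 6 2) * ψ (s 6 3)) * (ψ (s 6 2) * ψ (s 6 3))
        = (ψ (s 6 2) * ψ (s 6 3) * ψ (s 6 2)) * (ψ (s 6 3) * ψ (s 6 2) * ψ (s 6 3)) := by
          simp only [mul_assoc]
      _ = ψ (s 6 2) * ψ (s 6 3) * (ψ (s 6 2) * ψ (s 6 2)) * ψ (s 6 3) * ψ (s 6 2) := by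
          rw [← hbr]; simp only [mul_assoc]
      _ = 1 := by
          rw [hsq 2 (by omega), mul_one, mul_assoc (ψ (s 6 2)), hsq 3 (by omega), mul_one,
            hsq 2 (by omega)]
  set p := φ (s 6 0 ^ 2) with hp
  have hp1 : perm 6 p = 1 := perm_eq_one_of_permFin (by
    rw [hp, map_pow, map_pow, sq]; exact hsq0)
  have hinv : ∀ u v : Fin 6, lk p (c u) (c v) = lk p u v := lk_apply_of_commute hp1 (by
    refine Commute.map ?_ φ
    refine Commute.pow_right (Commute.mul_left ?_ ?_) 2
    · exact (s_comm (by omega)).symm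
    · exact (s_comm (by omega)).symm)
  have hrow : ∀ u : Fin 6, ∑ v : Fin 6, lk p (c u) v = ∑ v : Fin 6, lk p u v := by
    intro u
    rw [← Equiv.sum_comp c]
    exact Finset.sum_congr rfl fun v _ => hinv u v
  have hsum := sum_lk p
  have hexpo : Multiplicative.toAdd (expo 6 p) = 2 := by
    rw [hp, hφ, map_pow (expo 6), expo_s (by omega)]; rfl
  rw [hexpo] at hsum
  obtain ⟨y, hy⟩ := exists_bijective_of_pow_three c hc1 hc3
  rw [← hy.sum_comp, Fin.sum_univ_six] at hsum
  simp [hrow] at hsum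
  omega

theorem isSwap_of_four {φ : B 4 ≃* B 4} (hφ : ∀ b, expo 4 (φ b) = expo 4 b) :
    (permFin 4 (φ (s 4 0))).IsSwap := by
  let ψ : B 4 →* Perm (Fin 4) := (permFin 4).comp φ.toMonoidHom
  have hψ : Function.Surjective ψ := (permFin_surjective 4).comp φ.surjective
  rw [← Perm.card_support_eq_two]
  by_contra h2
  obtain ⟨hbij, h4, hcube⟩ := exists_bijective_of_four_cycle _ (sign_map_s hφ (by omega)) h2
  have hcube' := hcube (ψ (s 4 1)) (map_s_ne hψ (by omega)) (map_s_braid ψ (by omega))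
  set d := s 4 0 * s 4 1 with hd
  set p := φ (d * d * d) with hp
  have hp1 : perm 4 p = 1 := perm_eq_one_of_permFin (by
    rw [hp, hd]; simp only [map_mul]; exact hcube')
  have hbr : s 4 0 * s 4 1 * s 4 0 = s 4 1 * s 4 0 * s 4 1 := s_braid (by omega)
  have hcomm : Commute (s 4 0) (d * d * d) := by
    have e : d * d * d = (s 4 0 * s 4 1 * s 4 0) * (s 4 0 * s 4 1 * s 4 0) := by
      rw [hd]; nth_rw 2 [hbr]; simp only [mul_assoc]
    have e1 : s 4 0 * (s 4 0 * s 4 1 * s 4 0) = (s 4 0 * s 4 1 * s 4 0) * s 4 1 := by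
      rw [hbr]; simp only [← mul_assoc]; rw [hbr]
    have e2 : s 4 1 * (s 4 0 * s 4 1 * s 4 0) = (s 4 0 * s 4 1 * s 4 0) * s 4 0 := by
      rw [← mul_assoc, ← mul_assoc, ← hbr]
    rw [Commute, SemiconjBy, e, ← mul_assoc, e1, mul_assoc, e2]
    simp only [mul_assoc]
  set a := permFin 4 (φ (s 4 0)) with ha
  have hinv : ∀ u v : Fin 4, lk p (a u) (a v) = lk p u v :=
    lk_apply_of_commute hp1 (hcomm.map φ)
  have h4' : a (a (a (a 0))) = 0 := DFunLike.congr_fun h4 0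
  have hsum := sum_lk p
  have hexpo : Multiplicative.toAdd (expo 4 p) = 6 := by
    rw [hp, hφ, hd]
    simp only [map_mul, expo_s (show 0 + 1 < 4 by omega), expo_s (show 1 + 1 < 4 by omega)]
    rfl
  rw [hexpo, ← hbij.sum_comp, Fin.sum_univ_four] at hsum
  have hcol : ∀ u : Fin 4, ∑ v : Fin 4, lk p u v = lk p u (0 : Fin 4) + lk p u (a 0) +
      lk p u (a (a 0)) + lk p u (a (a (a 0))) := by
    intro u
    rw [← hbij.sum_comp, Fin.sum_univ_four]; rfl
  simp only [hcol] at hsum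
  have i1 := hinv 0 (a 0)
  have i2 := hinv (a 0) (a (a 0))
  have i3 := hinv (a (a 0)) (a (a (a 0)))
  have i4 := hinv 0 (a (a 0))
  rw [h4'] at i3
  obtain ⟨x, hx⟩ := even_lk hp1 (0 : Fin 4) (a 0)
  obtain ⟨y, hy⟩ := even_lk hp1 (0 : Fin 4) (a (a 0))
  simp [lk_self] at hsum
  have j1 := lk_symm p (0 : Fin 4) (a 0)
  have j2 := lk_symm p (0 : Fin 4) (a (a 0))
  have j3 := lk_symm p (0 : Fin 4) (a (a (a 0)))
  have j4 := lk_symm p (a 0) (a (a 0))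
  have j5 := lk_symm p (a 0) (a (a (a 0)))
  have j6 := lk_symm p (a (a 0)) (a (a (a 0)))
  simp only [Fin.val_zero] at *
  omega

end BraidGroup

namespace BraidGroup

open Equiv

/-! ### Automorphisms preserving the exponent sum -/

theorem swap_eq_of_not_commute {α : Type*} [DecidableEq α] {a b : α} {g : Perm α} (hab : a ≠ b)
    (hg : g.IsSwap) (hne : swap a b ≠ g) (hc : ¬ Commute (swap a b) g) :
    ∃ z, z ≠ a ∧ z ≠ b ∧ (g = swap b z ∨ g = swap a z) := by
  obtain ⟨x, y, hxy, rfl⟩ := hg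
  by_cases hxa : x = a
  · subst hxa
    exact ⟨y, hxy.symm, fun h => hne (by rw [h]), Or.inr rfl⟩
  by_cases hxb : x = b
  · subst hxb
    exact ⟨y, fun h => hne (by rw [h, swap_comm]), hxy.symm, Or.inl rfl⟩
  by_cases hya : y = a
  · subst hya
    exact ⟨x, hxy, hxb, Or.inr (swap_comm _ _)⟩
  by_cases hyb : y = b
  · subst hyb
    exact ⟨x, hxa, hxy, Or.inl (swap_comm _ _)⟩
  exact absurd (Perm.disjoint_swap_swap (by
    simp only [List.nodup_cons, List.mem_cons, List.not_mem_nil, or_false, not_or,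
      List.nodup_nil, and_true, not_false_eq_true]
    exact ⟨⟨hab, Ne.symm hxa, Ne.symm hya⟩, ⟨Ne.symm hxb, Ne.symm hyb⟩, hxy⟩)).commute hc

theorem eq_of_commute_swap {α : Type*} [DecidableEq α] {x y z : α} (hxy : x ≠ y)
    (hyz : z ≠ y) (h : Commute (swap x y) (swap y z)) : x = z := by
  have := DFunLike.congr_fun h.eq y
  rw [Perm.mul_apply, Perm.mul_apply, swap_apply_left, swap_apply_right] at this
  by_contra hxz
  rw [swap_apply_of_ne_of_ne (Ne.symm hxz) hyz, swap_apply_of_ne_of_ne hxy hxz] at this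
  exact hxz this.symm

section Chain

variable {n : ℕ} {ψ : B n →* Perm (Fin n)}

theorem not_commute_map_s (hψ : Function.Surjective ψ) {i : ℕ} (hi : i + 2 < n) :
    ¬ Commute (ψ (s n i)) (ψ (s n (i + 1))) := fun h =>
  map_s_ne hψ hi (eq_of_commute_of_braid h (map_s_braid ψ hi))

theorem map_s_add_two_ne (hψ : Function.Surjective ψ) (h0 : (ψ (s n 0)).IsSwap)
    (h1 : (ψ (s n 1)).IsSwap) {i : ℕ} (hi : i + 3 < n) : ψ (s n i) ≠ ψ (s n (i + 2)) := by
  intro h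
  obtain _ | i := i
  · obtain h4 | h4 := lt_or_ge 4 n
    · refine not_commute_map_s hψ (i := 2) (by omega) ?_
      rw [← h]
      exact commute_map_s ψ (by omega)
    · obtain rfl : n = 4 := by omega
      obtain ⟨a, b, hab, hs0⟩ := h0
      obtain ⟨z, hza, hzb, hz⟩ := swap_eq_of_not_commute hab h1 (hs0 ▸ map_s_ne hψ (by omega))
        (hs0 ▸ not_commute_map_s hψ (by omega))
      have hall := forall_of_invariant (p := fun x => x = a ∨ x = b ∨ x = z) hψ (fun i hi x hx => by
        have : ψ (s 4 i) = swap a b ∨ ψ (s 4 i) = swap b z ∨ ψ (s 4 i) = swap a z := by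
          obtain rfl | rfl | rfl : i = 0 ∨ i = 1 ∨ i = 2 := by omega
          · exact Or.inl hs0
          · exact Or.inr hz
          · exact Or.inl (h.symm.trans hs0)
        obtain h | h | h := this <;> rw [h, swap_apply_def] <;> split_ifs <;> tauto)
        (Or.inl rfl : a = a ∨ _)
      have : (Finset.univ : Finset (Fin 4)) ⊆ {a, b, z} := fun x _ => by simpa using hall x
      exact absurd ((Finset.card_le_card this).trans Finset.card_le_three) (by decide)
  · refine not_commute_map_s hψ (i := i) (by omega) ?_
    rw [h]
    exact commute_map_s ψ (by omega)

theorem exists_chain (hψ : Function.Surjective ψ) (hs : ∀ i, i + 1 < n → (ψ (s n i)).IsSwap) :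
    ∀ m, m + 2 < n → ∃ e : ℕ → Fin n,
      ∀ i ≤ m + 1, ψ (s n i) = swap (e i) (e (i + 1)) ∧ e i ≠ e (i + 1) := by
  intro m
  induction m with
  | zero =>
    intro hn
    obtain ⟨a, b, hab, hs0⟩ := hs 0 (by omega)
    obtain ⟨z, hza, hzb, hz⟩ := swap_eq_of_not_commute hab (hs 1 (by omega))
      (hs0 ▸ map_s_ne hψ (by omega)) (hs0 ▸ not_commute_map_s hψ (by omega))
    obtain hz | hz := hz
    · refine ⟨fun i => if i = 0 then a else if i = 1 then b else z, fun i hi => ?_⟩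
      obtain rfl | rfl : i = 0 ∨ i = 1 := by omega
      · exact ⟨hs0, hab⟩
      · exact ⟨hz, hzb.symm⟩
    · refine ⟨fun i => if i = 0 then b else if i = 1 then a else z, fun i hi => ?_⟩
      obtain rfl | rfl : i = 0 ∨ i = 1 := by omega
      · exact ⟨hs0.trans (swap_comm _ _), hab.symm⟩
      · exact ⟨hz, hza.symm⟩
  | succ m ih =>
    intro hm
    obtain ⟨e, he⟩ := ih (by omega)
    obtain ⟨h1, h1'⟩ := he (m + 1) le_rfl
    obtain ⟨h0, h0'⟩ := he m (by omega)
    obtain ⟨z, hz1, hz2, hz⟩ := swap_eq_of_not_commute h1' (hs (m + 2) (by omega))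
      (h1 ▸ map_s_ne hψ (by omega)) (h1 ▸ not_commute_map_s hψ (by omega))
    obtain hz | hz := hz
    · refine ⟨Function.update e (m + 3) z, fun i hi => ?_⟩
      rw [Function.update_of_ne (by omega)]
      obtain h | h := lt_or_ge i (m + 2)
      · rw [Function.update_of_ne (by omega)]
        exact he i (by omega)
      · obtain rfl : i = m + 2 := by omega
        rw [Function.update_self]
        exact ⟨hz, hz2.symm⟩
    · exfalso
      have hc : Commute (ψ (s n m)) (ψ (s n (m + 2))) := commute_map_s ψ le_rfl
      rw [h0, hz] at hc
      have := eq_of_commute_swap h0' hz1 hc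
      refine map_s_add_two_ne hψ (hs 0 (by omega)) (hs 1 (by omega)) (i := m) (by omega) ?_
      rw [h0, hz, this, swap_comm]

theorem exists_conj_eq_permFin (hψ : Function.Surjective ψ) (hn : 4 ≤ n)
    (hs : (ψ (s n 0)).IsSwap) : ∃ g : Perm (Fin n), ∀ b, ψ b = g * permFin n b * g⁻¹ := by
  have hs' : ∀ i, i + 1 < n → (ψ (s n i)).IsSwap := fun i hi => by
    rw [← Perm.card_support_eq_two] at hs ⊢
    rw [card_support_map_s ψ hi, hs]
  obtain ⟨e, he⟩ := exists_chain hψ hs' (n - 3) (by omega)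
  let f : Fin n → Fin n := fun i => e i
  have hf : Function.Surjective f := by
    intro y
    refine forall_of_invariant (p := fun y => ∃ x, f x = y) hψ (fun i hi x hx => ?_)
      ⟨⟨0, by omega⟩, rfl⟩ y
    rw [(he i (by omega)).1, swap_apply_def]
    split_ifs
    · exact ⟨⟨i + 1, hi⟩, rfl⟩
    · exact ⟨⟨i, by omega⟩, rfl⟩
    · exact hx
  let g : Perm (Fin n) := Equiv.ofBijective f (Finite.surjective_iff_bijective.1 hf)
  refine ⟨g, fun b => ?_⟩
  have : ψ = (MulAut.conj g).toMonoidHom.comp (permFin n) := hom_ext fun i hi => by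
    rw [(he i (by omega)).1, MonoidHom.comp_apply, permFin_s hi]
    exact swap_apply_apply g ⟨i, by omega⟩ ⟨i + 1, hi⟩
  rw [this]; rfl

end Chain

theorem isSwap_of_expo {n : ℕ} (hn : 4 ≤ n) {φ : B n ≃* B n}
    (hφ : ∀ b, expo n (φ b) = expo n b) : (permFin n (φ (s n 0))).IsSwap := by
  have hψ : Function.Surjective ((permFin n).comp φ.toMonoidHom) :=
    (permFin_surjective n).comp φ.surjective
  obtain rfl | rfl | rfl | h : n = 4 ∨ n = 5 ∨ n = 6 ∨ 7 ≤ n := by omega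
  · exact isSwap_of_four hφ
  · exact isSwap_of_five hψ (sign_map_s hφ (by omega))
  · exact isSwap_of_six hφ
  · exact isSwap_map_s_of_seven_le hψ h

theorem exists_eq_conj_of_expo {n : ℕ} (hn : 4 ≤ n) {φ : B n ≃* B n}
    (hφ : ∀ b, expo n (φ b) = expo n b) : ∃ g, ∀ b, φ b = g * b * g⁻¹ := by
  have hψ : Function.Surjective ((permFin n).comp φ.toMonoidHom) :=
    (permFin_surjective n).comp φ.surjective
  obtain ⟨e, he⟩ := exists_conj_eq_permFin hψ hn (isSwap_of_expo hn hφ)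
  obtain ⟨c, rfl⟩ := permFin_surjective n e
  have hE : IsExpoPreserving (φ.trans (MulAut.conj c⁻¹)) := by
    refine ⟨fun b => perm_eq_of_permFin_eq ?_, fun b => ?_⟩
    · have h1 : permFin n (φ b) = permFin n c * permFin n b * (permFin n c)⁻¹ := he b
      rw [MulEquiv.trans_apply, MulAut.conj_apply, inv_inv, map_mul, map_mul, map_inv, h1]
      group
    · rw [MulEquiv.trans_apply, MulAut.conj_apply, inv_inv, map_mul (expo n),
        map_mul (expo n), map_inv (expo n), mul_comm, mul_inv_cancel_left, hφ]
  obtain ⟨k, rfl⟩ : ∃ k, n = k + 3 := ⟨n - 3, by omega⟩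
  obtain ⟨g, -, hg⟩ := (hE.isLinkPreserving hn).isPureInner
  refine ⟨c * g, fun b => ?_⟩
  have := hg b
  rw [MulEquiv.trans_apply, MulAut.conj_apply] at this
  rw [mul_inv_rev, mul_assoc, mul_assoc c, ← mul_assoc b, ← mul_assoc g, ← mul_assoc g, ← this]
  group

/-! ### The outer automorphism group -/

/-- The endomorphism of the braid group inverting all generators. -/
def mirrorHom (n : ℕ) : B n →* B n :=
  lift (f := fun i => (s n i)⁻¹) ⟨fun i j hij _ => by
    rw [← mul_inv_rev, ← mul_inv_rev, s_comm hij], fun i hi => by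
    rw [← mul_inv_rev, ← mul_inv_rev, ← mul_inv_rev, ← mul_inv_rev, ← mul_assoc, ← mul_assoc,
      s_braid hi]⟩

theorem mirrorHom_s {n i : ℕ} (hi : i + 1 < n) : mirrorHom n (s n i) = (s n i)⁻¹ := lift_s _ hi

theorem mirrorHom_comp (n : ℕ) : (mirrorHom n).comp (mirrorHom n) = MonoidHom.id (B n) :=
  hom_ext fun i hi => by
    rw [MonoidHom.comp_apply, mirrorHom_s hi, map_inv, mirrorHom_s hi, inv_inv]; rfl

/-- The mirror automorphism of the braid group, inverting all generators. -/
def mirror (n : ℕ) : MulAut (B n) :=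
  MonoidHom.toMulEquiv (mirrorHom n) (mirrorHom n) (mirrorHom_comp n) (mirrorHom_comp n)

theorem expo_mirror {n : ℕ} (b : B n) : expo n (mirror n b) = (expo n b)⁻¹ := by
  have : (expo n).comp (mirrorHom n) = (expo n)⁻¹ := hom_ext fun i hi => by
    rw [MonoidHom.comp_apply, mirrorHom_s hi, map_inv, MonoidHom.inv_apply]
  exact DFunLike.congr_fun this b

theorem expo_map_eq {n : ℕ} (φ : B n →* B n) (b : B n) :
    expo n (φ b) = expo n (φ (s n 0)) ^ Multiplicative.toAdd (expo n b) := by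
  have : (expo n).comp φ = (zpowersHom _ (expo n (φ (s n 0)))).comp (expo n) :=
    hom_ext fun i hi => by
      obtain ⟨c, hc, -⟩ := exists_conj_s i hi
      rw [MonoidHom.comp_apply, MonoidHom.comp_apply, expo_s hi, hc, map_mul φ, map_mul φ,
        map_inv φ, map_mul (expo n), map_mul (expo n), map_inv (expo n), mul_comm,
        inv_mul_cancel_left]
      simp
  exact DFunLike.congr_fun this b

theorem expo_apply_eq_or {n : ℕ} (hn : 1 < n) (φ : B n ≃* B n) :
    (∀ b, expo n (φ b) = expo n b) ∨ ∀ b, expo n (φ b) = (expo n b)⁻¹ := by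
  have h := expo_map_eq φ.toMonoidHom
  have h1 : Multiplicative.toAdd (expo n (φ (s n 0))) *
      Multiplicative.toAdd (expo n (φ.symm (s n 0))) = 1 := by
    have := congrArg Multiplicative.toAdd (h (φ.symm (s n 0)))
    simp only [MulEquiv.coe_toMonoidHom, MulEquiv.apply_symm_apply,
      expo_s (show 0 + 1 < n by omega),
      toAdd_ofAdd, toAdd_zpow, smul_eq_mul] at this
    rw [this, mul_comm]
  obtain h2 | h2 := Int.eq_one_or_neg_one_of_mul_eq_one h1
  · left
    intro b
    refine (h b).trans (Multiplicative.toAdd.injective ?_)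
    rw [toAdd_zpow]
    exact (congrArg (_ • ·) h2).trans (by simp)
  · right
    intro b
    refine (h b).trans (Multiplicative.toAdd.injective ?_)
    rw [toAdd_zpow]
    exact (congrArg (_ • ·) h2).trans (by simp)

theorem mem_range_conj_iff {n : ℕ} (hn : 4 ≤ n) (φ : MulAut (B n)) :
    φ ∈ (MulAut.conj (G := B n)).range ↔ ∀ b, expo n (φ b) = expo n b := by
  constructor
  · rintro ⟨g, rfl⟩ b
    rw [MulAut.conj_apply, map_mul (expo n), map_mul (expo n), map_inv (expo n), mul_comm,
      inv_mul_cancel_left]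
  · intro h
    obtain ⟨g, hg⟩ := exists_eq_conj_of_expo hn h
    exact ⟨g, MulEquiv.ext fun b => (hg b).symm⟩

end BraidGroup

/-- For every `n ≥ 4`, the inner automorphism group of the braid group `B n`
(the range of the conjugation homomorphism) has index 2 in `MulAut (B n)`. -/
theorem inn_braid_index_two (n : ℕ) (hn : 4 ≤ n) :
    (MulAut.conj (G := B n)).range.index = 2 := by
  have hs : BraidGroup.expo n (BraidGroup.s n 0) = Multiplicative.ofAdd 1 :=
    BraidGroup.expo_s (by omega)
  rw [Subgroup.index_eq_two_iff]
  refine ⟨BraidGroup.mirror n, fun φ => ?_⟩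
  rw [BraidGroup.mem_range_conj_iff hn, BraidGroup.mem_range_conj_iff hn]
  simp only [MulAut.mul_apply]
  obtain h | h := BraidGroup.expo_apply_eq_or (by omega) φ
  · refine Or.inr ⟨h, fun h' => ?_⟩
    have := h' (BraidGroup.s n 0)
    rw [h, BraidGroup.expo_mirror, hs] at this
    exact absurd this (by decide)
  · refine Or.inl ⟨fun b => by rw [h, BraidGroup.expo_mirror, inv_inv], fun h' => ?_⟩
    have := h' (BraidGroup.s n 0)
    rw [h, hs] at this
    exact absurd this (by decide)
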